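/- Let q ∈ M be a point with θ(q) = 0 and 0 < |t(q)| < t₀, and suppose φ(m(t(q))) < π. Then the cut locus of q is C_q = θ⁻¹(π) ∪ (t⁻¹(−t(q)) ∩ θ⁻¹([φ(m(t(q))), 2π − φ(m(t(q)))])), i.e. C_q is the union of the meridian opposite to q and the subarc of the parallel t = −t(q) consisting of points whose θ-coordinate lies in [φ(m(t(q))), 2π − φ(m(t(q)))]. -/

import Mathlib

open Real Set

noncomputable section

/-- Length of a C¹ curve `c` on `[a,b]` in the warped product metric
`ds² = dt² + m(t)² dθ²` on `M̃ = ℝ²` (coordinates `(t,θ)`). -/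
def wLength (m : ℝ → ℝ) (c : ℝ → ℝ × ℝ) (a b : ℝ) : ℝ :=
  ∫ s in a..b,
    Real.sqrt ((deriv (fun u => (c u).1) s) ^ 2 +
      (m (c s).1) ^ 2 * (deriv (fun u => (c u).2) s) ^ 2)

/-- The Riemannian distance on `M̃`: the infimum of lengths of C¹ curves joining `p` to `q`. -/
def wDist (m : ℝ → ℝ) (p q : ℝ × ℝ) : ℝ :=
  sInf {L : ℝ | ∃ c : ℝ → ℝ × ℝ, ∃ b : ℝ, 0 ≤ b ∧ ContDiff ℝ 1 c ∧
    c 0 = p ∧ c b = q ∧ L = wLength m c 0 b}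

/-- `γ = (t(s), θ(s))` is a unit-speed geodesic of the warped product metric:
`t'' = m(t) m'(t) θ'²`, `m(t)² θ'` is constant, and `t'² + m(t)² θ'² = 1`. -/
def IsUnitGeodesic (m : ℝ → ℝ) (γ : ℝ → ℝ × ℝ) : Prop :=
  ContDiff ℝ 2 γ ∧
  (∀ s, deriv (deriv fun u => (γ u).1) s =
      m (γ s).1 * deriv m (γ s).1 * (deriv (fun u => (γ u).2) s) ^ 2) ∧
  (∃ ν : ℝ, ∀ s, m (γ s).1 ^ 2 * deriv (fun u => (γ u).2) s = ν) ∧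
  (∀ s, (deriv (fun u => (γ u).1) s) ^ 2 +
      m (γ s).1 ^ 2 * (deriv (fun u => (γ u).2) s) ^ 2 = 1)

/-- `ν` is the Clairaut constant of the geodesic `γ`: `m(t(s))² θ'(s) = ν` for all `s`. -/
def HasClairaut (m : ℝ → ℝ) (γ : ℝ → ℝ × ℝ) (ν : ℝ) : Prop :=
  ∀ s, m (γ s).1 ^ 2 * deriv (fun u => (γ u).2) s = ν

/-- The (unit-speed) geodesic segment `γ|[0,a]` is minimal: its length `a` equals
the distance between its endpoints. -/
def IsMinimalSeg (m : ℝ → ℝ) (γ : ℝ → ℝ × ℝ) (a : ℝ) : Prop :=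
  wDist m (γ 0) (γ a) = a

/-- `x` is a cut point of `p`: the endpoint of some minimal geodesic segment from `p`
no extension of which is minimal. -/
def IsCutPoint (m : ℝ → ℝ) (p x : ℝ × ℝ) : Prop :=
  ∃ γ : ℝ → ℝ × ℝ, ∃ a : ℝ, IsUnitGeodesic m γ ∧ γ 0 = p ∧ 0 < a ∧ γ a = x ∧
    IsMinimalSeg m γ a ∧ ∀ ε > 0, ¬ IsMinimalSeg m γ (a + ε)

/-- The cut locus of `p` in `M̃`. -/
def cutLocus (m : ℝ → ℝ) (p : ℝ × ℝ) : Set (ℝ × ℝ) := {x | IsCutPoint m p x}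

/-- The Gaussian curvature `K(t) = -m''(t)/m(t)` of the warped product metric. -/
def gaussK (m : ℝ → ℝ) (t : ℝ) : ℝ := -(deriv (deriv m) t) / m t

/-- `ξ(ν) := min {t > 0 | m t = ν}`. -/
def xi (m : ℝ → ℝ) (ν : ℝ) : ℝ := sInf {t : ℝ | 0 < t ∧ m t = ν}

/-- `φ(ν) := 2∫₀^{ξ(ν)} ν / (m(t) √(m(t)² - ν²)) dt`. -/
def phi (m : ℝ → ℝ) (ν : ℝ) : ℝ :=
  2 * ∫ t in (0:ℝ)..(xi m ν), ν / (m t * Real.sqrt ((m t) ^ 2 - ν ^ 2))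

/-- `l(ν) := 2∫_{-ξ(ν)}^{0} m(t) / √(m(t)² - ν²) dt`. -/
def ell (m : ℝ → ℝ) (ν : ℝ) : ℝ :=
  2 * ∫ t in (-(xi m ν))..(0:ℝ), m t / Real.sqrt ((m t) ^ 2 - ν ^ 2)

/-- `inf m`. -/
def infm (m : ℝ → ℝ) : ℝ := ⨅ t : ℝ, m t

/-- `t₀ := sup {t > 0 | m'(t) < 0}`. -/
def tZero (m : ℝ → ℝ) : ℝ := sSup {t : ℝ | 0 < t ∧ deriv m t < 0}

/-- The covering projection from `M̃ = ℝ²` to the cylinder `M = ℝ × S¹`,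
where the angular coordinate is taken modulo `2π`. -/
def proj (p : ℝ × ℝ) : ℝ × Real.Angle := (p.1, (p.2 : Real.Angle))

/-- The Riemannian distance on the cylinder `M`: the infimum of lengths of curves
joining the two points, computed via lifts to `M̃`. -/
def cylDist (m : ℝ → ℝ) (P Q : ℝ × Real.Angle) : ℝ :=
  sInf {L : ℝ | ∃ p q : ℝ × ℝ, proj p = P ∧ proj q = Q ∧ L = wDist m p q}

/-- A unit-speed geodesic of the cylinder `M` is the projection of a unit-speed
geodesic of `M̃`. -/
def IsCylGeodesic (m : ℝ → ℝ) (γ : ℝ → ℝ × Real.Angle) : Prop :=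
  ∃ γ' : ℝ → ℝ × ℝ, IsUnitGeodesic m γ' ∧ γ = fun s => proj (γ' s)

/-- The (unit-speed) geodesic segment `γ|[0,a]` in `M` is minimal. -/
def IsCylMinimalSeg (m : ℝ → ℝ) (γ : ℝ → ℝ × Real.Angle) (a : ℝ) : Prop :=
  cylDist m (γ 0) (γ a) = a

/-- The cut locus of the point `P` on the cylinder `M`. -/
def cylCutLocus (m : ℝ → ℝ) (P : ℝ × Real.Angle) : Set (ℝ × Real.Angle) :=
  {X | ∃ γ : ℝ → ℝ × Real.Angle, ∃ a : ℝ, IsCylGeodesic m γ ∧ γ 0 = P ∧ 0 < a ∧ γ a = X ∧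
    IsCylMinimalSeg m γ a ∧ ∀ ε > 0, ¬ IsCylMinimalSeg m γ (a + ε)}

section
open Real Set
/-- Shape facts for the profile `m`. -/
structure Shape (m : ℝ → ℝ) (t0 : ℝ) : Prop where
  smooth : ContDiff ℝ (⊤:ℕ∞) m
  pos : ∀ t, 0 < m t
  even : ∀ t, m (-t) = m t
  t0pos : 0 < t0
  dneg : ∀ t ∈ Ioo 0 t0, deriv m t < 0
  dt0 : deriv m t0 = 0
  dpos : ∀ t, t0 < t → 0 ≤ deriv m t
  Kineq : ∀ t ∈ Ioo 0 t0, gaussK m t * (m 0 ^ 2 - m t ^ 2) ≤ (deriv m t) ^ 2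

lemma smooth_hasDerivAt {m : ℝ → ℝ} (hm : ContDiff ℝ (⊤:ℕ∞) m) (t : ℝ) :
    HasDerivAt m (deriv m t) t :=
  ((hm.differentiable (by simp)) t).hasDerivAt

lemma smooth_deriv {m : ℝ → ℝ} (hm : ContDiff ℝ (⊤:ℕ∞) m) : ContDiff ℝ (⊤:ℕ∞) (deriv m) := by
  have := (contDiff_infty_iff_deriv (𝕜 := ℝ) (f := m)).1 hm
  exact this.2

lemma shape_of_hyp (m : ℝ → ℝ) (hm : ContDiff ℝ (⊤:ℕ∞) m) (hmpos : ∀ t, 0 < m t)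
    (hmeven : ∀ t, m (-t) = m t)
    (hK0 : 0 < gaussK m 0) (hKdec : AntitoneOn (gaussK m) (Ici 0))
    (h0 : 0 < tZero m) : Shape m (tZero m) := by
  have hd := smooth_hasDerivAt hm
  have hm' := smooth_deriv hm
  have hdd := smooth_hasDerivAt hm'
  have hc' : Continuous (deriv m) := hm'.continuous
  have hd0 : deriv m 0 = 0 := by
    have h1 : HasDerivAt (fun t => m (-t)) (-(deriv m 0)) 0 := by
      have := HasDerivAt.comp (0:ℝ) (h₂ := m) (h := fun t => -t) (hd (-0)) (hasDerivAt_neg (0:ℝ))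
      simpa [Function.comp_def] using this
    have h2 : (fun t => m (-t)) = m := funext hmeven
    rw [h2] at h1
    have := h1.unique (hd 0)
    linarith
  have hm2 : ∀ t, deriv (deriv m) t = - (gaussK m t * m t) := by
    intro t
    have := (hmpos t).ne'
    simp only [gaussK]; field_simp
  set S := {t : ℝ | 0 < t ∧ deriv m t < 0} with hS
  have hSne : S.Nonempty := by
    by_contra h
    rw [not_nonempty_iff_eq_empty] at h
    simp only [tZero] at h0
    rw [← hS, h] at h0
    simp at h0
  have hSbdd : BddAbove S := by
    by_contra h
    simp only [tZero] at h0
    rw [← hS, Real.sSup_of_not_bddAbove h] at h0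
    simp at h0
  have hlub : IsLUB S (tZero m) := isLUB_csSup hSne hSbdd
  set t0 := tZero m
  have hdpos : ∀ t, t0 < t → 0 ≤ deriv m t := by
    intro t ht
    by_contra h
    have : t ∈ S := ⟨h0.trans ht, not_le.1 h⟩
    exact absurd (hlub.1 this) (not_le.2 ht)
  -- negativity
  have hdneg : ∀ t ∈ Ioo 0 t0, deriv m t < 0 := by
    intro t1 ht1
    by_contra hcon
    push Not at hcon
    obtain ⟨t2, ht2S, ht2, -⟩ := hlub.exists_between ht1.2
    -- there is u in (0,t1) with m''(u) > 0
    have hex : ∃ u, 0 ≤ u ∧ u ≤ t1 ∧ 0 < deriv (deriv m) u := by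
      by_contra hno
      push Not at hno
      have hanti : AntitoneOn (deriv m) (Icc 0 t1) := by
        apply antitoneOn_of_deriv_nonpos (convex_Icc _ _) hc'.continuousOn
        · intro x hx; exact (hdd x).differentiableAt.differentiableWithinAt
        · intro x hx
          rw [interior_Icc] at hx
          exact hno x hx.1.le hx.2.le
      have hzero : ∀ x ∈ Icc 0 t1, deriv m x = 0 := by
        intro x hx
        have a1 := hanti ⟨le_refl 0, ht1.1.le⟩ hx hx.1
        have a2 := hanti hx ⟨ht1.1.le, le_refl t1⟩ hx.2
        rw [hd0] at a1
        linarith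
      have h00 : deriv (deriv m) 0 = 0 := by
        have e1 : HasDerivWithinAt (deriv m) (deriv (deriv m) 0) (Icc 0 t1) 0 := (hdd 0).hasDerivWithinAt
        have e2 : HasDerivWithinAt (deriv m) 0 (Icc 0 t1) 0 :=
          (hasDerivWithinAt_const (0:ℝ) (Icc 0 t1) (0:ℝ)).congr hzero (hzero 0 ⟨le_refl 0, ht1.1.le⟩)
        exact (uniqueDiffOn_Icc ht1.1 0 ⟨le_refl 0, ht1.1.le⟩).eq_deriv _ e1 e2
      rw [hm2] at h00
      have := mul_pos hK0 (hmpos 0)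
      linarith
    obtain ⟨u, hu0, hu1, hu2⟩ := hex
    have hKu : gaussK m u < 0 := by
      rw [hm2] at hu2
      by_contra h
      have := mul_nonneg (not_lt.1 h) (hmpos u).le
      linarith
    have hmono : MonotoneOn (deriv m) (Ici u) := by
      apply monotoneOn_of_deriv_nonneg (convex_Ici _) hc'.continuousOn
      · intro x hx; exact (hdd x).differentiableAt.differentiableWithinAt
      · intro x hx
        rw [interior_Ici] at hx
        have hx' : u < x := hx
        have : gaussK m x ≤ gaussK m u := hKdec hu0 (hu0.trans hx'.le) hx'.le
        rw [hm2]
        have h3 := mul_pos_of_neg_of_neg hKu (neg_neg_of_pos (hmpos x))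
        have h4 : gaussK m x * m x ≤ gaussK m u * m x := mul_le_mul_of_nonneg_right this (hmpos x).le
        linarith
    have := hmono (show u ≤ t1 from hu1) (show u ≤ t2 from hu1.trans ht2.le) ht2.le
    linarith [ht2S.2]
  have hdt0 : deriv m t0 = 0 := by
    apply le_antisymm
    · have : Filter.Tendsto (deriv m) (nhdsWithin t0 (Iio t0)) (nhds (deriv m t0)) :=
        hc'.continuousAt.mono_left nhdsWithin_le_nhds
      refine le_of_tendsto this ?_
      filter_upwards [Ioo_mem_nhdsLT h0] with x hx using (hdneg x hx).le
    · have : Filter.Tendsto (deriv m) (nhdsWithin t0 (Ioi t0)) (nhds (deriv m t0)) :=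
        hc'.continuousAt.mono_left nhdsWithin_le_nhds
      refine ge_of_tendsto this ?_
      filter_upwards [self_mem_nhdsWithin] with x hx using hdpos x hx
  refine ⟨hm, hmpos, hmeven, h0, hdneg, hdt0, hdpos, ?_⟩
  intro t ht
  let g : ℝ → ℝ := fun u => (deriv m u) ^ 2 - gaussK m t * (m 0 ^ 2 - m u ^ 2)
  have hg : ∀ u, HasDerivAt g (2 * deriv m u * deriv (deriv m) u + gaussK m t * (2 * m u * deriv m u)) u := by
    intro u
    have h1 := ((hdd u).pow 2).sub ((((hd u).pow 2).const_sub (m 0 ^ 2)).const_mul (gaussK m t))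
    refine HasDerivAt.congr_deriv (f := g) h1 ?_
    push_cast; ring
  have hgm : MonotoneOn g (Icc 0 t) := by
    apply monotoneOn_of_deriv_nonneg (convex_Icc _ _)
    · exact fun u _ => (hg u).continuousAt.continuousWithinAt
    · exact fun u _ => (hg u).differentiableAt.differentiableWithinAt
    · intro u hu
      rw [interior_Icc] at hu
      rw [(hg u).deriv, hm2]
      have hK : gaussK m t ≤ gaussK m u := hKdec hu.1.le ht.1.le hu.2.le
      have hn := hdneg u ⟨hu.1, hu.2.trans ht.2⟩
      have e : 2 * deriv m u * -(gaussK m u * m u) + gaussK m t * (2 * m u * deriv m u)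
        = 2 * m u * (-(deriv m u)) * (gaussK m u - gaussK m t) := by ring
      rw [e]
      have := hmpos u
      apply mul_nonneg (mul_nonneg (by linarith) (by linarith)) (by linarith)
  have := hgm ⟨le_refl 0, ht.1.le⟩ ⟨ht.1.le, le_refl t⟩ ht.1.le
  simp only [g, hd0] at this
  linarith

namespace Shape
variable {m : ℝ → ℝ} {t0 : ℝ}

lemma hd (S : Shape m t0) (t : ℝ) : HasDerivAt m (deriv m t) t := smooth_hasDerivAt S.smooth t
lemma cont (S : Shape m t0) : Continuous m := S.smooth.continuous
lemma contd (S : Shape m t0) : Continuous (deriv m) := (smooth_deriv S.smooth).continuous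
lemma hdd (S : Shape m t0) (t : ℝ) : HasDerivAt (deriv m) (deriv (deriv m) t) t :=
  smooth_hasDerivAt (smooth_deriv S.smooth) t

lemma abs_eq (S : Shape m t0) (t : ℝ) : m |t| = m t := by
  rcases abs_choice t with h | h <;> rw [h]
  exact S.even t

lemma odd_d (S : Shape m t0) (t : ℝ) : deriv m (-t) = - deriv m t := by
  have h1 : HasDerivAt (fun t => m (-t)) (-(deriv m (-t))) t := by
    have := HasDerivAt.comp t (h₂ := m) (h := fun t => -t) (S.hd (-t)) (hasDerivAt_neg t)
    simpa [Function.comp_def] using this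
  have h2 : (fun t => m (-t)) = m := funext S.even
  rw [h2] at h1
  have := h1.unique (S.hd t)
  linarith

lemma anti (S : Shape m t0) : StrictAntiOn m (Icc 0 t0) := by
  apply strictAntiOn_of_deriv_neg (convex_Icc _ _) S.cont.continuousOn
  intro x hx
  rw [interior_Icc] at hx
  exact S.dneg x hx

lemma min (S : Shape m t0) (t : ℝ) : m t0 ≤ m t := by
  rw [← S.abs_eq t]
  rcases le_total |t| t0 with h | h
  · exact S.anti.antitoneOn ⟨abs_nonneg t, h⟩ ⟨S.t0pos.le, le_refl _⟩ h
  · have : MonotoneOn m (Ici t0) := by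
      apply monotoneOn_of_deriv_nonneg (convex_Ici _) S.cont.continuousOn
      · exact fun x _ => (S.hd x).differentiableAt.differentiableWithinAt
      · intro x hx
        rw [interior_Ici] at hx
        exact S.dpos x hx
    exact this (le_refl t0) h h

lemma lt_of (S : Shape m t0) {a b : ℝ} (h : |a| < |b|) (hb : |b| ≤ t0) : m b < m a := by
  rw [← S.abs_eq a, ← S.abs_eq b]
  exact S.anti ⟨abs_nonneg a, h.le.trans hb⟩ ⟨abs_nonneg b, hb⟩ h

lemma le_of (S : Shape m t0) {a b : ℝ} (h : |a| ≤ |b|) (hb : |b| ≤ t0) : m b ≤ m a := by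
  rw [← S.abs_eq a, ← S.abs_eq b]
  exact S.anti.antitoneOn ⟨abs_nonneg a, h.trans hb⟩ ⟨abs_nonneg b, hb⟩ h

lemma min_lt (S : Shape m t0) {a : ℝ} (h : |a| < t0) : m t0 < m a :=
  S.lt_of (by rwa [abs_of_pos S.t0pos]) (by rw [abs_of_pos S.t0pos])

lemma le_max (S : Shape m t0) {a : ℝ} (h : |a| ≤ t0) : m a ≤ m 0 :=
  S.le_of (by simp) h

/-- every value in `[m t0, m 0]` is attained -/
lemma exists_eq (S : Shape m t0) {ν T : ℝ} (hT : 0 ≤ T) (hTt : T ≤ t0) (h1 : m t0 ≤ ν) (h2 : ν ≤ m T) :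
    ∃ b, T ≤ b ∧ b ≤ t0 ∧ m b = ν := by
  have := intermediate_value_Icc' hTt S.cont.continuousOn (show ν ∈ Icc (m t0) (m T) from ⟨h1, h2⟩)
  obtain ⟨b, hb, rfl⟩ := this
  exact ⟨b, hb.1, hb.2, rfl⟩

/-- quadratic bound near `t0` -/
lemma quad (S : Shape m t0) : ∃ C > 0, ∀ x ∈ Icc 0 t0, m x ^ 2 - m t0 ^ 2 ≤ C * (t0 - x) ^ 2 := by
  obtain ⟨C, hC⟩ := (isCompact_Icc (a := (0:ℝ)) (b := t0)).exists_bound_of_continuousOn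
    (f := deriv (deriv m)) (smooth_deriv (smooth_deriv S.smooth)).continuous.continuousOn
  have hC0 : 0 ≤ C := (norm_nonneg _).trans (hC 0 ⟨le_refl 0, S.t0pos.le⟩)
  have h1 : ∀ x ∈ Icc 0 t0, -(deriv m x) ≤ C * (t0 - x) := by
    intro x hx
    have := (convex_Icc (0:ℝ) t0).norm_image_sub_le_of_norm_deriv_le (f := deriv m) (C := C)
      (fun y _ => (S.hdd y).differentiableAt) (fun y hy => hC y hy) hx ⟨S.t0pos.le, le_refl t0⟩
    rw [S.dt0, zero_sub, norm_neg, Real.norm_eq_abs, Real.norm_eq_abs, abs_of_nonneg (sub_nonneg.2 hx.2)] at this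
    exact (neg_le_abs _).trans this
  have h2 : ∀ x ∈ Icc 0 t0, m x - m t0 ≤ C * (t0 - x) ^ 2 := by
    intro x hx
    have := (convex_Icc x t0).norm_image_sub_le_of_norm_deriv_le (f := m) (C := C * (t0 - x))
      (fun y _ => (S.hd y).differentiableAt) (fun y hy => by
        have hy' : y ∈ Icc 0 t0 := ⟨hx.1.trans hy.1, hy.2⟩
        have hle : deriv m y ≤ 0 := by
          rcases eq_or_lt_of_le hy'.2 with h | h
          · rw [h, S.dt0]
          · rcases eq_or_lt_of_le hy'.1 with h' | h'
            · have := S.odd_d 0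
              rw [neg_zero] at this
              rw [← h']; linarith
            · exact (S.dneg y ⟨h', h⟩).le
        rw [Real.norm_eq_abs, abs_of_nonpos hle]
        exact (h1 y hy').trans (mul_le_mul_of_nonneg_left (by linarith [hy.1]) hC0)) 
      (left_mem_Icc.2 hx.2) (right_mem_Icc.2 hx.2)
    rw [Real.norm_eq_abs, Real.norm_eq_abs, abs_of_nonneg (sub_nonneg.2 hx.2), abs_sub_comm] at this
    refine (le_abs_self _).trans (this.trans (le_of_eq ?_))
    ring
  refine ⟨(C + 1) * (2 * m 0), by have := S.pos 0; positivity, fun x hx => ?_⟩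
  have e : m x ^ 2 - m t0 ^ 2 = (m x - m t0) * (m x + m t0) := by ring
  have h3 : m x ≤ m 0 := S.le_max (by rw [abs_of_nonneg hx.1]; exact hx.2)
  have h4 : m t0 ≤ m 0 := S.min 0
  rw [e]
  have h5 := S.min x
  have h6 := S.pos t0
  calc (m x - m t0) * (m x + m t0) ≤ (C * (t0 - x) ^ 2) * (2 * m 0) := by
        apply mul_le_mul (h2 x hx) (by linarith) (by linarith [S.pos x]) (by positivity)
    _ ≤ (C + 1) * (2 * m 0) * (t0 - x) ^ 2 := by
        have : 0 ≤ (t0 - x) ^ 2 * (2 * m 0) := by have := S.pos 0; positivity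
        nlinarith

end Shape
end

section
open Real Set
def fF (m : ℝ → ℝ) (n x : ℝ) : ℝ := √(m x ^ 2 - n ^ 2) / m x
def FF (m : ℝ → ℝ) (n x : ℝ) : ℝ := ∫ u in (0:ℝ)..x, fF m n u
def rho (m : ℝ → ℝ) (n x : ℝ) : ℝ := n / (m x * √(m x ^ 2 - n ^ 2))
def Th (m : ℝ → ℝ) (n x : ℝ) : ℝ := ∫ u in (0:ℝ)..x, rho m n u
def XX (m : ℝ → ℝ) (t : ℝ) : ℝ := √(1 / m t ^ 2 - 1 / m 0 ^ 2)
def XX' (m : ℝ → ℝ) (t : ℝ) : ℝ := (-deriv m t / m t ^ 3) / XX m t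
def psi (m : ℝ → ℝ) (t : ℝ) : ℝ := √(m 0 ^ 2 - m t ^ 2) / (m 0 * (-deriv m t))

namespace Shape
variable {m : ℝ → ℝ} {t0 : ℝ}

lemma XX_pos (S : Shape m t0) {t : ℝ} (h : t ∈ Ioc 0 t0) : 0 < XX m t := by
  apply Real.sqrt_pos.2
  have h1 : m t < m 0 := S.lt_of (by simpa using h.1.ne') (by rw [abs_of_pos h.1]; exact h.2)
  have := S.pos t
  have : 1 / m 0 ^ 2 < 1 / m t ^ 2 := by
    apply one_div_lt_one_div_of_lt (by positivity)
    gcongr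
  linarith

lemma XX_sq (S : Shape m t0) {t : ℝ} (h : |t| ≤ t0) : XX m t ^ 2 = 1 / m t ^ 2 - 1 / m 0 ^ 2 := by
  apply Real.sq_sqrt
  have h1 := S.le_max h
  have := S.pos t
  have : 1 / m 0 ^ 2 ≤ 1 / m t ^ 2 := by
    apply one_div_le_one_div_of_le (by positivity)
    gcongr
  linarith

lemma XX_zero : XX m 0 = 0 := by simp [XX]

lemma XX_cont (S : Shape m t0) : Continuous (XX m) := by
  unfold XX
  have := S.cont
  refine Continuous.sqrt (Continuous.sub (Continuous.div continuous_const (by fun_prop) ?_) continuous_const)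
  intro x; have := S.pos x; positivity

lemma XX_deriv (S : Shape m t0) {t : ℝ} (h : t ∈ Ioo 0 t0) : HasDerivAt (XX m) (XX' m t) t := by
  have hp := S.XX_pos ⟨h.1, h.2.le⟩
  have hm := S.pos t
  have hne : 1 / m t ^ 2 - 1 / m 0 ^ 2 ≠ 0 := by
    intro h0; rw [XX, h0] at hp; simp at hp
  have h1 : HasDerivAt (fun t => 1 / m t ^ 2 - 1 / m 0 ^ 2) (-2 * deriv m t / m t ^ 3) t := by
    have := (((S.hd t).pow 2).inv (by simp only [Pi.pow_apply]; positivity)).sub_const (1 / m 0 ^ 2)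
    simp only [one_div] at this ⊢
    refine HasDerivAt.congr_deriv this ?_
    simp only [Pi.pow_apply]
    push_cast
    field_simp
  have h2 := h1.sqrt hne
  refine HasDerivAt.congr_deriv h2 ?_
  unfold XX' XX
  have : 0 < √(1 / m t ^ 2 - 1 / m 0 ^ 2) := hp
  field_simp

lemma XX'_pos (S : Shape m t0) {t : ℝ} (h : t ∈ Ioo 0 t0) : 0 < XX' m t := by
  have hp := S.XX_pos ⟨h.1, h.2.le⟩
  have hm := S.pos t
  have hn := S.dneg t h
  unfold XX'
  apply div_pos (div_pos (by linarith) (by positivity)) hp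

lemma XX_mono (S : Shape m t0) : StrictMonoOn (XX m) (Icc 0 t0) := by
  apply strictMonoOn_of_deriv_pos (convex_Icc _ _) S.XX_cont.continuousOn
  intro x hx
  rw [interior_Icc] at hx
  rw [(S.XX_deriv hx).deriv]
  exact S.XX'_pos hx

lemma psi_eq (S : Shape m t0) {t : ℝ} (h : t ∈ Ioo 0 t0) : psi m t = 1 / (m t ^ 2 * XX' m t) := by
  have hp := S.XX_pos ⟨h.1, h.2.le⟩
  have hm := S.pos t
  have hm0 := S.pos 0
  have hn := S.dneg t h
  have e : √(m 0 ^ 2 - m t ^ 2) = m t * m 0 * XX m t := by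
    rw [Real.sqrt_eq_iff_eq_sq]
    · rw [mul_pow, S.XX_sq (by rw [abs_of_pos h.1]; exact h.2.le)]
      field_simp
    · have := S.le_max (show |t| ≤ t0 by rw [abs_of_pos h.1]; exact h.2.le)
      have : m t ^ 2 ≤ m 0 ^ 2 := by gcongr
      linarith
    · positivity
  unfold psi XX'
  rw [e]
  have hn' : deriv m t ≠ 0 := hn.ne
  field_simp

lemma psi_pos (S : Shape m t0) {t : ℝ} (h : t ∈ Ioo 0 t0) : 0 < psi m t := by
  rw [S.psi_eq h]
  have := S.XX'_pos h
  have := S.pos t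
  positivity

lemma psi_zero : psi m 0 = 0 := by simp [psi]

lemma psi_mono (S : Shape m t0) : MonotoneOn (psi m) (Ico 0 t0) := by
  -- first on the open interval, through the square
  have key : MonotoneOn (fun t => (m 0 ^ 2 - m t ^ 2) / (deriv m t) ^ 2) (Ioo 0 t0) := by
    have hder : ∀ t ∈ Ioo 0 t0, HasDerivAt (fun t => (m 0 ^ 2 - m t ^ 2) / (deriv m t) ^ 2)
        ((-(2 * m t * deriv m t) * (deriv m t) ^ 2 -
          (m 0 ^ 2 - m t ^ 2) * (2 * deriv m t * deriv (deriv m) t)) / ((deriv m t) ^ 2) ^ 2) t := by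
      intro t ht
      have hn := (S.dneg t ht).ne
      have h1 := (((S.hd t).pow 2).const_sub (m 0 ^ 2)).div ((S.hdd t).pow 2) (by simp only [Pi.pow_apply]; positivity)
      refine HasDerivAt.congr_deriv (f := (fun t => (m 0 ^ 2 - m t ^ 2) / (deriv m t) ^ 2)) h1 ?_
      simp only [Pi.pow_apply]
      push_cast
      ring
    apply monotoneOn_of_deriv_nonneg (convex_Ioo _ _)
    · exact fun t ht => (hder t ht).continuousAt.continuousWithinAt
    · intro t ht
      rw [interior_Ioo] at ht
      exact (hder t ht).differentiableAt.differentiableWithinAt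
    · intro t ht
      rw [interior_Ioo] at ht
      rw [(hder t ht).deriv]
      apply div_nonneg _ (by positivity)
      have hm := S.pos t
      have hK := S.Kineq t ht
      have hm2 : deriv (deriv m) t = - (gaussK m t * m t) := by
        simp only [gaussK]; field_simp
      rw [hm2]
      have e : -(2 * m t * deriv m t) * deriv m t ^ 2 -
        (m 0 ^ 2 - m t ^ 2) * (2 * deriv m t * -(gaussK m t * m t)) =
        2 * m t * (-deriv m t) * ((deriv m t) ^ 2 - gaussK m t * (m 0 ^ 2 - m t ^ 2)) := by ring
      rw [e]
      have hn := S.dneg t ht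
      exact mul_nonneg (mul_nonneg (by linarith) (by linarith)) (by linarith)
  intro x hx y hy hxy
  rcases eq_or_lt_of_le hx.1 with h0 | h0
  · rw [← h0, psi_zero]
    rcases eq_or_lt_of_le hy.1 with h1 | h1
    · rw [← h1, psi_zero]
    · exact (S.psi_pos ⟨h1, hy.2⟩).le
  have hx' : x ∈ Ioo 0 t0 := ⟨h0, hx.2⟩
  have hy' : y ∈ Ioo 0 t0 := ⟨h0.trans_le hxy, hy.2⟩
  have e : ∀ t ∈ Ioo 0 t0, psi m t = √((m 0 ^ 2 - m t ^ 2) / (deriv m t) ^ 2) / m 0 := by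
    intro t ht
    have hn := S.dneg t ht
    have hm0 := S.pos 0
    have : √((deriv m t) ^ 2) = - deriv m t := by
      rw [Real.sqrt_sq_eq_abs, abs_of_neg hn]
    rw [Real.sqrt_div' _ (by positivity), this, psi]
    have : deriv m t ≠ 0 := hn.ne
    field_simp
  rw [e x hx', e y hy']
  have := key hx' hy' hxy
  have := S.pos 0
  gcongr

lemma psi_cont (S : Shape m t0) : ContinuousOn (psi m) (Ioo 0 t0) := by
  unfold psi
  have h1 := S.cont
  have h2 := S.contd
  refine ContinuousOn.div (by fun_prop) (by fun_prop) ?_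
  intro t ht
  have := S.dneg t ht
  have := S.pos 0
  apply mul_ne_zero <;> linarith

/-- inverse of `XX` on `[0,t0]` -/
lemma exists_inv (S : Shape m t0) : ∃ T : ℝ → ℝ, (∀ t ∈ Icc 0 t0, T (XX m t) = t) ∧
    StrictMonoOn T (Icc 0 (XX m t0)) ∧ (∀ x ∈ Ico 0 (XX m t0), T x ∈ Ico 0 t0) ∧
    (∀ x ∈ Ioo 0 (XX m t0), T x ∈ Ioo 0 t0 ∧ ContinuousAt T x) := by
  have hmono := S.XX_mono
  have ht0 := S.t0pos
  have himg : XX m '' Icc 0 t0 = Icc 0 (XX m t0) := by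
    apply Subset.antisymm
    · rintro _ ⟨t, ht, rfl⟩
      exact ⟨Real.sqrt_nonneg _, hmono.monotoneOn ht ⟨ht0.le, le_refl _⟩ ht.2⟩
    · have := intermediate_value_Icc ht0.le S.XX_cont.continuousOn
      rwa [XX_zero] at this
  let T := Function.invFunOn (XX m) (Icc 0 t0)
  have hT : ∀ t ∈ Icc 0 t0, T (XX m t) = t := fun t ht => hmono.injOn.leftInvOn_invFunOn ht
  have hTm : StrictMonoOn T (Icc 0 (XX m t0)) := by
    rw [← himg]
    rintro _ ⟨x, hx, rfl⟩ _ ⟨y, hy, rfl⟩ hxy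
    rw [hT x hx, hT y hy]
    exact (hmono.lt_iff_lt hx hy).1 hxy
  have hT0 : T 0 = 0 := by
    have := hT 0 ⟨le_refl _, ht0.le⟩
    rwa [XX_zero] at this
  have hTt : T (XX m t0) = t0 := hT t0 ⟨ht0.le, le_refl _⟩
  have hX0 : 0 < XX m t0 := S.XX_pos ⟨ht0, le_refl _⟩
  refine ⟨T, hT, hTm, ?_, ?_⟩
  · intro x hx
    constructor
    · have := hTm.monotoneOn ⟨le_refl _, hX0.le⟩ ⟨hx.1, hx.2.le⟩ hx.1
      rwa [hT0] at this
    · have := hTm ⟨hx.1, hx.2.le⟩ ⟨hX0.le, le_refl _⟩ hx.2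
      rwa [hTt] at this
  · intro x hx
    have hIoo : T x ∈ Ioo 0 t0 := by
      constructor
      · have := hTm ⟨le_refl _, hX0.le⟩ ⟨hx.1.le, hx.2.le⟩ hx.1
        rwa [hT0] at this
      · have := hTm ⟨hx.1.le, hx.2.le⟩ ⟨hX0.le, le_refl _⟩ hx.2
        rwa [hTt] at this
    refine ⟨hIoo, ?_⟩
    apply hTm.continuousAt_of_image_mem_nhds (Icc_mem_nhds hx.1 hx.2)
    have : T '' Icc 0 (XX m t0) = Icc 0 t0 := by
      rw [← himg, image_image]
      apply Subset.antisymm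
      · rintro _ ⟨y, hy, rfl⟩
        show T (XX m y) ∈ _
        rw [hT y hy]; exact hy
      · intro y hy
        exact ⟨y, hy, hT y hy⟩
    rw [this]
    exact Icc_mem_nhds hIoo.1 hIoo.2

end Shape
end

section
open Real Set MeasureTheory
def JJ (m : ℝ → ℝ) (b t : ℝ) : ℝ := arcsin (XX m t / XX m b)
def JJ' (m : ℝ → ℝ) (b t : ℝ) : ℝ := 1 / √(1 - (XX m t / XX m b) ^ 2) * (XX' m t / XX m b)

namespace Shape
variable {m : ℝ → ℝ} {t0 : ℝ}

lemma ratio (S : Shape m t0) {b t : ℝ} (hb : b ∈ Ioo 0 t0) (ht : t ∈ Ioo 0 b) :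
    XX m t / XX m b ∈ Ioo (0:ℝ) 1 := by
  have h1 := S.XX_pos ⟨ht.1, (ht.2.trans hb.2).le⟩
  have h2 := S.XX_pos ⟨hb.1, hb.2.le⟩
  refine ⟨div_pos h1 h2, ?_⟩
  rw [div_lt_one h2]
  exact S.XX_mono ⟨ht.1.le, (ht.2.trans hb.2).le⟩ ⟨hb.1.le, hb.2.le⟩ ht.2

lemma JJ_deriv (S : Shape m t0) {b t : ℝ} (hb : b ∈ Ioo 0 t0) (ht : t ∈ Ioo 0 b) :
    HasDerivAt (JJ m b) (JJ' m b t) t := by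
  have hr := S.ratio hb ht
  have h := (S.XX_deriv ⟨ht.1, ht.2.trans hb.2⟩).div_const (XX m b)
  exact (hasDerivAt_arcsin (by linarith [hr.1]) hr.2.ne).comp t h

lemma JJ_cont (S : Shape m t0) {b : ℝ} : Continuous (JJ m b) :=
  continuous_arcsin.comp (S.XX_cont.div_const _)

lemma JJ'_pos (S : Shape m t0) {b t : ℝ} (hb : b ∈ Ioo 0 t0) (ht : t ∈ Ioo 0 b) :
    0 ≤ JJ' m b t := by
  have := S.XX'_pos ⟨ht.1, ht.2.trans hb.2⟩
  have := S.XX_pos ⟨hb.1, hb.2.le⟩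
  unfold JJ'; positivity

lemma JJ_zero {b : ℝ} : JJ m b 0 = 0 := by simp [JJ, XX_zero]
lemma JJ_b (S : Shape m t0) {b : ℝ} (hb : b ∈ Ioo 0 t0) : JJ m b b = π / 2 := by
  have := S.XX_pos ⟨hb.1, hb.2.le⟩
  simp [JJ, this.ne']

lemma psi_JJ' (S : Shape m t0) {b t : ℝ} (hb : b ∈ Ioo 0 t0) (ht : t ∈ Ioo 0 b) :
    psi m t * JJ' m b t = rho m (m b) t := by
  have htt : t ∈ Ioo 0 t0 := ⟨ht.1, ht.2.trans hb.2⟩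
  have hX := S.XX'_pos htt
  have hXb := S.XX_pos ⟨hb.1, hb.2.le⟩
  have hmt := S.pos t
  have hmb := S.pos b
  have hm0 := S.pos 0
  have hlt : m b < m t := S.lt_of (by rw [abs_of_pos ht.1, abs_of_pos hb.1]; exact ht.2)
    (by rw [abs_of_pos hb.1]; exact hb.2.le)
  have hsq : 0 < m t ^ 2 - m b ^ 2 := by
    have : m b ^ 2 < m t ^ 2 := by gcongr
    linarith
  have e1 : √(1 - (XX m t / XX m b) ^ 2) = √(m t ^ 2 - m b ^ 2) / (m b * m t * XX m b) := by
    rw [Real.sqrt_eq_iff_eq_sq]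
    · rw [div_pow, div_pow, Real.sq_sqrt hsq.le, mul_pow, S.XX_sq (by rw [abs_of_pos ht.1]; exact htt.2.le)]
      have h3 := S.XX_sq (show |b| ≤ t0 by rw [abs_of_pos hb.1]; exact hb.2.le)
      have h4 : (1 / m b ^ 2 - 1 / m 0 ^ 2) ≠ 0 := by rw [← h3]; positivity
      have h5 : XX m b ≠ 0 := hXb.ne'
      have : 1 - (1 / m t ^ 2 - 1 / m 0 ^ 2) / XX m b ^ 2 = (XX m b ^ 2 - (1 / m t ^ 2 - 1 / m 0 ^ 2)) / XX m b ^ 2 := by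
        field_simp
      rw [this, show XX m b ^ 2 - (1 / m t ^ 2 - 1 / m 0 ^ 2) = (m t ^ 2 - m b ^ 2) / (m b * m t) ^ 2 by
        rw [h3]; field_simp; ring]
      field_simp
    · have hr := S.ratio hb ht
      have : (XX m t / XX m b) ^ 2 ≤ 1 := by
        have := hr.1; have := hr.2
        nlinarith
      linarith
    · positivity
  have hs : 0 < √(m t ^ 2 - m b ^ 2) := Real.sqrt_pos.2 hsq
  rw [S.psi_eq htt, JJ', e1, rho]
  field_simp

lemma rho_int_b (S : Shape m t0) {b : ℝ} (hb : b ∈ Ioo 0 t0) :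
    IntervalIntegrable (rho m (m b)) volume 0 b := by
  rw [intervalIntegrable_iff_integrableOn_Ioo_of_le hb.1.le]
  have h1 : IntegrableOn (JJ' m b) (Ioo 0 b) := by
    rw [← integrableOn_Ioc_iff_integrableOn_Ioo]
    exact intervalIntegral.integrableOn_deriv_of_nonneg S.JJ_cont.continuousOn
      (fun x hx => S.JJ_deriv hb hx) (fun x hx => S.JJ'_pos hb hx)
  have h2 : IntegrableOn (fun t => psi m t * JJ' m b t) (Ioo 0 b) := by
    apply Integrable.bdd_mul (c := psi m b) h1
    · exact (S.psi_cont.mono (Ioo_subset_Ioo_right hb.2.le)).aestronglyMeasurable measurableSet_Ioo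
    · refine (ae_restrict_mem measurableSet_Ioo).mono fun x hx => ?_
      rw [Real.norm_eq_abs, abs_of_pos (S.psi_pos ⟨hx.1, hx.2.trans hb.2⟩)]
      exact S.psi_mono ⟨hx.1.le, hx.2.trans hb.2⟩ ⟨hb.1.le, hb.2⟩ hx.2.le
  exact h2.congr_fun (fun x hx => S.psi_JJ' hb hx) measurableSet_Ioo

lemma xi_eq (S : Shape m t0) {b : ℝ} (hb : b ∈ Ioo 0 t0) : xi m (m b) = b := by
  unfold xi
  have : IsLeast {t : ℝ | 0 < t ∧ m t = m b} b := by
    refine ⟨⟨hb.1, rfl⟩, fun t ht => ?_⟩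
    by_contra h
    push Not at h
    have := S.lt_of (a := t) (b := b) (by rw [abs_of_pos ht.1, abs_of_pos hb.1]; exact h)
      (by rw [abs_of_pos hb.1]; exact hb.2.le)
    linarith [ht.2]
  exact this.csInf_eq

lemma phi_eq (S : Shape m t0) {b : ℝ} (hb : b ∈ Ioo 0 t0) : phi m (m b) = 2 * Th m (m b) b := by
  unfold phi
  rw [S.xi_eq hb]
  rfl

/-- The angular representation of `Th`. -/
lemma Th_rep (S : Shape m t0) : ∃ Ψ : ℝ → ℝ, MonotoneOn Ψ (Ico 0 (XX m t0)) ∧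
    ContinuousOn Ψ (Ioo 0 (XX m t0)) ∧ (∀ x ∈ Ico 0 (XX m t0), 0 ≤ Ψ x) ∧
    ∀ b ∈ Ioo 0 t0, Th m (m b) b = ∫ α in (0:ℝ)..(π/2), Ψ (XX m b * sin α) := by
  obtain ⟨T, hT, hTm, hTI, hTc⟩ := S.exists_inv
  have ht0 := S.t0pos
  have hX0 : 0 < XX m t0 := S.XX_pos ⟨ht0, le_refl _⟩
  have hmono : MonotoneOn (psi m ∘ T) (Ico 0 (XX m t0)) := by
    intro x hx y hy hxy
    exact S.psi_mono (hTI x hx) (hTI y hy) (hTm.monotoneOn ⟨hx.1, hx.2.le⟩ ⟨hy.1, hy.2.le⟩ hxy)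
  have hcont : ContinuousOn (psi m ∘ T) (Ioo 0 (XX m t0)) := by
    intro x hx
    have := S.psi_cont.continuousAt (Ioo_mem_nhds (hTc x hx).1.1 (hTc x hx).1.2)
    exact (this.comp (hTc x hx).2).continuousWithinAt
  refine ⟨psi m ∘ T, hmono, hcont, ?_, ?_⟩
  · intro x hx
    have := S.psi_mono ⟨le_refl _, ht0⟩ (hTI x hx) (hTI x hx).1
    rwa [psi_zero] at this
  · intro b hb
    have hXb := S.XX_pos ⟨hb.1, hb.2.le⟩
    have hXbt : XX m b < XX m t0 := S.XX_mono ⟨hb.1.le, hb.2.le⟩ ⟨ht0.le, le_refl _⟩ hb.2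
    let g : ℝ → ℝ := fun α => (psi m ∘ T) (XX m b * sin α)
    have hgJ : ∀ t ∈ Icc 0 b, g (JJ m b t) = psi m t := by
      intro t ht
      have hr0 : 0 ≤ XX m t / XX m b := div_nonneg (Real.sqrt_nonneg _) hXb.le
      have hr1 : XX m t / XX m b ≤ 1 := by
        rw [div_le_one hXb]
        exact S.XX_mono.monotoneOn ⟨ht.1, ht.2.trans hb.2.le⟩ ⟨hb.1.le, hb.2.le⟩ ht.2
      simp only [g, JJ, Function.comp]
      rw [sin_arcsin (by linarith) hr1, mul_div_cancel₀ _ hXb.ne', hT t ⟨ht.1, ht.2.trans hb.2.le⟩]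
    have himg : JJ m b '' Icc 0 b ⊆ Icc 0 (π/2) := by
      rintro _ ⟨t, ht, rfl⟩
      have hr0 : 0 ≤ XX m t / XX m b := div_nonneg (Real.sqrt_nonneg _) hXb.le
      exact ⟨arcsin_nonneg.2 hr0, arcsin_le_pi_div_two _⟩
    have himg' : JJ m b '' Ioo 0 b ⊆ Ioo 0 (π/2) := by
      rintro _ ⟨t, ht, rfl⟩
      have hr := S.ratio hb ht
      exact ⟨arcsin_pos.2 hr.1, arcsin_lt_pi_div_two.2 hr.2⟩
    have hsub := intervalIntegral.integral_comp_mul_deriv''' (a := 0) (b := b) (f := JJ m b) (f' := JJ' m b)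
      (g := g) S.JJ_cont.continuousOn
      (fun x hx => by
        rw [min_eq_left hb.1.le, max_eq_right hb.1.le] at hx
        exact (S.JJ_deriv hb hx).hasDerivWithinAt)
      (by
        rw [min_eq_left hb.1.le, max_eq_right hb.1.le]
        refine ContinuousOn.mono ?_ himg'
        refine hcont.comp (by fun_prop) ?_
        intro α hα
        have h1 : 0 < sin α := sin_pos_of_pos_of_lt_pi hα.1 (by linarith [hα.2, pi_pos])
        have h2 := sin_le_one α
        exact ⟨by positivity, by nlinarith⟩)
      (by
        rw [uIcc_of_le hb.1.le]
        refine IntegrableOn.mono_set ?_ himg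
        apply MonotoneOn.integrableOn_isCompact isCompact_Icc
        intro x hx y hy hxy
        have hs : sin x ≤ sin y := Real.sin_le_sin_of_le_of_le_pi_div_two (by linarith [hx.1, pi_pos]) hy.2 hxy
        have h0 : 0 ≤ sin x := sin_nonneg_of_nonneg_of_le_pi hx.1 (by linarith [hx.2, pi_pos])
        have h1 := sin_le_one y
        apply hmono
        · exact ⟨by positivity, by nlinarith⟩
        · exact ⟨by have := h0.trans hs; positivity, by nlinarith⟩
        · exact mul_le_mul_of_nonneg_left hs hXb.le)
      (by
        rw [uIcc_of_le hb.1.le, integrableOn_Icc_iff_integrableOn_Ioo]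
        have := S.rho_int_b hb
        rw [intervalIntegrable_iff_integrableOn_Ioo_of_le hb.1.le] at this
        refine this.congr_fun ?_ measurableSet_Ioo
        intro x hx
        simp only [Function.comp]
        rw [hgJ x ⟨hx.1.le, hx.2.le⟩, S.psi_JJ' hb hx])
    rw [JJ_zero, S.JJ_b hb] at hsub
    rw [← hsub, Th]
    rw [intervalIntegral.integral_of_le hb.1.le, intervalIntegral.integral_of_le hb.1.le,
      integral_Ioc_eq_integral_Ioo, integral_Ioc_eq_integral_Ioo]
    apply setIntegral_congr_fun measurableSet_Ioo
    intro x hx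
    simp only [Function.comp]
    rw [hgJ x ⟨hx.1.le, hx.2.le⟩, S.psi_JJ' hb hx]

lemma sin_dom {b x0 : ℝ} (h0 : 0 ≤ b) (hb : b < x0) {α : ℝ} (hα : α ∈ Icc 0 (π/2)) :
    b * sin α ∈ Ico 0 x0 := by
  have h0' : 0 ≤ sin α := sin_nonneg_of_nonneg_of_le_pi hα.1 (by linarith [hα.2, pi_pos])
  have h1 := sin_le_one α
  exact ⟨by positivity, by nlinarith⟩

lemma phi_mono (S : Shape m t0) : MonotoneOn (fun b => phi m (m b)) (Ioo 0 t0) := by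
  obtain ⟨Ψ, hmono, hcont, hpos, hrep⟩ := S.Th_rep
  have ht0 := S.t0pos
  intro b hb c hc hbc
  simp only
  rw [S.phi_eq hb, S.phi_eq hc, hrep b hb, hrep c hc]
  have hXX : ∀ b ∈ Ioo 0 t0, 0 < XX m b ∧ XX m b < XX m t0 := fun b hb =>
    ⟨S.XX_pos ⟨hb.1, hb.2.le⟩, S.XX_mono ⟨hb.1.le, hb.2.le⟩ ⟨ht0.le, le_refl _⟩ hb.2⟩
  have hInt : ∀ b ∈ Ioo 0 t0, IntervalIntegrable (fun α => Ψ (XX m b * sin α)) volume 0 (π/2) := by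
    intro b hb
    apply MonotoneOn.intervalIntegrable
    rw [uIcc_of_le (by positivity)]
    intro x hx y hy hxy
    have hs : sin x ≤ sin y := Real.sin_le_sin_of_le_of_le_pi_div_two (by linarith [hx.1, pi_pos]) hy.2 hxy
    exact hmono (sin_dom (hXX b hb).1.le (hXX b hb).2 hx) (sin_dom (hXX b hb).1.le (hXX b hb).2 hy)
      (mul_le_mul_of_nonneg_left hs (hXX b hb).1.le)
  have := intervalIntegral.integral_mono_on (by positivity) (hInt b hb) (hInt c hc) (fun α hα => by
    refine hmono (sin_dom (hXX b hb).1.le (hXX b hb).2 hα) (sin_dom (hXX c hc).1.le (hXX c hc).2 hα) ?_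
    have h0' : 0 ≤ sin α := sin_nonneg_of_nonneg_of_le_pi hα.1 (by linarith [hα.2, pi_pos])
    exact mul_le_mul_of_nonneg_right (S.XX_mono.monotoneOn ⟨hb.1.le, hb.2.le⟩ ⟨hc.1.le, hc.2.le⟩ hbc) h0')
  linarith

lemma phi_cont (S : Shape m t0) : ContinuousOn (fun b => phi m (m b)) (Ioo 0 t0) := by
  obtain ⟨Ψ, hmono, hcont, hpos, hrep⟩ := S.Th_rep
  have ht0 := S.t0pos
  have hXX : ∀ b ∈ Ioo 0 t0, 0 < XX m b ∧ XX m b < XX m t0 := fun b hb =>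
    ⟨S.XX_pos ⟨hb.1, hb.2.le⟩, S.XX_mono ⟨hb.1.le, hb.2.le⟩ ⟨ht0.le, le_refl _⟩ hb.2⟩
  have : ContinuousOn (fun b => 2 * ∫ α in (0:ℝ)..(π/2), Ψ (XX m b * sin α)) (Ioo 0 t0) := by
    intro b hb
    apply ContinuousWithinAt.const_mul
    apply ContinuousAt.continuousWithinAt
    obtain ⟨c, hbc, hc⟩ := exists_between hb.2
    have hcI : c ∈ Ioo 0 t0 := ⟨hb.1.trans hbc, hc⟩
    apply intervalIntegral.continuousAt_of_dominated_interval (bound := fun _ => Ψ (XX m c))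
    · filter_upwards [Ioo_mem_nhds hb.1 hb.2] with x hx
      have : MonotoneOn (fun α => Ψ (XX m x * sin α)) (uIcc 0 (π/2)) := by
        rw [uIcc_of_le (by positivity)]
        intro y hy z hz hyz
        have hs : sin y ≤ sin z := Real.sin_le_sin_of_le_of_le_pi_div_two (by linarith [hy.1, pi_pos]) hz.2 hyz
        exact hmono (sin_dom (hXX x hx).1.le (hXX x hx).2 hy) (sin_dom (hXX x hx).1.le (hXX x hx).2 hz)
          (mul_le_mul_of_nonneg_left hs (hXX x hx).1.le)
      have := this.intervalIntegrable (μ := volume)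
      exact this.def'.aestronglyMeasurable
    · filter_upwards [Ioo_mem_nhds hb.1 hbc] with x hx
      refine Filter.Eventually.of_forall fun α hα => ?_
      rw [uIoc_of_le (by positivity)] at hα
      have hα' : α ∈ Icc 0 (π/2) := ⟨hα.1.le, hα.2⟩
      have hxI : x ∈ Ioo 0 t0 := ⟨hx.1, hx.2.trans hc⟩
      have hd := sin_dom (hXX x hxI).1.le (hXX x hxI).2 hα'
      rw [Real.norm_eq_abs, abs_of_nonneg (hpos _ hd)]
      apply hmono hd ⟨(hXX c hcI).1.le, (hXX c hcI).2⟩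
      have h1 := sin_le_one α
      have := S.XX_mono ⟨hxI.1.le, hxI.2.le⟩ ⟨hcI.1.le, hcI.2.le⟩ hx.2
      have := (hXX x hxI).1
      nlinarith
    · exact intervalIntegrable_const
    · refine Filter.Eventually.of_forall fun α hα => ?_
      rw [uIoc_of_le (by positivity)] at hα
      have h0' : 0 < sin α := sin_pos_of_pos_of_lt_pi hα.1 (by linarith [hα.2, pi_pos])
      have hd := sin_dom (hXX b hb).1.le (hXX b hb).2 ⟨hα.1.le, hα.2⟩
      have := hcont.continuousAt (Ioo_mem_nhds (mul_pos (hXX b hb).1 h0') hd.2)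
      have h2 : ContinuousAt (fun x => XX m x * sin α) b := (S.XX_cont.mul continuous_const).continuousAt
      exact ContinuousAt.comp (f := fun x => XX m x * sin α) (g := Ψ) this h2
  refine this.congr fun b hb => ?_
  simp only
  rw [S.phi_eq hb, hrep b hb]

end Shape
end

section
open Real Set MeasureTheory
namespace Shape
variable {m : ℝ → ℝ} {t0 : ℝ}

lemma fF_cont (S : Shape m t0) (n : ℝ) : Continuous (fF m n) := by
  unfold fF
  have := S.cont
  refine Continuous.div (by fun_prop) this (fun x => (S.pos x).ne')

lemma fF_nonneg (S : Shape m t0) (n x : ℝ) : 0 ≤ fF m n x := by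
  have := S.pos x
  unfold fF; positivity

lemma fF_even (S : Shape m t0) (n x : ℝ) : fF m n (-x) = fF m n x := by
  unfold fF; rw [S.even]

lemma rho_even (S : Shape m t0) (n x : ℝ) : rho m n (-x) = rho m n x := by
  unfold rho; rw [S.even]

lemma rho_nonneg (S : Shape m t0) {n : ℝ} (hn : 0 ≤ n) (x : ℝ) : 0 ≤ rho m n x := by
  have := S.pos x
  unfold rho; positivity

lemma FF_deriv (S : Shape m t0) (n x : ℝ) : HasDerivAt (FF m n) (fF m n x) x :=
  ((S.fF_cont n).integral_hasStrictDerivAt 0 x).hasDerivAt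

lemma FF_cont (S : Shape m t0) (n : ℝ) : Continuous (FF m n) :=
  continuous_iff_continuousAt.2 fun x => (S.FF_deriv n x).continuousAt

lemma odd_of_even {f : ℝ → ℝ} (h : ∀ x, f (-x) = f x) (x : ℝ) :
    ∫ u in (0:ℝ)..(-x), f u = - ∫ u in (0:ℝ)..x, f u := by
  have := intervalIntegral.integral_comp_neg (a := 0) (b := x) f
  simp only [h, neg_zero] at this
  rw [intervalIntegral.integral_symm, ← this]

lemma FF_neg (S : Shape m t0) (n x : ℝ) : FF m n (-x) = - FF m n x :=
  odd_of_even (S.fF_even n) x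

lemma Th_neg (S : Shape m t0) (n x : ℝ) : Th m n (-x) = - Th m n x :=
  odd_of_even (S.rho_even n) x

lemma FF_sub (S : Shape m t0) (n x y : ℝ) : FF m n y - FF m n x = ∫ u in x..y, fF m n u := by
  unfold FF
  rw [intervalIntegral.integral_interval_sub_left] <;>
    exact (S.fF_cont n).intervalIntegrable _ _

lemma FF_mono (S : Shape m t0) (n : ℝ) : Monotone (FF m n) :=
  monotone_of_deriv_nonneg (fun x => (S.FF_deriv n x).differentiableAt)
    (fun x => by rw [(S.FF_deriv n x).deriv]; exact S.fF_nonneg n x)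

lemma FF_zero : FF m n 0 = 0 := by simp [FF]
lemma Th_zero : Th m n 0 = 0 := by simp [Th]

lemma rho_cont (S : Shape m t0) {n x : ℝ} (hn : 0 ≤ n) (h : n < m x) : ContinuousAt (rho m n) x := by
  unfold rho
  have hc := S.cont.continuousAt (x := x)
  have hp := S.pos x
  refine ContinuousAt.div continuousAt_const (hc.mul ((hc.pow 2).sub continuousAt_const).sqrt) ?_
  have : 0 < √(m x ^ 2 - n ^ 2) := Real.sqrt_pos.2 (by nlinarith)
  positivity

lemma rho_meas (S : Shape m t0) : Measurable (fun p : ℝ × ℝ => rho m p.1 p.2) := by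
  unfold rho
  have := S.cont.measurable
  fun_prop

lemma rho_meas1 (S : Shape m t0) (n : ℝ) : Measurable (rho m n) := by
  unfold rho
  have := S.cont.measurable
  fun_prop

lemma rho_junk {n x : ℝ} (hp : 0 ≤ m x) (h : m x ≤ n) : rho m n x = 0 := by
  unfold rho
  rw [Real.sqrt_eq_zero_of_nonpos (by nlinarith)]; simp

lemma fF_junk {n x : ℝ} (hp : 0 ≤ m x) (h : m x ≤ n) : fF m n x = 0 := by
  unfold fF
  rw [Real.sqrt_eq_zero_of_nonpos (by nlinarith)]; simp

lemma rho_mono (S : Shape m t0) {n n' x : ℝ} (hn : 0 ≤ n) (h : n ≤ n') (h' : n' < m x) :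
    rho m n x ≤ rho m n' x := by
  unfold rho
  have hp := S.pos x
  have : 0 < √(m x ^ 2 - n' ^ 2) := Real.sqrt_pos.2 (by nlinarith)
  have : √(m x ^ 2 - n' ^ 2) ≤ √(m x ^ 2 - n ^ 2) := Real.sqrt_le_sqrt (by nlinarith)
  have : 0 ≤ n' := hn.trans h
  gcongr

/-- integrability of `rho` -/
lemma rho_int0 (S : Shape m t0) {T n : ℝ} (hT : T ∈ Ioo 0 t0) (hn : 0 ≤ n) (hnT : n ≤ m T) :
    IntervalIntegrable (rho m n) volume 0 T := by
  have h := S.rho_int_b hT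
  rw [intervalIntegrable_iff_integrableOn_Ioo_of_le hT.1.le] at h ⊢
  refine h.mono' (S.rho_meas1 n).aestronglyMeasurable ?_
  refine (ae_restrict_iff' measurableSet_Ioo).2 (Filter.Eventually.of_forall fun x hx => ?_)
  rw [Real.norm_of_nonneg (S.rho_nonneg hn x)]
  refine S.rho_mono hn hnT (S.lt_of ?_ ?_)
  · rw [abs_of_pos hx.1, abs_of_pos hT.1]; exact hx.2
  · rw [abs_of_pos hT.1]; exact hT.2.le

lemma rho_int (S : Shape m t0) {T n x y : ℝ} (hT : T ∈ Ioo 0 t0) (hn : 0 ≤ n) (hnT : n ≤ m T)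
    (hx : |x| ≤ T) (hy : |y| ≤ T) :
    IntervalIntegrable (rho m n) volume x y := by
  have h := S.rho_int0 hT hn hnT
  have h2 : IntervalIntegrable (rho m n) volume (-T) 0 := by
    have := (IntervalIntegrable.iff_comp_neg (by simp)).1 h
    simp only [S.rho_even, neg_zero] at this
    exact this.symm
  refine (h2.trans h).mono_set ?_
  rw [uIcc_of_le (by linarith [hT.1] : -T ≤ T)]
  exact uIcc_subset_Icc (abs_le.1 hx) (abs_le.1 hy)

lemma Th_sub (S : Shape m t0) {T n x y : ℝ} (hT : T ∈ Ioo 0 t0) (hn : 0 ≤ n) (hnT : n ≤ m T)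
    (hx : |x| ≤ T) (hy : |y| ≤ T) : Th m n y - Th m n x = ∫ u in x..y, rho m n u := by
  unfold Th
  have h0 : |(0:ℝ)| ≤ T := by simpa using hT.1.le
  rw [intervalIntegral.integral_interval_sub_left] <;>
    exact S.rho_int hT hn hnT h0 (by assumption)

lemma Th_mono (S : Shape m t0) {T n x y : ℝ} (hT : T ∈ Ioo 0 t0) (hn : 0 ≤ n) (hnT : n ≤ m T)
    (hx : |x| ≤ T) (hy : |y| ≤ T) (hxy : x ≤ y) : Th m n x ≤ Th m n y := by
  have := S.Th_sub hT hn hnT hx hy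
  have h2 := intervalIntegral.integral_nonneg (μ := volume) hxy (fun u _ => S.rho_nonneg hn u)
  linarith

lemma Th_contOn (S : Shape m t0) {T n : ℝ} (hT : T ∈ Ioo 0 t0) (hn : 0 ≤ n) (hnT : n ≤ m T) :
    ContinuousOn (Th m n) (Icc (-T) T) := by
  unfold Th
  have h := intervalIntegral.continuousOn_primitive_interval' (a := 0) (μ := volume)
    (S.rho_int hT hn hnT (x := -T) (y := T) (by rw [abs_neg, abs_of_pos hT.1]) (by rw [abs_of_pos hT.1]))
    (by rw [uIcc_of_le (by linarith [hT.1] : -T ≤ T)]; exact ⟨by linarith [hT.1], hT.1.le⟩)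
  rwa [uIcc_of_le (by linarith [hT.1] : -T ≤ T)] at h

lemma Th_deriv_of (S : Shape m t0) {n x : ℝ} (hn : 0 ≤ n) (h : n < m x)
    (hi : IntervalIntegrable (rho m n) volume 0 x) : HasDerivAt (Th m n) (rho m n x) x :=
  intervalIntegral.integral_hasDerivAt_right hi
    ((S.rho_meas1 n).stronglyMeasurable.stronglyMeasurableAtFilter) (S.rho_cont hn h)

lemma rho_int_low (S : Shape m t0) {n x y : ℝ} (hn : 0 ≤ n) (hx : |x| < t0) (hy : |y| < t0)
    (h : n ≤ m t0) : IntervalIntegrable (rho m n) volume x y := by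
  have hxy := max_lt hx hy
  have hmx : 0 ≤ max |x| |y| := (abs_nonneg x).trans (le_max_left _ _)
  have hT : (max |x| |y| + t0) / 2 ∈ Ioo 0 t0 := ⟨by linarith [S.t0pos], by linarith⟩
  refine S.rho_int hT hn (h.trans (S.min _)) ?_ ?_
  · linarith [le_max_left |x| |y|]
  · linarith [le_max_right |x| |y|]

lemma rho_int_vlow (S : Shape m t0) {n x y : ℝ} (hn : 0 ≤ n) 
    (h : n < m t0) : IntervalIntegrable (rho m n) volume x y := by
  apply Continuous.intervalIntegrable
  exact continuous_iff_continuousAt.2 fun x => S.rho_cont hn (h.trans_le (S.min x))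

/-- Inner integral -/
lemma inner_int (M : ℝ) (hM : 0 < M) {a b : ℝ} (ha : 0 ≤ a) (hab : a ≤ b) :
    IntervalIntegrable (fun n => n / √(M ^ 2 - n ^ 2)) volume a b ∧
    ∫ n in a..b, n / √(M ^ 2 - n ^ 2) = √(M ^ 2 - a ^ 2) - √(M ^ 2 - b ^ 2) := by
  have hd : ∀ n ∈ Ioo (a ⊓ b) (a ⊔ b) \ {M}, HasDerivAt (fun n => -√(M ^ 2 - n ^ 2)) (n / √(M ^ 2 - n ^ 2)) n := by
    intro n hn
    rw [inf_eq_left.2 hab, sup_eq_right.2 hab] at hn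
    have hn0 : 0 < n := ha.trans_lt hn.1.1
    rcases lt_or_gt_of_ne (show n ≠ M from hn.2) with h | h
    · have h1 : HasDerivAt (fun n => M ^ 2 - n ^ 2) (-(2 * n)) n := by
        have := (hasDerivAt_pow 2 n).const_sub (M ^ 2)
        simpa using this
      have := (h1.sqrt (by nlinarith)).neg
      refine HasDerivAt.congr_deriv this ?_
      have : 0 < √(M ^ 2 - n ^ 2) := Real.sqrt_pos.2 (by nlinarith)
      field_simp
    · rw [Real.sqrt_eq_zero_of_nonpos (by nlinarith), div_zero]
      refine (hasDerivAt_const n (0:ℝ)).congr_of_eventuallyEq ?_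
      filter_upwards [lt_mem_nhds h] with k hk
      rw [Real.sqrt_eq_zero_of_nonpos (by nlinarith), neg_zero]
  have hmono : MonotoneOn (fun n => -√(M ^ 2 - n ^ 2)) (uIcc a b) := by
    rw [uIcc_of_le hab]
    intro x hx y hy hxy
    have : x ^ 2 ≤ y ^ 2 := by have := hx.1; gcongr; linarith
    have := Real.sqrt_le_sqrt (show M ^ 2 - y ^ 2 ≤ M ^ 2 - x ^ 2 by linarith)
    simpa using this
  have hi : IntervalIntegrable (fun n => n / √(M ^ 2 - n ^ 2)) volume a b := by
    refine hmono.intervalIntegrable_deriv.congr_ae ?_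
    rw [uIoc_of_le hab]
    have h0 : ∀ᵐ x : ℝ ∂volume, x ∉ ({M, b} : Set ℝ) := by
      rw [ae_iff]; simp only [not_not, Set.ofPred_mem_eq]
      exact (Set.toFinite _).measure_zero _
    filter_upwards [ae_restrict_mem measurableSet_Ioc, ae_restrict_of_ae h0] with x hx hx2
    simp only [mem_insert_iff, mem_singleton_iff, not_or] at hx2
    refine (hd x ?_).deriv
    rw [inf_eq_left.2 hab, sup_eq_right.2 hab]
    exact ⟨⟨hx.1, lt_of_le_of_ne hx.2 hx2.2⟩, hx2.1⟩
  refine ⟨hi, ?_⟩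
  rw [integral_eq_of_hasDerivAt_off_countable (fun n => -√(M ^ 2 - n ^ 2)) _ (s := {M}) (by simp)
    (by fun_prop) hd hi]
  ring

/-- integrals over `[0,t0]` (junk convention) -/
def PP (m : ℝ → ℝ) (t0 n : ℝ) : ℝ := ∫ x in Ioc 0 t0, rho m n x

lemma fub (S : Shape m t0) {a b : ℝ} (ha : 0 ≤ a) (hab : a ≤ b) :
    IntegrableOn (PP m t0) (Ioc a b) ∧
    FF m a t0 - FF m b t0 = ∫ n in Ioc a b, PP m t0 n := by
  have inner : ∀ x, IntegrableOn (fun n => rho m n x) (Ioc a b) ∧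
      ∫ n in Ioc a b, rho m n x = fF m a x - fF m b x := by
    intro x
    obtain ⟨h1, h2⟩ := inner_int (m x) (S.pos x) ha hab
    have e : ∀ n, rho m n x = (m x)⁻¹ * (n / √(m x ^ 2 - n ^ 2)) := by
      intro n; unfold rho; rw [div_mul_eq_div_div, div_right_comm]; ring
    rw [intervalIntegrable_iff_integrableOn_Ioc_of_le hab] at h1
    rw [intervalIntegral.integral_of_le hab] at h2
    simp only [e]
    refine ⟨h1.const_mul _, ?_⟩
    rw [integral_const_mul, h2]; unfold fF; ring
  have hI : Integrable (Function.uncurry fun n x => rho m n x)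
      ((volume.restrict (Ioc a b)).prod (volume.restrict (Ioc 0 t0))) := by
    have hme : Measurable (Function.uncurry fun n x => rho m n x) := S.rho_meas
    rw [integrable_prod_iff' hme.aestronglyMeasurable]
    refine ⟨Filter.Eventually.of_forall fun x => (inner x).1, ?_⟩
    have : (fun x => ∫ n in Ioc a b, ‖(Function.uncurry fun n x => rho m n x) (n, x)‖) =
        fun x => fF m a x - fF m b x := by
      ext x
      rw [← (inner x).2]
      refine setIntegral_congr_fun measurableSet_Ioc fun n hn => ?_
      exact Real.norm_of_nonneg (S.rho_nonneg (ha.trans hn.1.le) x)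
    rw [this]
    exact (((S.fF_cont a).sub (S.fF_cont b)).integrableOn_Icc).mono_set Ioc_subset_Icc_self
  refine ⟨hI.integral_prod_left, ?_⟩
  have hsw := integral_integral_swap hI
  unfold PP
  rw [hsw]
  simp only [(inner _).2]
  rw [← intervalIntegral.integral_of_le S.t0pos.le, intervalIntegral.integral_sub] 
  · rfl
  · exact (S.fF_cont a).intervalIntegrable _ _
  · exact (S.fF_cont b).intervalIntegrable _ _

lemma FF_t0 (S : Shape m t0) {b : ℝ} (hb : 0 ≤ b) (hb' : b ≤ t0) : FF m (m b) t0 = FF m (m b) b := by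
  have : FF m (m b) t0 - FF m (m b) b = 0 := by
    rw [S.FF_sub]
    refine intervalIntegral.integral_zero_ae (Filter.Eventually.of_forall fun x hx => ?_)
    rw [uIoc_of_le hb'] at hx
    refine fF_junk (S.pos x).le (S.le_of ?_ ?_)
    · rw [abs_of_nonneg hb, abs_of_pos (hb.trans_lt hx.1)]; exact hx.1.le
    · rw [abs_of_pos (hb.trans_lt hx.1)]; exact hx.2
  linarith

lemma PP_eq (S : Shape m t0) {b : ℝ} (hb : b ∈ Ioo 0 t0) : 2 * PP m t0 (m b) = phi m (m b) := by
  rw [S.phi_eq hb]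
  unfold PP Th
  have h := S.rho_int_b hb
  have h0 : IntervalIntegrable (rho m (m b)) volume b t0 ∧ ∫ x in b..t0, rho m (m b) x = 0 := by
    have : ∀ x ∈ uIoc b t0, rho m (m b) x = 0 := fun x hx => by
      rw [uIoc_of_le hb.2.le] at hx
      refine rho_junk (S.pos x).le (S.le_of ?_ ?_)
      · rw [abs_of_pos hb.1, abs_of_pos (hb.1.trans hx.1)]; exact hx.1.le
      · rw [abs_of_pos (hb.1.trans hx.1)]; exact hx.2
    refine ⟨?_, intervalIntegral.integral_zero_ae (Filter.Eventually.of_forall this)⟩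
    exact (intervalIntegrable_const (c := (0:ℝ))).congr (fun x hx => (this x hx).symm)
  rw [← intervalIntegral.integral_of_le S.t0pos.le,
    ← intervalIntegral.integral_add_adjacent_intervals h h0.1, h0.2, add_zero]

/-- S5 -/
lemma Phi_conv (S : Shape m t0) {b c : ℝ} (hb : b ∈ Ioo 0 t0) (hc : c ∈ Ioc 0 t0) :
    2 * FF m (m b) b + (m b - m c) * phi m (m b) ≤ 2 * FF m (m c) c := by
  rw [← S.FF_t0 hb.1.le hb.2.le, ← S.FF_t0 hc.1.le hc.2]
  have key : ∀ n, m t0 < n → n < m 0 → ∃ d ∈ Ioo 0 t0, m d = n ∧ 2 * PP m t0 n = phi m (m d) := by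
    intro n h1 h2
    obtain ⟨d, hd0, hd1, rfl⟩ := S.exists_eq (le_refl 0) S.t0pos.le h1.le h2.le
    have h3 : d ≠ 0 := by rintro rfl; exact lt_irrefl _ h2
    have h4 : d ≠ t0 := by rintro rfl; exact lt_irrefl _ h1
    have : d ∈ Ioo 0 t0 := ⟨lt_of_le_of_ne hd0 h3.symm, lt_of_le_of_ne hd1 h4⟩
    exact ⟨d, this, rfl, S.PP_eq this⟩
  have hm0 : m b < m 0 := S.lt_of (by simpa using hb.1.ne') (by rw [abs_of_pos hb.1]; exact hb.2.le)
  have hcm0 : m c < m 0 := S.lt_of (by simpa using hc.1.ne') (by rw [abs_of_pos hc.1]; exact hc.2)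
  rcases le_total (m c) (m b) with h | h
  · obtain ⟨hI, he⟩ := S.fub (S.pos c).le h
    have : ∫ n in Ioc (m c) (m b), phi m (m b) / 2 ≤ ∫ n in Ioc (m c) (m b), PP m t0 n := by
      refine setIntegral_mono_on (by simp) hI measurableSet_Ioc fun n hn => ?_
      obtain ⟨d, hd, rfl, hd'⟩ := key n ((S.min c).trans_lt hn.1) (hn.2.trans_lt hm0)
      have : b ≤ d := by
        by_contra hlt
        push Not at hlt
        have := S.anti ⟨hd.1.le, hd.2.le⟩ ⟨hb.1.le, hb.2.le⟩ hlt
        linarith [hn.2]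
      have := S.phi_mono hb hd this
      simp only at this
      linarith
    rw [← he, setIntegral_const] at this
    simp only [Measure.real, Real.volume_Ioc, smul_eq_mul] at this
    rw [ENNReal.toReal_ofReal (by linarith)] at this
    linarith
  · obtain ⟨hI, he⟩ := S.fub (S.pos b).le h
    have : ∫ n in Ioc (m b) (m c), PP m t0 n ≤ ∫ n in Ioc (m b) (m c), phi m (m b) / 2 := by
      refine setIntegral_mono_on hI (by simp) measurableSet_Ioc fun n hn => ?_
      obtain ⟨d, hd, rfl, hd'⟩ := key n ((S.min b).trans_lt hn.1) (hn.2.trans_lt hcm0)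
      have : d ≤ b := by
        by_contra hlt
        push Not at hlt
        have := S.anti ⟨hb.1.le, hb.2.le⟩ ⟨hd.1.le, hd.2.le⟩ hlt
        linarith [hn.1]
      have := S.phi_mono hd hb this
      simp only at this
      linarith
    rw [← he, setIntegral_const] at this
    simp only [Measure.real, Real.volume_Ioc, smul_eq_mul] at this
    rw [ENNReal.toReal_ofReal (by linarith)] at this
    linarith

/-- S6 -/
lemma FF_tangent (S : Shape m t0) {T n ν x y : ℝ} (hT : T ∈ Ioo 0 t0) (hn : 0 ≤ n) (hν : 0 ≤ ν)
    (hνT : ν ≤ m T) (hnT : n ≤ m T) (hx : |x| ≤ T) (hy : |y| ≤ T) :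
    |FF m n y - FF m n x| ≤ |FF m ν y - FF m ν x| + (ν - n) * |Th m ν y - Th m ν x| := by
  wlog hxy : x ≤ y generalizing x y
  · have := this hy hx (by linarith)
    rwa [abs_sub_comm, abs_sub_comm (FF m ν x), abs_sub_comm (Th m ν x)] at this
  have h1 := S.FF_mono n hxy
  have h2 := S.FF_mono ν hxy
  have h3 := S.Th_mono hT hν hνT hx hy hxy
  rw [abs_of_nonneg (by linarith), abs_of_nonneg (by linarith), abs_of_nonneg (by linarith),
    S.FF_sub, S.FF_sub, S.Th_sub hT hν hνT hx hy, ← intervalIntegral.integral_const_mul,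
    ← intervalIntegral.integral_add]
  · refine intervalIntegral.integral_mono_on_of_le_Ioo hxy ((S.fF_cont n).intervalIntegrable _ _)
      (((S.fF_cont ν).intervalIntegrable _ _).add
        ((S.rho_int hT hν hνT hx hy).const_mul _)) fun u hu => ?_
    have hu' : |u| < T := by
      rw [abs_le] at hx hy; rw [abs_lt]; exact ⟨by linarith [hu.1], by linarith [hu.2]⟩
    have hmT : m T < m u := S.lt_of (by rwa [abs_of_pos hT.1]) (by rw [abs_of_pos hT.1]; exact hT.2.le)
    have hmu : ν < m u := hνT.trans_lt hmT
    have hp := S.pos u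
    unfold fF rho
    set r := √(m u ^ 2 - ν ^ 2) with hr
    have hr0 : 0 < r := Real.sqrt_pos.2 (by nlinarith)
    have hr2 : r ^ 2 = m u ^ 2 - ν ^ 2 := Real.sq_sqrt (by nlinarith)
    have : √(m u ^ 2 - n ^ 2) ≤ r + (ν - n) * ν / r := by
      apply Real.sqrt_le_iff.2
      constructor
      · have : 0 ≤ r ^ 2 + (ν - n) * ν := by
          have : n < m u := hnT.trans_lt hmT
          nlinarith
        have : 0 ≤ (r ^ 2 + (ν - n) * ν) / r := by positivity
        convert this using 1; field_simp
      · have e : (r + (ν - n) * ν / r) ^ 2 = r ^ 2 + 2 * (ν - n) * ν + ((ν - n) * ν / r) ^ 2 := by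
          field_simp; ring
        rw [e, hr2]
        have h5 : ((ν - n) * ν / r) ^ 2 = (ν - n) ^ 2 * ν ^ 2 / r ^ 2 := by rw [div_pow, mul_pow]
        nlinarith [sq_nonneg ((ν - n) * ν / r), sq_nonneg (ν - n)]
    calc _ ≤ (r + (ν - n) * ν / r) / m u := by gcongr
      _ = _ := by field_simp
  · exact (S.fF_cont ν).intervalIntegrable _ _
  · exact (S.rho_int hT hν hνT hx hy).const_mul _

end Shape
end

section
open Real Set MeasureTheory Filter Topology
namespace Shape
variable {m : ℝ → ℝ} {t0 : ℝ}

/-- S7 divergence -/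
lemma Th_div (S : Shape m t0) (N T1 : ℝ) (hT1 : T1 < t0) : ∃ T ∈ Ioo 0 t0, T1 ≤ T ∧ N ≤ Th m (m t0) T := by
  obtain ⟨C, hC, hq⟩ := S.quad
  have ht0 := S.t0pos
  have hm0 := S.pos 0
  have hmt := S.pos t0
  set k := m t0 / (m 0 * √C) with hk
  have hk0 : 0 < k := by positivity
  -- lower bound
  have low : ∀ T ∈ Ioo 0 t0, k * (Real.log t0 - Real.log (t0 - T)) ≤ Th m (m t0) T := by
    intro T hT
    have hder : ∀ u ∈ uIcc 0 T, HasDerivAt (fun u => - (k * Real.log (t0 - u))) (k / (t0 - u)) u := by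
      intro u hu
      rw [uIcc_of_le hT.1.le] at hu
      have h1 : t0 - u ≠ 0 := by linarith [hu.2, hT.2]
      have := ((((hasDerivAt_id u).const_sub t0).log h1).const_mul k).neg
      refine this.congr_deriv ?_
      simp only [id]
      field_simp
    have hcont : ContinuousOn (fun u => k / (t0 - u)) (uIcc 0 T) := by
      refine ContinuousOn.div (by fun_prop) (by fun_prop) fun u hu => ?_
      rw [uIcc_of_le hT.1.le] at hu
      linarith [hu.2, hT.2]
    have e := intervalIntegral.integral_eq_sub_of_hasDerivAt hder hcont.intervalIntegrable
    have e2 : k * (Real.log t0 - Real.log (t0 - T)) = ∫ u in (0:ℝ)..T, k / (t0 - u) := by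
      rw [e]; simp; ring
    rw [e2]
    refine intervalIntegral.integral_mono_on hT.1.le hcont.intervalIntegrable
      (S.rho_int0 hT hmt.le (S.min T)) fun u hu => ?_
    have hu1 : u ∈ Icc 0 t0 := ⟨hu.1, hu.2.trans hT.2.le⟩
    have hlt : u < t0 := hu.2.trans_lt hT.2
    have hu0 : |u| = u := abs_of_nonneg hu.1
    have hmu : m t0 < m u := S.min_lt (by rwa [hu0])
    have hsq : 0 < √(m u ^ 2 - m t0 ^ 2) := Real.sqrt_pos.2 (by nlinarith)
    have hle : √(m u ^ 2 - m t0 ^ 2) ≤ √C * (t0 - u) := by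
      apply Real.sqrt_le_iff.2
      refine ⟨mul_nonneg (Real.sqrt_nonneg _) (by linarith), ?_⟩
      rw [mul_pow, Real.sq_sqrt hC.le]; exact hq u hu1
    have hmm : m u ≤ m 0 := S.le_max (by rw [hu0]; exact hlt.le)
    have hpu := S.pos u
    have : rho m (m t0) u ≥ m t0 / (m 0 * (√C * (t0 - u))) := by
      unfold rho
      have : 0 < m u * √(m u ^ 2 - m t0 ^ 2) := by positivity
      have h3 : 0 < √C * (t0 - u) := mul_pos (Real.sqrt_pos.2 hC) (by linarith)
      gcongr
    refine le_trans (le_of_eq ?_) this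
    rw [hk, div_div, mul_assoc]
  -- choose T
  obtain ⟨x, hx0, hx1, hx2, hx3⟩ : ∃ x : ℝ, 0 < x ∧ x < t0 ∧ x ≤ t0 - T1 ∧ Real.log x ≤ Real.log t0 - N / k := by
    have h1 : ∀ᶠ x in 𝓝[>] (0:ℝ), Real.log x ≤ Real.log t0 - N / k :=
      Real.tendsto_log_nhdsGT_zero.eventually (eventually_le_atBot _)
    have h2 : ∀ᶠ x in 𝓝[>] (0:ℝ), x < t0 := nhdsWithin_le_nhds (gt_mem_nhds ht0)
    have h3 : ∀ᶠ x in 𝓝[>] (0:ℝ), x < t0 - T1 := nhdsWithin_le_nhds (gt_mem_nhds (by linarith))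
    have h4 : ∀ᶠ x in 𝓝[>] (0:ℝ), 0 < x := self_mem_nhdsWithin
    obtain ⟨x, hx⟩ := (h1.and (h2.and (h3.and h4))).exists
    exact ⟨x, hx.2.2.2, hx.2.1, hx.2.2.1.le, hx.1⟩
  refine ⟨t0 - x, ⟨by linarith, by linarith⟩, by linarith, ?_⟩
  refine le_trans ?_ (low (t0 - x) ⟨by linarith, by linarith⟩)
  rw [sub_sub_cancel]
  calc N = k * (N / k) := by field_simp
    _ ≤ _ := by gcongr; linarith

/-- S8 general continuity in the Clairaut constant -/
lemma Th_contN (S : Shape m t0) {n1 x : ℝ} (hn1 : 0 ≤ n1)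
    (hi : IntervalIntegrable (rho m n1) volume 0 |x|) (h : ∀ u ∈ Ioo 0 |x|, n1 < m u) :
    ContinuousOn (fun ν => Th m ν x) (Icc 0 n1) := by
  wlog hx : 0 ≤ x generalizing x
  · have := this (x := -x) (by rwa [abs_neg]) (by rwa [abs_neg]) (by linarith)
    simp only [S.Th_neg] at this
    have h2 := this.neg
    simp only [Pi.neg_def, neg_neg] at h2
    exact h2
  rw [abs_of_nonneg hx] at hi h
  unfold Th
  have hae : ∀ᵐ u : ℝ ∂volume, u ∈ uIoc 0 x → u ∈ Ioo 0 x := by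
    have h0 : ∀ᵐ u : ℝ ∂volume, u ≠ x := by
      simp [ae_iff]
    filter_upwards [h0] with u hu hu2
    rw [uIoc_of_le hx] at hu2
    exact ⟨hu2.1, lt_of_le_of_ne hu2.2 hu⟩
  intro ν hν
  apply intervalIntegral.continuousWithinAt_of_dominated_interval (bound := rho m n1)
  · exact Eventually.of_forall fun n => (S.rho_meas1 n).aestronglyMeasurable
  · filter_upwards [self_mem_nhdsWithin] with n hn
    filter_upwards [hae] with u hu hu2
    rw [Real.norm_of_nonneg (S.rho_nonneg hn.1 u)]
    exact S.rho_mono hn.1 hn.2 (h u (hu hu2))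
  · exact hi
  · filter_upwards [hae] with u hu hu2
    have h3 := h u (hu hu2)
    have hp := S.pos u
    apply ContinuousAt.continuousWithinAt
    unfold rho
    refine ContinuousAt.div continuousAt_id (by fun_prop) ?_
    have : 0 < √(m u ^ 2 - ν ^ 2) := Real.sqrt_pos.2 (by nlinarith [hν.1, hν.2])
    positivity

lemma gt_of_lt (S : Shape m t0) {T u : ℝ} (hT : T ∈ Ioo 0 t0) (hu : u ∈ Ioo 0 T) : m T < m u :=
  S.lt_of (by rw [abs_of_pos hu.1, abs_of_pos hT.1]; exact hu.2) (by rw [abs_of_pos hT.1]; exact hT.2.le)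

lemma Th_contN1 (S : Shape m t0) {T x : ℝ} (hT : T ∈ Ioo 0 t0) (hx : |x| ≤ T) :
    ContinuousOn (fun ν => Th m ν x) (Icc 0 (m T)) :=
  S.Th_contN (S.pos T).le (S.rho_int hT (S.pos T).le le_rfl (by simpa using hT.1.le) (by simpa using hx))
    fun _ hu => S.gt_of_lt hT ⟨hu.1, hu.2.trans_le hx⟩

lemma Th_contN2 (S : Shape m t0) {n1 x : ℝ} (hn1 : 0 ≤ n1) (h : n1 < m t0) :
    ContinuousOn (fun ν => Th m ν x) (Icc 0 n1) :=
  S.Th_contN hn1 (S.rho_int_vlow hn1 h) fun u _ => h.trans_le (S.min u)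

/-- monotone in the Clairaut constant -/
lemma Th_monoN (S : Shape m t0) {T x n n' : ℝ} (hT : T ∈ Ioo 0 t0) (hx0 : 0 ≤ x) (hx : x ≤ T)
    (hn : 0 ≤ n) (h : n ≤ n') (h' : n' ≤ m T) : Th m n x ≤ Th m n' x := by
  have hx' : |x| ≤ T := by rwa [abs_of_nonneg hx0]
  have h0 : |(0:ℝ)| ≤ T := by simpa using hT.1.le
  refine intervalIntegral.integral_mono_on_of_le_Ioo hx0 (S.rho_int hT hn (h.trans h') h0 hx')
    (S.rho_int hT (hn.trans h) h' h0 hx') fun u hu => ?_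
  exact S.rho_mono hn h (h'.trans_lt (S.gt_of_lt hT ⟨hu.1, hu.2.trans_le hx⟩))

lemma Th_le_abs (S : Shape m t0) {T n x : ℝ} (hT : T ∈ Ioo 0 t0) (hn : 0 ≤ n) (hnT : n ≤ m T)
    (hx : |x| ≤ T) : |Th m n x| ≤ Th m n T := by
  have hTT : |T| ≤ T := (abs_of_pos hT.1).le
  rw [abs_le, ← S.Th_neg]
  rw [abs_le] at hx
  exact ⟨S.Th_mono hT hn hnT (by rw [abs_neg]; exact hTT) (abs_le.2 hx) hx.1,
    S.Th_mono hT hn hnT (abs_le.2 hx) hTT hx.2⟩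

lemma FF_le_abs (S : Shape m t0) {T n x : ℝ} (hx : |x| ≤ T) : |FF m n x| ≤ FF m n T := by
  rw [abs_le, ← S.FF_neg]
  rw [abs_le] at hx
  exact ⟨S.FF_mono n hx.1, S.FF_mono n hx.2⟩

lemma FF_nonneg (S : Shape m t0) {n x : ℝ} (hx : 0 ≤ x) : 0 ≤ FF m n x := by
  have := S.FF_mono n hx
  rwa [FF_zero] at this

/-- `φ` diverges -/
lemma phi_div (S : Shape m t0) (N T1 : ℝ) (hT1 : T1 < t0) : ∃ b ∈ Ioo 0 t0, T1 ≤ b ∧ N ≤ phi m (m b) := by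
  obtain ⟨T, hT, h1, h2⟩ := S.Th_div (N/2) T1 hT1
  refine ⟨T, hT, h1, ?_⟩
  rw [S.phi_eq hT]
  have := S.Th_monoN hT hT.1.le le_rfl (S.pos t0).le (S.min T) le_rfl
  linarith

/-- C1: calibration -/
lemma calib (S : Shape m t0) {c : ℝ → ℝ × ℝ} (hc : ContDiff ℝ 1 c) {a b n : ℝ} (hab : a ≤ b) (hn : 0 ≤ n)
    (h : ∀ s ∈ Icc a b, n ≤ m (c s).1) :
    n * |(c b).2 - (c a).2| + |FF m n (c b).1 - FF m n (c a).1| ≤ wLength m c a b := by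
  have h1 : ContDiff ℝ 1 fun u => (c u).1 := contDiff_fst.comp hc
  have h2 : ContDiff ℝ 1 fun u => (c u).2 := contDiff_snd.comp hc
  have d1 : Continuous (deriv fun u => (c u).1) := h1.continuous_deriv le_rfl
  have d2 : Continuous (deriv fun u => (c u).2) := h2.continuous_deriv le_rfl
  have hd1 : ∀ s, HasDerivAt (fun u => (c u).1) (deriv (fun u => (c u).1) s) s :=
    fun s => (h1.differentiable one_ne_zero s).hasDerivAt
  have hd2 : ∀ s, HasDerivAt (fun u => (c u).2) (deriv (fun u => (c u).2) s) s :=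
    fun s => (h2.differentiable one_ne_zero s).hasDerivAt
  have cm := S.cont
  have cF := S.fF_cont n
  have c1 := h1.continuous
  have e1 : (c b).2 - (c a).2 = ∫ s in a..b, deriv (fun u => (c u).2) s :=
    (intervalIntegral.integral_eq_sub_of_hasDerivAt (fun s _ => hd2 s) (d2.intervalIntegrable _ _)).symm
  have cG : Continuous fun s => fF m n (c s).1 * deriv (fun u => (c u).1) s := (cF.comp c1).mul d1
  have e2 : FF m n (c b).1 - FF m n (c a).1 = ∫ s in a..b, fF m n (c s).1 * deriv (fun u => (c u).1) s :=
    (intervalIntegral.integral_eq_sub_of_hasDerivAt (f := fun s => FF m n (c s).1)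
      (f' := fun s => fF m n (c s).1 * deriv (fun u => (c u).1) s)
      (fun s _ => HasDerivAt.comp s (h₂ := FF m n) (h := fun u => (c u).1) (S.FF_deriv n (c s).1) (hd1 s)) (cG.intervalIntegrable _ _)).symm
  have i1 : |(c b).2 - (c a).2| ≤ ∫ s in a..b, |deriv (fun u => (c u).2) s| := by
    rw [e1]; exact intervalIntegral.abs_integral_le_integral_abs hab
  have i2 : |FF m n (c b).1 - FF m n (c a).1| ≤ ∫ s in a..b, |fF m n (c s).1 * deriv (fun u => (c u).1) s| := by
    rw [e2]; exact intervalIntegral.abs_integral_le_integral_abs hab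
  calc _ ≤ n * (∫ s in a..b, |deriv (fun u => (c u).2) s|) +
        ∫ s in a..b, |fF m n (c s).1 * deriv (fun u => (c u).1) s| := by gcongr
    _ = ∫ s in a..b, (n * |deriv (fun u => (c u).2) s| + |fF m n (c s).1 * deriv (fun u => (c u).1) s|) := by
        rw [← intervalIntegral.integral_const_mul, ← intervalIntegral.integral_add]
        · exact (continuous_const.mul d2.abs).intervalIntegrable _ _
        · exact cG.abs.intervalIntegrable _ _
    _ ≤ _ := by
        refine intervalIntegral.integral_mono_on hab ?_ ?_ fun s hs => ?_
        · exact ((continuous_const.mul d2.abs).add cG.abs).intervalIntegrable _ _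
        · apply Continuous.intervalIntegrable; fun_prop
        · set v := deriv (fun u => (c u).1) s
          set w := deriv (fun u => (c u).2) s
          set M := m (c s).1
          have hM : 0 < M := S.pos _
          have hnM : n ≤ M := h s hs
          apply Real.le_sqrt_of_sq_le
          have hr : fF m n (c s).1 = √(M ^ 2 - n ^ 2) / M := rfl
          set r := √(M ^ 2 - n ^ 2)
          have hr2 : r ^ 2 = M ^ 2 - n ^ 2 := Real.sq_sqrt (by nlinarith)
          have hr0 : 0 ≤ r := Real.sqrt_nonneg _
          rw [abs_mul, hr, abs_of_nonneg (show 0 ≤ r / M by positivity), ← sq_abs v, ← sq_abs w]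
          generalize |v| = v
          generalize |w| = w
          have : (n * w + r / M * v) ^ 2 = v ^ 2 + M ^ 2 * w ^ 2 - (r * w - n * v / M) ^ 2 := by
            field_simp
            have : n ^ 2 = M ^ 2 - r ^ 2 := by linarith
            linear_combination (M^2*w^2 + v^2) * this
          rw [this]
          linarith [sq_nonneg (r * w - n * v / M)]

end Shape

/-- candidates -/
def Cand (m : ℝ → ℝ) (t0 tq t θ ν s : ℝ) : Prop :=
  (0 ≤ ν ∧ ν ≤ m t0 ∧ s = ν * θ + |FF m ν t - FF m ν tq|) ∨
  (∃ b ∈ Ioo 0 t0, |t| ≤ b ∧ |tq| ≤ b ∧ ν = m b ∧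
    ((θ = |Th m ν t - Th m ν tq| ∧ s = ν * θ + |FF m ν t - FF m ν tq|) ∨
     (θ = phi m ν - |Th m ν t + Th m ν tq| ∧ s = ν * θ + (2 * FF m ν b - |FF m ν t + FF m ν tq|))))

lemma abs_max {a b P : ℝ} (ha : |a| ≤ P) (hb : |b| ≤ P) : |a - b| + |a + b| ≤ 2 * P := by
  rw [abs_le] at ha hb
  rcases abs_cases (a - b) with h | h <;> rcases abs_cases (a + b) with h' | h' <;> linarith

namespace Shape
variable {m : ℝ → ℝ} {t0 : ℝ}

/-- core inequality for second pass and big first pass -/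
lemma core2 (S : Shape m t0) {tq t θ b c : ℝ} (htq : tq ≠ 0) (hb : b ∈ Ioo 0 t0) (hc : c ∈ Ioc 0 t0)
    (h1 : |t| ≤ b) (h2 : |tq| ≤ b) (h3 : |t| ≤ c) (h4 : |tq| ≤ c)
    (hθ : 0 ≤ (m b - m c) * (phi m (m b) - |Th m (m b) t + Th m (m b) tq| - θ)) :
    m b * θ + (2 * FF m (m b) b - |FF m (m b) t + FF m (m b) tq|) ≤
    m c * θ + (2 * FF m (m c) c - |FF m (m c) t + FF m (m c) tq|) := by
  have hS5 := S.Phi_conv hb hc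
  have hT : max |t| |tq| ∈ Ioo 0 t0 :=
    ⟨(abs_pos.2 htq).trans_le (le_max_right _ _), (max_le h1 h2).trans_lt hb.2⟩
  have hmb : m b ≤ m (max |t| |tq|) := S.le_of (by rw [abs_of_pos hT.1, abs_of_pos hb.1]; exact max_le h1 h2)
    (by rw [abs_of_pos hb.1]; exact hb.2.le)
  have hmc : m c ≤ m (max |t| |tq|) := S.le_of (by rw [abs_of_pos hT.1, abs_of_pos hc.1]; exact max_le h3 h4)
    (by rw [abs_of_pos hc.1]; exact hc.2)
  have hS6 := S.FF_tangent (x := -tq) (y := t) hT (S.pos c).le (S.pos b).le hmb hmc (by rw [abs_neg]; exact le_max_right _ _) (le_max_left _ _)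
  simp only [S.FF_neg, S.Th_neg, sub_neg_eq_add] at hS6
  nlinarith

/-- `s ≤ g(n)` -/
lemma cand_g (S : Shape m t0) {tq t θ ν s b : ℝ} (htq : tq ≠ 0) (hC : Cand m t0 tq t θ ν s)
    (hb : b ∈ Ioo 0 t0) (h1 : |t| ≤ b) (h2 : |tq| ≤ b) (hθ : |Th m (m b) t - Th m (m b) tq| ≤ θ) :
    s ≤ m b * θ + (2 * FF m (m b) b - |FF m (m b) t + FF m (m b) tq|) := by
  have A := abs_max (S.FF_le_abs (n := m b) h1) (S.FF_le_abs h2)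
  have low : 0 ≤ ν → ν ≤ m b → s = ν * θ + |FF m ν t - FF m ν tq| →
      s ≤ m b * θ + (2 * FF m (m b) b - |FF m (m b) t + FF m (m b) tq|) := by
    intro h0 hle hs
    have := S.FF_tangent (x := tq) (y := t) hb h0 (S.pos b).le le_rfl hle h2 h1
    nlinarith
  rcases hC with ⟨h0, hν, hs⟩ | ⟨d, hd, h3, h4, rfl, ⟨hθ', hs⟩ | ⟨hθ', hs⟩⟩
  · exact low h0 (hν.trans (S.min b)) hs
  · rcases le_total (m d) (m b) with h | h
    · exact low (S.pos d).le h hs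
    · refine le_trans ?_ (S.core2 (θ := θ) htq hd ⟨hb.1, hb.2.le⟩ h3 h4 h1 h2 ?_)
      · have := abs_max (S.FF_le_abs (n := m d) h3) (S.FF_le_abs h4)
        linarith
      · have := abs_max (S.Th_le_abs hd (S.pos d).le le_rfl h3) (S.Th_le_abs hd (S.pos d).le le_rfl h4)
        rw [← hθ', ← S.phi_eq hd] at this
        exact mul_nonneg (by linarith) (by linarith)
  · rw [hs]
    exact S.core2 htq hd ⟨hb.1, hb.2.le⟩ h3 h4 h1 h2 (by rw [hθ']; simp)

/-- lower bound by the excursion -/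
lemma exc (S : Shape m t0) {c : ℝ → ℝ × ℝ} (hc : ContDiff ℝ 1 c) {b tq t θ : ℝ} (hb : 0 ≤ b)
    (h0 : (c 0).1 = tq) (h1 : (c b).1 = t) (hq : |tq| < t0) (ht : |t| < t0) (htq : tq ≠ 0)
    (hθ : θ ≤ |(c b).2 - (c 0).2|) :
    ∃ c0 ∈ Ioc 0 t0, |t| ≤ c0 ∧ |tq| ≤ c0 ∧ (∀ s ∈ Icc 0 b, m c0 ≤ m (c s).1) ∧
      m c0 * θ + (2 * FF m (m c0) c0 - |FF m (m c0) t + FF m (m c0) tq|) ≤ wLength m c 0 b := by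
  have h1c : Continuous fun u => |(c u).1| := (continuous_fst.comp hc.continuous).abs
  obtain ⟨sB, hsB, hB⟩ := (isCompact_Icc (a := (0:ℝ)) (b := b)).exists_isMaxOn ⟨0, le_rfl, hb⟩ h1c.continuousOn
  have hmax : ∀ s ∈ Icc 0 b, |(c s).1| ≤ |(c sB).1| := fun s hs => hB hs
  have b1 : |tq| ≤ |(c sB).1| := by rw [← h0]; exact hmax 0 ⟨le_rfl, hb⟩
  have b2 : |t| ≤ |(c sB).1| := by rw [← h1]; exact hmax b ⟨hb, le_rfl⟩
  set c0 := Min.min |(c sB).1| t0 with hc0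
  have b3 : |tq| ≤ c0 := le_min b1 hq.le
  have b4 : |t| ≤ c0 := le_min b2 ht.le
  have b5 : 0 < c0 := (abs_pos.2 htq).trans_le b3
  have b6 : c0 ≤ t0 := min_le_right _ _
  have hm : ∀ s ∈ Icc 0 b, m c0 ≤ m (c s).1 := by
    intro s hs
    rcases le_total |(c s).1| t0 with h | h
    · exact S.le_of (by rw [abs_of_pos b5]; exact le_min (hmax s hs) h) (by rwa [abs_of_pos b5])
    · have : c0 = t0 := by rw [hc0, min_eq_right]; exact h.trans (hmax s hs)
      rw [this]; exact S.min _
  refine ⟨c0, ⟨b5, b6⟩, b4, b3, hm, ?_⟩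
  obtain ⟨s1, hs1, e1⟩ : ∃ s1 ∈ Icc 0 b, |(c s1).1| = c0 := by
    have := intermediate_value_Icc hsB.1 (h1c.continuousOn (s := Icc 0 sB))
    obtain ⟨s1, hs1, e⟩ := this (show c0 ∈ _ from ⟨by simp only [h0]; exact b3, min_le_left _ _⟩)
    exact ⟨s1, ⟨hs1.1, hs1.2.trans hsB.2⟩, e⟩
  have L1 := S.calib hc hs1.1 (S.pos c0).le fun s hs => hm s ⟨hs.1, hs.2.trans hs1.2⟩
  have L2 := S.calib hc hs1.2 (S.pos c0).le fun s hs => hm s ⟨hs1.1.trans hs.1, hs.2⟩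
  have hcont : Continuous fun s => √((deriv (fun u => (c u).1) s) ^ 2 +
      (m (c s).1) ^ 2 * (deriv (fun u => (c u).2) s) ^ 2) := by
    have k1 : ContDiff ℝ 1 fun u => (c u).1 := contDiff_fst.comp hc
    have k2 : ContDiff ℝ 1 fun u => (c u).2 := contDiff_snd.comp hc
    have d1 : Continuous (deriv fun u => (c u).1) := k1.continuous_deriv le_rfl
    have d2 : Continuous (deriv fun u => (c u).2) := k2.continuous_deriv le_rfl
    have := S.cont
    have := k1.continuous
    fun_prop
  have hadd : wLength m c 0 s1 + wLength m c s1 b = wLength m c 0 b :=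
    intervalIntegral.integral_add_adjacent_intervals (hcont.intervalIntegrable _ _) (hcont.intervalIntegrable _ _)
  rw [← hadd]
  rw [h0] at L1
  rw [h1] at L2
  have tri : θ ≤ |(c s1).2 - (c 0).2| + |(c b).2 - (c s1).2| := by
    refine hθ.trans ?_
    have := abs_add_le ((c s1).2 - (c 0).2) ((c b).2 - (c s1).2)
    refine le_trans (le_of_eq ?_) this
    congr 1; ring
  have hF : 2 * FF m (m c0) c0 - |FF m (m c0) t + FF m (m c0) tq| ≤
      |FF m (m c0) (c s1).1 - FF m (m c0) tq| + |FF m (m c0) t - FF m (m c0) (c s1).1| := by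
    have : FF m (m c0) (c s1).1 = FF m (m c0) c0 ∨ FF m (m c0) (c s1).1 = - FF m (m c0) c0 := by
      rcases abs_choice (c s1).1 with h | h
      · left; rw [← e1, h]
      · right; rw [← e1, h, S.FF_neg, neg_neg]
    generalize FF m (m c0) (c s1).1 = X at *
    generalize FF m (m c0) c0 = P at *
    generalize FF m (m c0) t = A
    generalize FF m (m c0) tq = B
    have k1 := le_abs_self (A + B)
    have k2 := neg_abs_le (A + B)
    have k3 := le_abs_self (X - B)
    have k4 := neg_abs_le (X - B)
    have k5 := le_abs_self (A - X)
    have k6 := neg_abs_le (A - X)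
    rcases this with rfl | rfl <;> linarith
  have := mul_le_mul_of_nonneg_left tri (S.pos c0).le
  linarith

/-- Lemma L -/
lemma cand_le (S : Shape m t0) {tq t θ ν s : ℝ} (htq : tq ≠ 0) (hC : Cand m t0 tq t θ ν s)
    {c : ℝ → ℝ × ℝ} (hc : ContDiff ℝ 1 c) {b : ℝ} (hb : 0 ≤ b)
    (h0 : (c 0).1 = tq) (h1 : (c b).1 = t)
    (hθ : θ ≤ |(c b).2 - (c 0).2|) : s ≤ wLength m c 0 b := by
  have low : 0 ≤ ν → (∀ s ∈ Icc 0 b, ν ≤ m (c s).1) → s = ν * θ + |FF m ν t - FF m ν tq| → s ≤ wLength m c 0 b := by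
    intro h2 h3 hs
    have := S.calib hc hb h2 h3
    rw [h0, h1] at this
    nlinarith
  rcases hC with ⟨h2, hν, hs⟩ | ⟨d, hd, h3, h4, rfl, hh⟩
  · exact low h2 (fun s _ => hν.trans (S.min _)) hs
  · obtain ⟨c0, hc0, k1, k2, k3, k4⟩ := S.exc hc hb h0 h1 (h4.trans_lt hd.2) (h3.trans_lt hd.2) htq hθ
    rcases hh with ⟨hθ', hs⟩ | ⟨hθ', hs⟩
    · rcases le_total (m d) (m c0) with h | h
      · exact low (S.pos d).le (fun s hs => h.trans (k3 s hs)) hs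
      · refine le_trans (le_trans ?_ (S.core2 (θ := θ) htq hd hc0 h3 h4 k1 k2 ?_)) k4
        · have := abs_max (S.FF_le_abs (n := m d) h3) (S.FF_le_abs h4)
          linarith
        · have := abs_max (S.Th_le_abs hd (S.pos d).le le_rfl h3) (S.Th_le_abs hd (S.pos d).le le_rfl h4)
          rw [← hθ', ← S.phi_eq hd] at this
          exact mul_nonneg (by linarith) (by linarith)
    · rw [hs]
      exact le_trans (S.core2 htq hd hc0 h3 h4 k1 k2 (by rw [hθ']; simp)) k4

end Shape
end

section
open Real Set MeasureTheory Filter Topology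
lemma wLength_nonneg {m : ℝ → ℝ} {c : ℝ → ℝ × ℝ} {b : ℝ} (hb : 0 ≤ b) : 0 ≤ wLength m c 0 b :=
  intervalIntegral.integral_nonneg hb fun _ _ => Real.sqrt_nonneg _

lemma wDist_le {m : ℝ → ℝ} {p q : ℝ × ℝ} {c : ℝ → ℝ × ℝ} {b : ℝ} (hb : 0 ≤ b) (hc : ContDiff ℝ 1 c)
    (h0 : c 0 = p) (h1 : c b = q) : wDist m p q ≤ wLength m c 0 b := by
  refine csInf_le ⟨0, ?_⟩ ⟨c, b, hb, hc, h0, h1, rfl⟩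
  rintro L ⟨c, b, hb, -, -, -, rfl⟩
  exact wLength_nonneg hb

lemma le_wDist {m : ℝ → ℝ} {p q : ℝ × ℝ} {L : ℝ}
    (h : ∀ c : ℝ → ℝ × ℝ, ∀ b : ℝ, 0 ≤ b → ContDiff ℝ 1 c → c 0 = p → c b = q → L ≤ wLength m c 0 b) :
    L ≤ wDist m p q := by
  refine le_csInf ?_ ?_
  · refine ⟨_, fun s => p + s • (q - p), 1, zero_le_one, by fun_prop, by simp, by simp, rfl⟩
  · rintro L' ⟨c, b, hb, hc, h0, h1, rfl⟩
    exact h c b hb hc h0 h1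

lemma wDist_nonneg {m : ℝ → ℝ} {p q : ℝ × ℝ} : 0 ≤ wDist m p q :=
  le_wDist fun _ _ hb _ _ _ => wLength_nonneg hb

lemma cylDist_le {m : ℝ → ℝ} {p q : ℝ × ℝ} {P Q : ℝ × Real.Angle} (hp : proj p = P) (hq : proj q = Q) :
    cylDist m P Q ≤ wDist m p q := by
  refine csInf_le ⟨0, ?_⟩ ⟨p, q, hp, hq, rfl⟩
  rintro L ⟨p, q, -, -, rfl⟩
  exact wDist_nonneg

lemma le_cylDist {m : ℝ → ℝ} {P Q : ℝ × Real.Angle} {L : ℝ}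
    (h : ∀ p q : ℝ × ℝ, proj p = P → proj q = Q → L ≤ wDist m p q) : L ≤ cylDist m P Q := by
  have hs : ∀ P : ℝ × Real.Angle, ∃ p, proj p = P := by
    rintro ⟨x, y⟩
    obtain ⟨z, rfl⟩ := QuotientAddGroup.mk_surjective y
    exact ⟨(x, z), rfl⟩
  refine le_csInf ?_ ?_
  · obtain ⟨p, hp⟩ := hs P
    obtain ⟨q, hq⟩ := hs Q
    exact ⟨_, p, q, hp, hq, rfl⟩
  · rintro L' ⟨p, q, hp, hq, rfl⟩
    exact h p q hp hq

lemma angle_abs {x : ℝ} (hx : |x| ≤ π) (k : ℤ) : |x| ≤ |x + 2 * π * k| := by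
  have hpi := pi_pos
  rcases lt_trichotomy k 0 with h | h | h
  · have : (k:ℝ) ≤ -1 := by exact_mod_cast Int.le_sub_one_of_lt h
    rw [abs_le] at hx
    have h2 : 2 * π * k ≤ -2 * π := by nlinarith
    rw [abs_of_nonpos (by linarith : x + 2 * π * k ≤ 0)]
    rw [abs_le]; constructor <;> linarith
  · simp [h]
  · have : (1:ℝ) ≤ k := by exact_mod_cast h
    rw [abs_le] at hx
    have h2 : 2 * π ≤ 2 * π * k := by nlinarith
    rw [abs_of_nonneg (by linarith : 0 ≤ x + 2 * π * k)]
    rw [abs_le]; constructor <;> linarith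

lemma Shape.cyl_lower {m : ℝ → ℝ} {t0 : ℝ} (S : Shape m t0) {tq t x ν s : ℝ} (htq : tq ≠ 0)
    (hC : Cand m t0 tq t |x| ν s) (hx : |x| ≤ π) :
    s ≤ cylDist m (tq, ((0:ℝ) : Real.Angle)) (t, (x : Real.Angle)) := by
  refine le_cylDist fun p q hp hq => le_wDist fun c b hb hc h0 h1 => ?_
  simp only [proj, Prod.mk.injEq] at hp hq
  refine S.cand_le htq hC hc hb (by rw [h0, hp.1]) (by rw [h1, hq.1]) ?_
  rw [h0, h1]
  have : ((q.2 - p.2 : ℝ) : Real.Angle) = (x : Real.Angle) := by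
    rw [Real.Angle.coe_sub, hp.2, hq.2]; simp
  rw [Real.Angle.angle_eq_iff_two_pi_dvd_sub] at this
  obtain ⟨k, hk⟩ := this
  have e : q.2 - p.2 = x + 2 * π * k := by linarith
  rw [e]
  exact angle_abs hx k

lemma geod_length {m : ℝ → ℝ} {γ : ℝ → ℝ × ℝ} (hγ : IsUnitGeodesic m γ) (s : ℝ) : wLength m γ 0 s = s := by
  unfold wLength
  simp only [hγ.2.2.2]
  simp

lemma cyl_upper {m : ℝ → ℝ} {γ : ℝ → ℝ × ℝ} (hγ : IsUnitGeodesic m γ) {s : ℝ} (hs : 0 ≤ s) :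
    cylDist m (proj (γ 0)) (proj (γ s)) ≤ s := by
  have h := wDist_le (m := m) hs (hγ.1.of_le (by norm_num)) rfl rfl
  rw [geod_length hγ] at h
  exact (cylDist_le rfl rfl).trans h

lemma cyl_strict {m : ℝ → ℝ} (hmc : Continuous m) (hmp : ∀ t, 0 < m t) {γ : ℝ → ℝ × ℝ} (hγ : IsUnitGeodesic m γ)
    {ν : ℝ} (hν : HasClairaut m γ ν) (hν0 : ν ≠ 0) {s : ℝ} (hs : 0 < s)
    (h : π < |(γ s).2 - (γ 0).2|) :
    cylDist m (proj (γ 0)) (proj (γ s)) < s := by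
  have hpi := pi_pos
  set D := (γ s).2 - (γ 0).2 with hD
  have hD0 : D ≠ 0 := by intro h0; rw [h0] at h; simp at h; linarith
  obtain ⟨k, hk⟩ : ∃ k : ℤ, |D - 2 * π * k| < |D| := by
    rcases abs_cases D with h' | h'
    · refine ⟨1, ?_⟩
      rw [h'.1, abs_lt]; push_cast; constructor <;> linarith
    · refine ⟨-1, ?_⟩
      rw [h'.1, abs_lt]; push_cast; constructor <;> linarith
  set l := (D - 2 * π * k) / D with hl
  have hl1 : l ^ 2 < 1 := by
    rw [hl, div_pow, div_lt_one (by positivity)]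
    exact sq_lt_sq.2 hk
  set c : ℝ → ℝ × ℝ := fun u => ((γ u).1, (γ 0).2 + l * ((γ u).2 - (γ 0).2)) with hc
  have hγ1 : ContDiff ℝ 1 γ := hγ.1.of_le (by norm_num)
  have g1 : ContDiff ℝ 1 fun u => (γ u).1 := contDiff_fst.comp hγ1
  have g2 : ContDiff ℝ 1 fun u => (γ u).2 := contDiff_snd.comp hγ1
  have hcc : ContDiff ℝ 1 c := by
    refine g1.prodMk ?_
    fun_prop
  have hd2 : ∀ u, deriv (fun u => (c u).2) u = l * deriv (fun u => (γ u).2) u := by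
    intro u
    have := (g2.differentiable one_ne_zero u).hasDerivAt
    exact (((this.sub_const (γ 0).2).const_mul l).const_add (γ 0).2).deriv
  have hw := wDist_le (m := m) hs.le hcc rfl rfl
  have hlt : wLength m c 0 s < s := by
    conv_rhs => rw [← geod_length hγ s]
    unfold wLength
    have d1 : Continuous (deriv fun u => (γ u).1) := g1.continuous_deriv le_rfl
    have d2 : Continuous (deriv fun u => (γ u).2) := g2.continuous_deriv le_rfl
    have c1 := g1.continuous
    simp only [hd2]
    have hpt : ∀ u, √(deriv (fun u => (c u).1) u ^ 2 + m (c u).1 ^ 2 * (l * deriv (fun u => (γ u).2) u) ^ 2) <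
        √(deriv (fun u => (γ u).1) u ^ 2 + m (γ u).1 ^ 2 * (deriv (fun u => (γ u).2) u) ^ 2) := by
      intro u
      apply Real.sqrt_lt_sqrt (by positivity)
      show deriv (fun u => (γ u).1) u ^ 2 + m (γ u).1 ^ 2 * (l * deriv (fun u => (γ u).2) u) ^ 2 < _
      have h1 := hν u
      have hne : deriv (fun u => (γ u).2) u ≠ 0 := by
        intro h0; rw [h0] at h1; simp at h1; exact hν0 h1.symm
      have : 0 < m (γ u).1 ^ 2 * (deriv (fun u => (γ u).2) u) ^ 2 := by
        have := hmp (γ u).1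
        positivity
      nlinarith
    refine intervalIntegral.integral_lt_integral_of_continuousOn_of_le_of_exists_lt hs ?_ ?_ (fun u _ => (hpt u).le)
      ⟨0, ⟨le_rfl, hs.le⟩, hpt 0⟩
    · apply Continuous.continuousOn
      show Continuous fun u => √(deriv (fun u => (γ u).1) u ^ 2 + m (γ u).1 ^ 2 * (l * deriv (fun u => (γ u).2) u) ^ 2)
      fun_prop
    · apply Continuous.continuousOn
      fun_prop
  refine lt_of_le_of_lt ((cylDist_le ?_ ?_).trans hw) hlt
  · simp [hc, proj]
  · simp only [hc, proj, Prod.mk.injEq, true_and]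
    rw [Real.Angle.angle_eq_iff_two_pi_dvd_sub]
    refine ⟨-k, ?_⟩
    rw [← hD, hl, div_mul_cancel₀ _ hD0]
    push_cast
    linarith

/-- normalised geodesic data -/
structure Geo (m : ℝ → ℝ) (tq ν : ℝ) (t v θ : ℝ → ℝ) : Prop where
  z : t 0 = tq
  zθ : θ 0 = 0
  dt : ∀ s, HasDerivAt t (v s) s
  dv : ∀ s, HasDerivAt v (ν ^ 2 * deriv m (t s) / m (t s) ^ 3) s
  dθ : ∀ s, HasDerivAt θ (ν / m (t s) ^ 2) s
  en : ∀ s, v s ^ 2 = 1 - ν ^ 2 / m (t s) ^ 2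

lemma Geo.cont {m : ℝ → ℝ} {tq ν : ℝ} {t v θ : ℝ → ℝ} (G : Geo m tq ν t v θ) :
    Continuous t ∧ Continuous v ∧ Continuous θ :=
  ⟨continuous_iff_continuousAt.2 fun s => (G.dt s).continuousAt,
   continuous_iff_continuousAt.2 fun s => (G.dv s).continuousAt,
   continuous_iff_continuousAt.2 fun s => (G.dθ s).continuousAt⟩

lemma Geo.reflect {m : ℝ → ℝ} {t0 : ℝ} (S : Shape m t0) {tq ν : ℝ} {t v θ : ℝ → ℝ} (G : Geo m tq ν t v θ) :
    Geo m (-tq) ν (fun s => -t s) (fun s => -v s) θ where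
  z := by simp [G.z]
  zθ := G.zθ
  dt s := (G.dt s).neg
  dv s := by
    rw [S.even, S.odd_d]
    exact (G.dv s).neg.congr_deriv (by ring)
  dθ s := by rw [S.even]; exact G.dθ s
  en s := by rw [S.even, ← G.en s]; ring

/-- a unit geodesic gives normalised data -/
lemma geo_of {m : ℝ → ℝ} {t0 : ℝ} (S : Shape m t0) {γ : ℝ → ℝ × ℝ} (hγ : IsUnitGeodesic m γ) :
    ∃ ν ε : ℝ, 0 ≤ ν ∧ |ε| = 1 ∧ HasClairaut m γ (ε * ν) ∧ Geo m (γ 0).1 ν (fun s => (γ s).1)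
      (deriv fun s => (γ s).1) (fun s => ε * ((γ s).2 - (γ 0).2)) := by
  obtain ⟨h1, h2, ⟨ν, h3⟩, h4⟩ := hγ
  obtain ⟨ε, hε, hεν, hε2⟩ : ∃ ε : ℝ, |ε| = 1 ∧ ε * ν = |ν| ∧ ε * |ν| = ν := by
    rcases abs_cases ν with h | h
    · exact ⟨1, by simp, by rw [h.1]; ring, by rw [h.1]; ring⟩
    · exact ⟨-1, by simp, by rw [h.1]; ring, by rw [h.1]; ring⟩
  have g1 : ContDiff ℝ 2 fun u => (γ u).1 := contDiff_fst.comp h1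
  have g2 : ContDiff ℝ 2 fun u => (γ u).2 := contDiff_snd.comp h1
  have g1' : ContDiff ℝ 1 (deriv fun u => (γ u).1) := by
    have := (contDiff_succ_iff_deriv (n := 1) (f := fun u => (γ u).1)).1 (by simpa [one_add_one_eq_two] using g1)
    exact this.2.2
  have hθ : ∀ s, deriv (fun u => (γ u).2) s = ν / m (γ s).1 ^ 2 := by
    intro s
    have := S.pos (γ s).1
    rw [← h3 s]; field_simp
  refine ⟨|ν|, ε, abs_nonneg _, hε, by intro s; rw [h3 s, hε2], rfl, by simp, ?_, ?_, ?_, ?_⟩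
  · intro s; exact (g1.differentiable two_ne_zero s).hasDerivAt
  · intro s
    refine (g1'.differentiable one_ne_zero s).hasDerivAt.congr_deriv ?_
    rw [h2, hθ, sq_abs]
    have := S.pos (γ s).1
    field_simp
  · intro s
    have := ((g2.differentiable two_ne_zero s).hasDerivAt.sub_const (γ 0).2).const_mul ε
    refine this.congr_deriv ?_
    rw [hθ, ← hεν]; ring
  · intro s
    have h := h4 s
    rw [hθ] at h
    rw [sq_abs]
    have := S.pos (γ s).1
    have e : m (γ s).1 ^ 2 * (ν / m (γ s).1 ^ 2) ^ 2 = ν ^ 2 / m (γ s).1 ^ 2 := by field_simp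
    linarith

lemma Geo.geod {m : ℝ → ℝ} {t0 : ℝ} (S : Shape m t0) {tq ν : ℝ} {t v θ : ℝ → ℝ} (G : Geo m tq ν t v θ)
    {ε : ℝ} (hε : |ε| = 1) :
    IsUnitGeodesic m (fun s => (t s, ε * θ s)) ∧ HasClairaut m (fun s => (t s, ε * θ s)) (ε * ν) := by
  obtain ⟨ct, cv, cθ⟩ := G.cont
  have cm := S.cont
  have cdm := S.contd
  have hd1 : deriv t = v := funext fun s => (G.dt s).deriv
  have hd2 : deriv v = fun s => ν ^ 2 * deriv m (t s) / m (t s) ^ 3 := funext fun s => (G.dv s).deriv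
  have hd3' : ∀ s, HasDerivAt (fun u => ε * θ u) (ε * (ν / m (t s) ^ 2)) s := fun s => (G.dθ s).const_mul ε
  have hd3 : deriv (fun u => ε * θ u) = fun s => ε * (ν / m (t s) ^ 2) := funext fun s => (hd3' s).deriv
  have hε2 : ε ^ 2 = 1 := by rw [← sq_abs, hε]; norm_num
  have mne : ∀ s, m (t s) ≠ 0 := fun s => (S.pos _).ne'
  have cC : HasClairaut m (fun s => (t s, ε * θ s)) (ε * ν) := by
    intro s
    simp only [hd3]
    have := mne s
    field_simp
  refine ⟨⟨?_, ?_, ⟨_, cC⟩, ?_⟩, cC⟩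
  · have kv : ContDiff ℝ 1 v := by
      rw [contDiff_one_iff_deriv, hd2]
      refine ⟨fun s => (G.dv s).differentiableAt, ?_⟩
      refine Continuous.div (by fun_prop) (by fun_prop) fun s => pow_ne_zero _ (mne s)
    have kt : ContDiff ℝ 2 t := by
      have := (contDiff_succ_iff_deriv (𝕜 := ℝ) (n := 1) (f := t)).2
        ⟨fun s => (G.dt s).differentiableAt, by simp, by rw [hd1]; exact kv⟩
      simpa [one_add_one_eq_two] using this
    have kθ : ContDiff ℝ 2 (fun s => ε * θ s) := by
      have := (contDiff_succ_iff_deriv (𝕜 := ℝ) (n := 1) (f := fun s => ε * θ s)).2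
        ⟨fun s => (hd3' s).differentiableAt, by simp, by
          rw [hd3]
          have k1 : ContDiff ℝ 1 fun s => m (t s) :=
            (S.smooth.of_le (by exact_mod_cast le_top)).comp (kt.of_le (by norm_num))
          exact contDiff_const.mul (contDiff_const.div (k1.pow 2) fun s => pow_ne_zero _ (mne s))⟩
      simpa [one_add_one_eq_two] using this
    exact kt.prodMk kθ
  · intro s
    simp only [hd1, hd2, hd3]
    have := mne s
    field_simp
    rw [hε2]; ring
  · intro s
    simp only [hd1, hd3, G.en]
    have := mne s
    field_simp
    rw [hε2]; ring

end

section
open Real Set MeasureTheory Filter Topology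
open scoped NNReal
/-- the geodesic vector field -/
def geoF (g : ℝ → ℝ) (y : ℝ × ℝ) : ℝ × ℝ := (cos y.2, -(g y.1 * sin y.2))

lemma geoF_lip {g : ℝ → ℝ} {B C : ℝ} (hB : ∀ x, |g x| ≤ B) (hC0 : 0 ≤ C)
    (hC : ∀ x y, |g x - g y| ≤ C * |x - y|) :
    LipschitzWith (Real.toNNReal (1 + B + C)) (geoF g) := by
  have hB0 : 0 ≤ B := (abs_nonneg _).trans (hB 0)
  refine LipschitzWith.of_dist_le_mul fun x y => ?_
  rw [Real.coe_toNNReal _ (by linarith), Prod.dist_eq, Prod.dist_eq]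
  simp only [geoF, Real.dist_eq]
  have h1 : |cos x.2 - cos y.2| ≤ |x.2 - y.2| := by
    have := Real.lipschitzWith_cos.dist_le_mul x.2 y.2
    simpa [Real.dist_eq] using this
  have h2 : |sin x.2 - sin y.2| ≤ |x.2 - y.2| := by
    have := Real.lipschitzWith_sin.dist_le_mul x.2 y.2
    simpa [Real.dist_eq] using this
  set D := max |x.1 - y.1| |x.2 - y.2|
  have hD1 : |x.1 - y.1| ≤ D := le_max_left _ _
  have hD2 : |x.2 - y.2| ≤ D := le_max_right _ _
  have hD0 : 0 ≤ D := (abs_nonneg _).trans hD1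
  refine max_le ?_ ?_
  · nlinarith
  · have e : -(g x.1 * sin x.2) - -(g y.1 * sin y.2)
        = -((g x.1 - g y.1) * sin x.2 + g y.1 * (sin x.2 - sin y.2)) := by ring
    rw [e, abs_neg]
    refine (abs_add_le _ _).trans ?_
    rw [abs_mul, abs_mul]
    have a1 : |g x.1 - g y.1| * |sin x.2| ≤ C * D := by
      refine (mul_le_mul (hC _ _) (abs_sin_le_one _) (abs_nonneg _) (by positivity)).trans ?_
      rw [mul_one]; gcongr
    have a2 : |g y.1| * |sin x.2 - sin y.2| ≤ B * D :=
      mul_le_mul (hB _) (h2.trans hD2) (abs_nonneg _) hB0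
    nlinarith

lemma geoF_exist {g : ℝ → ℝ} {B C : ℝ} (hB : ∀ x, |g x| ≤ B) (hC0 : 0 ≤ C)
    (hC : ∀ x y, |g x - g y| ≤ C * |x - y|) (y0 : ℝ × ℝ) {N : ℝ} (hN : 0 < N) :
    ∃ Y : ℝ → ℝ × ℝ, Y 0 = y0 ∧ ∀ s ∈ Icc (-N) N, HasDerivWithinAt Y (geoF g (Y s)) (Icc (-N) N) s := by
  have hB0 : 0 ≤ B := (abs_nonneg _).trans (hB 0)
  have hP : IsPicardLindelof (fun _ : ℝ => geoF g) (tmin := -N) (tmax := N) ⟨0, by constructor <;> linarith⟩ y0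
      (Real.toNNReal ((1+B) * N)) 0 (Real.toNNReal (1+B)) (Real.toNNReal (1 + B + C)) := by
    refine ⟨fun t _ => (geoF_lip hB hC0 hC).lipschitzOnWith, fun x _ => continuousOn_const, ?_, ?_⟩
    · intro t _ x _
      rw [Real.coe_toNNReal _ (by linarith), Prod.norm_def]
      simp only [geoF, Real.norm_eq_abs]
      refine max_le ((abs_cos_le_one _).trans (by linarith)) ?_
      rw [abs_neg, abs_mul]
      have := mul_le_mul (hB x.1) (abs_sin_le_one x.2) (abs_nonneg _) hB0
      linarith
    · rw [Real.coe_toNNReal _ (by linarith), Real.coe_toNNReal _ (by positivity)]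
      simp
  obtain ⟨Y, h1, h2⟩ := hP.exists_eq_forall_mem_Icc_hasDerivWithinAt₀
  exact ⟨Y, h1, h2⟩

/-- clamped function bounds -/
lemma clamp_bd {g : ℝ → ℝ} (hg : ContDiff ℝ 1 g) (R : ℝ) (hR : 0 ≤ R) :
    ∃ B C : ℝ, 0 ≤ C ∧ (∀ x, |g (max (-R) (min R x))| ≤ B) ∧
      ∀ x y, |g (max (-R) (min R x)) - g (max (-R) (min R y))| ≤ C * |x - y| := by
  have hmem : ∀ x, max (-R) (min R x) ∈ Icc (-R) R := fun x =>
    ⟨le_max_left _ _, max_le (by linarith) (min_le_left _ _)⟩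
  obtain ⟨B, hB⟩ := isCompact_Icc.exists_bound_of_continuousOn (hg.continuous.continuousOn (s := Icc (-R) R))
  obtain ⟨C, hC⟩ := isCompact_Icc.exists_bound_of_continuousOn
    ((hg.continuous_deriv le_rfl).continuousOn (s := Icc (-R) R))
  refine ⟨B, |C|, abs_nonneg _, fun x => hB _ (hmem x), fun x y => ?_⟩
  have := (convex_Icc (-R) R).norm_image_sub_le_of_norm_deriv_le (f := g) (C := |C|)
    (fun z _ => hg.differentiable one_ne_zero z) (fun z hz => (hC z hz).trans (le_abs_self _)) (hmem y) (hmem x)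
  refine this.trans ?_
  gcongr
  have h := ((LipschitzWith.id.const_min R).const_max (-R)).dist_le_mul x y
  simpa [Real.dist_eq] using h

lemma geo_local {g : ℝ → ℝ} (hg : ContDiff ℝ 1 g) (y0 : ℝ × ℝ) {N : ℝ} (hN : 0 < N) :
    ∃ Y : ℝ → ℝ × ℝ, Y 0 = y0 ∧ ∀ s ∈ Ioo (-N) N, HasDerivAt Y (geoF g (Y s)) s ∧ |(Y s).1| ≤ |y0.1| + N := by
  set R := |y0.1| + N
  obtain ⟨B, C, hC0, hB, hC⟩ := clamp_bd hg R (by positivity)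
  obtain ⟨Y, hY0, hY⟩ := geoF_exist hB hC0 hC y0 hN
  have hb : ∀ s ∈ Icc (-N) N, |(Y s).1| ≤ R := by
    intro s hs
    have h0 : (0:ℝ) ∈ Icc (-N) N := ⟨by linarith, by linarith⟩
    have := (convex_Icc (-N) N).norm_image_sub_le_of_norm_hasDerivWithin_le (f := fun s => (Y s).1) (C := 1)
      (f' := fun s => cos (Y s).2) (fun z hz => (hY z hz).fst) (fun z _ => abs_cos_le_one _) h0 hs
    simp only [hY0, Real.norm_eq_abs, sub_zero, one_mul] at this
    have h3 : |s| ≤ N := abs_le.2 hs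
    have h4 := abs_sub_abs_le_abs_sub (Y s).1 y0.1
    simp only [R]; linarith
  refine ⟨Y, hY0, fun s hs => ⟨?_, hb s (Ioo_subset_Icc_self hs)⟩⟩
  have h1 := (hY s (Ioo_subset_Icc_self hs)).hasDerivAt (Icc_mem_nhds hs.1 hs.2)
  have h2 := abs_le.1 (hb s (Ioo_subset_Icc_self hs))
  refine h1.congr_deriv ?_
  simp only [geoF]
  rw [min_eq_right h2.2, max_eq_right h2.1]

lemma geo_uniq {g : ℝ → ℝ} (hg : ContDiff ℝ 1 g) {N R : ℝ} (hN : 0 < N) (hR : 0 ≤ R) {Y Z : ℝ → ℝ × ℝ}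
    (h0 : Y 0 = Z 0)
    (hY : ∀ s ∈ Ioo (-N) N, HasDerivAt Y (geoF g (Y s)) s ∧ |(Y s).1| ≤ R)
    (hZ : ∀ s ∈ Ioo (-N) N, HasDerivAt Z (geoF g (Z s)) s ∧ |(Z s).1| ≤ R) :
    EqOn Y Z (Ioo (-N) N) := by
  obtain ⟨B, C, hC0, hB, hC⟩ := clamp_bd hg R hR
  have key : ∀ Y : ℝ → ℝ × ℝ, (∀ s ∈ Ioo (-N) N, HasDerivAt Y (geoF g (Y s)) s ∧ |(Y s).1| ≤ R) →
      ∀ s ∈ Ioo (-N) N, HasDerivAt Y (geoF (fun x => g (max (-R) (min R x))) (Y s)) s ∧ Y s ∈ (univ : Set (ℝ × ℝ)) := by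
    intro Y hY s hs
    obtain ⟨h1, h2⟩ := hY s hs
    have h2 := abs_le.1 h2
    refine ⟨h1.congr_deriv ?_, mem_univ _⟩
    simp only [geoF]
    rw [min_eq_right h2.2, max_eq_right h2.1]
  exact ODE_solution_unique_of_mem_Ioo (v := fun _ => geoF (fun x => g (max (-R) (min R x))))
    (s := fun _ => univ) (fun t _ => (geoF_lip hB hC0 hC).lipschitzOnWith)
    (⟨by linarith, hN⟩ : (0:ℝ) ∈ Ioo (-N) N) (key Y hY) (key Z hZ) h0

lemma geo_global {g : ℝ → ℝ} (hg : ContDiff ℝ 1 g) (y0 : ℝ × ℝ) :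
    ∃ Y : ℝ → ℝ × ℝ, Y 0 = y0 ∧ ∀ s, HasDerivAt Y (geoF g (Y s)) s := by
  have hex := fun n : ℕ => geo_local hg y0 (N := (n:ℝ) + 1) (by positivity)
  choose Y h0 hY using hex
  have hcons : ∀ n k : ℕ, n ≤ k → ∀ s : ℝ, |s| < (n:ℝ) + 1 → Y n s = Y k s := by
    intro n k hnk s hs
    have hnk' : (n:ℝ) ≤ k := by exact_mod_cast hnk
    refine geo_uniq hg (N := (n:ℝ)+1) (R := |y0.1| + ((k:ℝ)+1)) (by positivity) (by positivity)
      (by rw [h0, h0]) ?_ ?_ (abs_lt.1 hs)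
    · intro u hu
      exact ⟨(hY n u hu).1, (hY n u hu).2.trans (by linarith)⟩
    · intro u hu
      exact hY k u ⟨by linarith [hu.1], by linarith [hu.2]⟩
  refine ⟨fun s => Y ⌊|s|⌋₊ s, by simp [h0], fun s => ?_⟩
  have hs : |s| < (⌊|s|⌋₊ : ℝ) + 1 := Nat.lt_floor_add_one _
  have hs' := abs_lt.1 hs
  refine ((hY ⌊|s|⌋₊ s hs').1).congr_of_eventuallyEq ?_
  have : ∀ᶠ u in 𝓝 s, |u| < (⌊|s|⌋₊ : ℝ) + 1 := (continuous_abs.continuousAt).eventually_lt_const hs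
  filter_upwards [this] with u hu
  refine hcons _ _ ?_ u (Nat.lt_floor_add_one _)
  have : ⌊|u|⌋₊ < ⌊|s|⌋₊ + 1 := by
    rw [Nat.floor_lt (abs_nonneg _)]; exact_mod_cast hu
  omega

lemma Shape.geo_exists {m : ℝ → ℝ} {t0 : ℝ} (S : Shape m t0) {tq ν : ℝ} (h0 : 0 ≤ ν) (h1 : ν ≤ m tq) :
    ∃ t v θ, Geo m tq ν t v θ ∧ 0 ≤ v 0 := by
  have hpos := S.pos
  have hgc : ContDiff ℝ 1 (fun x => deriv m x / m x) := by
    have hm : ContDiff ℝ 1 m := S.smooth.of_le (by simp)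
    have hd : ContDiff ℝ 1 (deriv m) := by
      have := (contDiff_succ_iff_deriv (n := 1) (f := m)).1 (S.smooth.of_le (by norm_cast))
      exact this.2.2
    exact hd.div hm fun x => (hpos x).ne'
  obtain ⟨Y, hY0, hY⟩ := geo_global hgc (tq, arcsin (ν / m tq))
  have d1 : ∀ s, HasDerivAt (fun s => (Y s).1) (cos (Y s).2) s := fun s => (hY s).fst
  have d2 : ∀ s, HasDerivAt (fun s => (Y s).2) (-(deriv m (Y s).1 / m (Y s).1 * sin (Y s).2)) s :=
    fun s => (hY s).snd
  have cl : ∀ s, m (Y s).1 * sin (Y s).2 = ν := by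
    have hd : ∀ s, HasDerivAt (fun s => m (Y s).1 * sin (Y s).2) 0 s := by
      intro s
      have a := ((S.hd (Y s).1).comp s (d1 s)).mul ((d2 s).sin)
      refine a.congr_deriv ?_
      have := hpos (Y s).1
      simp only [Function.comp]
      field_simp
      ring
    have hc := is_const_of_deriv_eq_zero (fun s => (hd s).differentiableAt) (fun s => (hd s).deriv)
    intro s
    rw [hc s 0, hY0]
    simp only
    have := hpos tq
    rw [sin_arcsin (by have : 0 ≤ ν / m tq := by positivity
                       linarith) ((div_le_one this).2 h1)]
    field_simp
  have hcont : Continuous fun s => ν / m (Y s).1 ^ 2 := by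
    have c1 : Continuous fun s => (Y s).1 := continuous_iff_continuousAt.2 fun s => (d1 s).continuousAt
    exact continuous_const.div ((S.cont.comp c1).pow 2) fun s => (pow_pos (hpos _) 2).ne'
  have hsin : ∀ s, sin (Y s).2 = ν / m (Y s).1 := by
    intro s
    have := hpos (Y s).1
    rw [eq_div_iff this.ne', ← cl s]; ring
  refine ⟨fun s => (Y s).1, fun s => cos (Y s).2, fun s => ∫ u in (0:ℝ)..s, ν / m (Y u).1 ^ 2,
    ⟨by simp [hY0], by simp, d1, ?_, ?_, ?_⟩, ?_⟩
  · intro s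
    refine (d2 s).cos.congr_deriv ?_
    have := hpos (Y s).1
    rw [hsin]; field_simp
  · intro s
    exact intervalIntegral.integral_hasDerivAt_right (hcont.intervalIntegrable _ _)
      (hcont.stronglyMeasurableAtFilter _ _) hcont.continuousAt
  · intro s
    have := sin_sq_add_cos_sq (Y s).2
    rw [hsin, div_pow] at this
    linarith
  · simp only [hY0]
    exact cos_arcsin_nonneg _

end

section
open Real Set MeasureTheory Filter Topology
lemma eq_of_deriv_zero {f : ℝ → ℝ} {p q : ℝ} (hpq : p ≤ q) (hc : ContinuousOn f (Icc p q))
    (hd : ∀ x ∈ Ioo p q, HasDerivAt f 0 x) : f q = f p := by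
  rcases hpq.eq_or_lt with rfl | h
  · rfl
  · obtain ⟨c, -, hcc⟩ := exists_hasDerivAt_eq_slope f (fun _ => 0) h hc hd
    have : q - p ≠ 0 := by linarith
    field_simp at hcc
    linarith

namespace Geo
variable {m : ℝ → ℝ} {t0 tq ν : ℝ} {t v θ : ℝ → ℝ}

lemma vsq (S : Shape m t0) (G : Geo m tq ν t v θ) (s : ℝ) :
    v s ^ 2 * m (t s) ^ 2 = m (t s) ^ 2 - ν ^ 2 := by
  have := S.pos (t s)
  rw [G.en s]; field_simp

lemma le (S : Shape m t0) (G : Geo m tq ν t v θ) (s : ℝ) : ν ≤ m (t s) := by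
  have := G.vsq S s
  exact (le_abs_self ν).trans (abs_le_of_sq_le_sq (by nlinarith [sq_nonneg (v s * m (t s))]) (S.pos _).le)

lemma v_ne (S : Shape m t0) (G : Geo m tq ν t v θ) (h0 : 0 ≤ ν) {s : ℝ} (h : ν < m (t s)) : v s ≠ 0 := by
  intro hv
  have := G.vsq S s
  rw [hv] at this
  nlinarith

lemma v_zero (S : Shape m t0) (G : Geo m tq ν t v θ) (h0 : 0 ≤ ν) {s : ℝ} (h : v s = 0) : m (t s) = ν := by
  by_contra hne
  exact G.v_ne S h0 (lt_of_le_of_ne (G.le S s) (Ne.symm hne)) h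

lemma lt_m (S : Shape m t0) (G : Geo m tq ν t v θ) {s : ℝ} (h : v s ≠ 0) : ν < m (t s) := by
  refine lt_of_le_of_ne (G.le S s) fun e => h ?_
  have h1 := G.vsq S s
  rw [← e] at h1
  have h2 : v s * ν = 0 := by nlinarith
  have := S.pos (t s)
  rcases mul_eq_zero.1 h2 with h | h
  · exact h
  · linarith

lemma fF_eq (S : Shape m t0) (G : Geo m tq ν t v θ) (s : ℝ) : fF m ν (t s) = |v s| := by
  have hp := S.pos (t s)
  rw [fF, ← G.vsq S s, ← mul_pow, Real.sqrt_sq_eq_abs, abs_mul, abs_of_pos hp]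
  field_simp

lemma rho_eq (S : Shape m t0) (G : Geo m tq ν t v θ) {s : ℝ} (h : 0 < v s) :
    rho m ν (t s) * v s = ν / m (t s) ^ 2 := by
  have hp := S.pos (t s)
  rw [rho, ← G.vsq S s, ← mul_pow, Real.sqrt_sq_eq_abs, abs_mul, abs_of_pos hp, abs_of_pos h]
  field_simp

/-- turning bound -/
lemma bound (S : Shape m t0) (G : Geo m tq ν t v θ) {b : ℝ} (hb : b ∈ Ioo 0 t0) (hν : ν = m b)
    (hq : |tq| ≤ b) (s : ℝ) : |t s| ≤ b := by
  by_contra hs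
  push Not at hs
  have hlt : b < Min.min |t s| t0 := lt_min hs hb.2
  obtain ⟨r, hr⟩ := mem_range_of_exists_le_of_exists_ge (f := fun s => |t s|) (c := Min.min |t s| t0)
    (G.cont.1.abs) ⟨0, by simp only [G.z]; linarith⟩ ⟨s, min_le_left _ _⟩
  have hr : |t r| = Min.min |t s| t0 := hr
  have h1 : m (t r) < m b := S.lt_of (by rw [hr, abs_of_pos hb.1]; exact hlt) (by rw [hr]; exact min_le_right _ _)
  have := G.le S r
  linarith

lemma θ_mono (S : Shape m t0) (G : Geo m tq ν t v θ) (h0 : 0 ≤ ν) : Monotone θ :=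
  monotone_of_deriv_nonneg (fun s => (G.dθ s).differentiableAt) fun s => by
    rw [(G.dθ s).deriv]; exact div_nonneg h0 (by positivity)

lemma θ_strict (S : Shape m t0) (G : Geo m tq ν t v θ) (h0 : 0 < ν) : StrictMono θ :=
  strictMono_of_deriv_pos fun s => by
    rw [(G.dθ s).deriv]; have := S.pos (t s); positivity

lemma dE (G : Geo m tq ν t v θ) (s : ℝ) : HasDerivAt (fun s => s - ν * θ s) (v s ^ 2) s := by
  refine ((hasDerivAt_id s).sub ((G.dθ s).const_mul ν)).congr_deriv ?_
  rw [G.en s]; ring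

lemma E_mono (G : Geo m tq ν t v θ) : Monotone (fun s => s - ν * θ s) :=
  monotone_of_deriv_nonneg (fun s => (G.dE s).differentiableAt) fun s => by
    rw [(G.dE s).deriv]; positivity

lemma t_strict (G : Geo m tq ν t v θ) {p q : ℝ} (hv : ∀ s ∈ Ioo p q, 0 < v s) :
    StrictMonoOn t (Icc p q) := by
  refine strictMonoOn_of_deriv_pos (convex_Icc p q) G.cont.1.continuousOn ?_
  intro x hx
  rw [interior_Icc] at hx
  rw [(G.dt x).deriv]; exact hv x hx

lemma FF_up (S : Shape m t0) (G : Geo m tq ν t v θ) {p q : ℝ} (hpq : p ≤ q) (hv : ∀ s ∈ Ioo p q, 0 < v s) :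
    FF m ν (t q) - FF m ν (t p) = (q - ν * θ q) - (p - ν * θ p) := by
  have hd : ∀ s, HasDerivAt (fun s => FF m ν (t s) - (s - ν * θ s)) (fF m ν (t s) * v s - v s ^ 2) s :=
    fun s => ((S.FF_deriv ν (t s)).comp s (G.dt s)).sub (G.dE s)
  have := eq_of_deriv_zero hpq (fun s _ => (hd s).continuousAt.continuousWithinAt) fun s hs =>
    (hd s).congr_deriv (by rw [G.fF_eq S, abs_of_pos (hv s hs)]; ring)
  linarith

lemma Th_up (S : Shape m t0) (G : Geo m tq ν t v θ) (h0 : 0 ≤ ν) {p q : ℝ} (hpq : p ≤ q) (hv : ∀ s ∈ Ioo p q, 0 < v s)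
    (hc : ContinuousOn (fun s => Th m ν (t s)) (Icc p q))
    (hi : ∀ s ∈ Ioo p q, IntervalIntegrable (rho m ν) volume 0 (t s)) :
    Th m ν (t q) - Th m ν (t p) = θ q - θ p := by
  have := eq_of_deriv_zero hpq (hc.sub G.cont.2.2.continuousOn) fun s hs => by
    have h1 := (S.Th_deriv_of h0 (G.lt_m S (hv s hs).ne') (hi s hs)).comp s (G.dt s)
    refine (h1.sub (G.dθ s)).congr_deriv ?_
    rw [G.rho_eq S (hv s hs)]; ring
  simp only [Pi.sub_apply] at this
  linarith

lemma Th_upT (S : Shape m t0) (G : Geo m tq ν t v θ) (h0 : 0 ≤ ν) {T : ℝ} (hT : T ∈ Ioo 0 t0) (hνT : ν ≤ m T)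
    {p q : ℝ} (hpq : p ≤ q) (hv : ∀ s ∈ Ioo p q, 0 < v s) (hb : ∀ s ∈ Icc p q, |t s| ≤ T) :
    Th m ν (t q) - Th m ν (t p) = θ q - θ p := by
  refine G.Th_up S h0 hpq hv ?_ ?_
  · exact (S.Th_contOn hT h0 hνT).comp G.cont.1.continuousOn fun s hs => abs_le.1 (hb s hs)
  · intro s hs
    exact S.rho_int hT h0 hνT (by rw [abs_zero]; exact hT.1.le) (hb s (Ioo_subset_Icc_self hs))

lemma Th_upL (S : Shape m t0) (G : Geo m tq ν t v θ) (h0 : 0 ≤ ν) 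
    {p q : ℝ} (hpq : p ≤ q) (hv : ∀ s ∈ Ioo p q, 0 < v s) (hl : ν < m t0) :
    Th m ν (t q) - Th m ν (t p) = θ q - θ p := by
  refine G.Th_up S h0 hpq hv ?_ fun s _ => S.rho_int_vlow h0 hl
  intro s hs
  exact ((S.Th_deriv_of h0 (hl.trans_le (S.min _)) (S.rho_int_vlow h0 hl)).continuousAt.comp
    (f := t) G.cont.1.continuousAt).continuousWithinAt

lemma θ_growth (S : Shape m t0) (G : Geo m tq ν t v θ) (h0 : 0 ≤ ν) {p q : ℝ} (hpq : p ≤ q)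
    (hb : ∀ s ∈ Icc p q, |t s| ≤ t0) : ν / m 0 ^ 2 * (q - p) ≤ θ q - θ p := by
  refine (convex_Icc p q).mul_sub_le_image_sub_of_le_deriv G.cont.2.2.continuousOn
    (fun s _ => (G.dθ s).differentiableAt.differentiableWithinAt) ?_ p ⟨le_rfl, hpq⟩ q ⟨hpq, le_rfl⟩ hpq
  intro s hs
  rw [interior_Icc] at hs
  rw [(G.dθ s).deriv]
  have h1 := S.le_max (hb s (Ioo_subset_Icc_self hs))
  have h2 := S.pos (t s)
  gcongr

lemma reach (S : Shape m t0) (G : Geo m tq ν t v θ) (h0 : 0 < ν) {T : ℝ} (hT : T ∈ Ioo 0 t0) (hνT : ν ≤ m T)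
    {s0 t1 : ℝ} (ha : -T ≤ t s0) (hb : t s0 < t1) (ht1 : t1 ≤ T) (hv0 : 0 ≤ v s0) :
    ∃ s1, s0 < s1 ∧ t s1 = t1 ∧ (∀ s ∈ Ioo s0 s1, 0 < v s) ∧ ∀ s ∈ Icc s0 s1, |t s| ≤ T := by
  have hct := G.cont.1
  have hcv := G.cont.2.1
  -- near the start
  have hev : ∀ᶠ s in 𝓝[>] s0, 0 < v s := by
    rcases hv0.eq_or_lt with h | h
    · have hm0 := G.v_zero S h0.le h.symm
      have habs : |t s0| ≤ T := abs_le.2 ⟨ha, by linarith⟩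
      have hte : t s0 = -T := by
        by_contra hne
        have : |t s0| < T := abs_lt.2 ⟨lt_of_le_of_ne ha (Ne.symm hne), by linarith⟩
        have := S.lt_of (a := t s0) (b := T) (by rwa [abs_of_pos hT.1]) (by rw [abs_of_pos hT.1]; exact hT.2.le)
        linarith
      have hd : 0 < ν ^ 2 * deriv m (t s0) / m (t s0) ^ 3 := by
        rw [hte, S.odd_d]
        have := S.dneg T hT
        have := S.pos (-T)
        have : 0 < -deriv m T := by linarith
        positivity
      have h2 := (G.dv s0).hasDerivWithinAt (s := Ioi s0)
      have h3 := (hasDerivWithinAt_iff_tendsto_slope' (by simp)).1 h2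
      filter_upwards [h3.eventually (lt_mem_nhds hd), self_mem_nhdsWithin] with s hs hs0
      rw [slope_def_field, ← h, sub_zero] at hs
      have : 0 < s - s0 := sub_pos.2 hs0
      exact (div_pos_iff_of_pos_right this).1 hs
    · exact nhdsWithin_le_nhds (hcv.continuousAt.eventually_const_lt h)
  have hev2 : ∀ᶠ s in 𝓝[>] s0, t s < t1 := nhdsWithin_le_nhds (hct.continuousAt.eventually_lt_const hb)
  obtain ⟨u, hu, hsub⟩ := (mem_nhdsGT_iff_exists_Ioo_subset).1 (hev.and hev2)
  have hu : s0 < u := hu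
  set A := {s : ℝ | (s0 + u) / 2 ≤ s ∧ (t1 ≤ t s ∨ v s ≤ 0)} with hA
  have hAc : IsClosed A := by
    apply (isClosed_le continuous_const continuous_id).inter
    exact (isClosed_le continuous_const hct).union (isClosed_le hcv continuous_const)
  have hAb : BddBelow A := ⟨(s0+u)/2, fun s hs => hs.1⟩
  have hnot : ∀ s, s0 < s → s ∉ A → t s < t1 ∧ 0 < v s := by
    intro s hs hsA
    by_cases h : (s0+u)/2 ≤ s
    · simp only [hA, mem_ofPred_eq, h, true_and, not_or, not_le] at hsA
      exact hsA
    · have := hsub ⟨hs, by linarith⟩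
      exact ⟨this.2, this.1⟩
  have hbd : ∀ s1, s0 ≤ s1 → (∀ s ∈ Ioo s0 s1, t s < t1 ∧ 0 < v s) → ∀ s ∈ Icc s0 s1, -T ≤ t s ∧ t s ≤ t1 := by
    intro s1 h01 hh s hs
    have hmono := G.t_strict (fun s hs => (hh s hs).2)
    refine ⟨ha.trans (hmono.monotoneOn ⟨le_rfl, h01⟩ hs hs.1), ?_⟩
    rcases hs.1.eq_or_lt with h | h
    · rw [← h]; exact hb.le
    have hcl : Icc s0 s ⊆ {s | t s ≤ t1} := by
      rw [← closure_Ioo h.ne]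
      exact closure_minimal (fun x hx => (hh x ⟨hx.1, hx.2.trans_le hs.2⟩).1.le) (isClosed_le hct continuous_const)
    exact hcl ⟨h.le, le_rfl⟩
  by_cases hne : A.Nonempty
  · set s1 := sInf A
    have hs1 : s1 ∈ A := hAc.csInf_mem hne hAb
    have h01 : s0 < s1 := by have := hs1.1; linarith
    have hh : ∀ s ∈ Ioo s0 s1, t s < t1 ∧ 0 < v s := fun s hs =>
      hnot s hs.1 (notMem_of_lt_csInf hs.2 hAb)
    have hB := hbd s1 h01.le hh
    have hmono := G.t_strict (fun s hs => (hh s hs).2)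
    refine ⟨s1, h01, ?_, fun s hs => (hh s hs).2, fun s hs => abs_le.2 ⟨(hB s hs).1, (hB s hs).2.trans ht1⟩⟩
    have h1 := hB s1 ⟨h01.le, le_rfl⟩
    by_contra hne1
    have hlt : t s1 < t1 := lt_of_le_of_ne h1.2 hne1
    have hgt : -T < t s1 := ha.trans_lt (hmono ⟨le_rfl, h01.le⟩ ⟨h01.le, le_rfl⟩ h01)
    have hm := S.lt_of (a := t s1) (b := T) (by rw [abs_of_pos hT.1]; exact abs_lt.2 ⟨hgt, by linarith⟩)
      (by rw [abs_of_pos hT.1]; exact hT.2.le)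
    have hvne := G.v_ne S h0.le (hνT.trans_lt hm)
    have hvge : 0 ≤ v s1 := by
      have hcl : Icc s0 s1 ⊆ {s | 0 ≤ v s} := by
        rw [← closure_Ioo h01.ne]
        exact closure_minimal (fun x hx => (hh x hx).2.le) (isClosed_le continuous_const hcv)
      exact hcl ⟨h01.le, le_rfl⟩
    rcases hs1.2 with h | h
    · linarith
    · exact hvne (le_antisymm h hvge)
  · exfalso
    have hh : ∀ s, s0 < s → t s < t1 ∧ 0 < v s := fun s hs => hnot s hs fun h => hne ⟨s, h⟩
    obtain ⟨s1, hs1⟩ : ∃ s1, s0 < s1 ∧ 2 * Th m ν T < ν / m 0 ^ 2 * (s1 - s0) := by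
      have hk : 0 < ν / m 0 ^ 2 := by have := S.pos 0; positivity
      refine ⟨s0 + (2 * |Th m ν T| + 1) / (ν / m 0 ^ 2), by linarith [show 0 < (2 * |Th m ν T| + 1) / (ν / m 0 ^ 2) by positivity], ?_⟩
      rw [add_sub_cancel_left, mul_div_cancel₀ _ hk.ne']
      linarith [le_abs_self (Th m ν T)]
    have hB := hbd s1 hs1.1.le fun s hs => hh s hs.1
    have hB' : ∀ s ∈ Icc s0 s1, |t s| ≤ T := fun s hs => abs_le.2 ⟨(hB s hs).1, (hB s hs).2.trans ht1⟩
    have e1 := G.θ_growth S h0.le hs1.1.le fun s hs => (hB' s hs).trans hT.2.le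
    have e2 := G.Th_upT S h0.le hT hνT hs1.1.le (fun s hs => (hh s hs.1).2) hB'
    have a1 := abs_le.1 (S.Th_le_abs hT h0.le hνT (hB' s1 ⟨hs1.1.le, le_rfl⟩))
    have a2 := abs_le.1 (S.Th_le_abs hT h0.le hνT (hB' s0 ⟨le_rfl, hs1.1.le⟩))
    linarith [hs1.2]

lemma E_strict (S : Shape m t0) (G : Geo m tq ν t v θ) {b : ℝ} (hb : b ∈ Ioo 0 t0) (hν : ν = m b)
    (hq : |tq| ≤ b) : StrictMono (fun s => s - ν * θ s) := by
  intro p q hpq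
  refine lt_of_le_of_ne (G.E_mono hpq.le) fun he => ?_
  have h0 : 0 < ν := hν ▸ S.pos b
  have hv0 : ∀ x ∈ Ioo p q, v x = 0 := by
    intro x hx
    have hev : (fun s => s - ν * θ s) =ᶠ[𝓝 x] fun _ => p - ν * θ p := by
      filter_upwards [Ioo_mem_nhds hx.1 hx.2] with y hy
      exact le_antisymm ((G.E_mono hy.2.le).trans he.symm.le) (G.E_mono hy.1.le)
    have h1 := (G.dE x).unique ((hasDerivAt_const x (p - ν * θ p)).congr_of_eventuallyEq hev)
    exact pow_eq_zero_iff (two_ne_zero) |>.1 h1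
  set x := (p+q)/2
  have hx : x ∈ Ioo p q := ⟨by simp only [x]; linarith, by simp only [x]; linarith⟩
  have hev : v =ᶠ[𝓝 x] fun _ => 0 := by
    filter_upwards [Ioo_mem_nhds hx.1 hx.2] with y hy using hv0 y hy
  have h1 := (G.dv x).unique ((hasDerivAt_const x (0:ℝ)).congr_of_eventuallyEq hev)
  have hm := G.v_zero S h0.le (hv0 x hx)
  have hB := G.bound S hb hν hq x
  have habs : |t x| = b := by
    by_contra hne
    have := S.lt_of (a := t x) (b := b) (by rw [abs_of_pos hb.1]; exact lt_of_le_of_ne hB hne)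
      (by rw [abs_of_pos hb.1]; exact hb.2.le)
    linarith
  have hdn := S.dneg b hb
  have hp := S.pos (t x)
  have hd : deriv m (t x) ≠ 0 := by
    rcases abs_cases (t x) with h | h
    · rw [show t x = b by linarith]; exact hdn.ne
    · rw [show t x = -b by linarith, S.odd_d]; linarith
  have : ν ^ 2 * deriv m (t x) / m (t x) ^ 3 ≠ 0 := by positivity
  exact this h1

end Geo
end

section
open Real Set MeasureTheory Filter Topology
lemma Shape.cand_reflect {m : ℝ → ℝ} {t0 : ℝ} (S : Shape m t0) {tq t θ ν s : ℝ}
    (h : Cand m t0 (-tq) (-t) θ ν s) : Cand m t0 tq t θ ν s := by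
  have e1 : |FF m ν (-t) - FF m ν (-tq)| = |FF m ν t - FF m ν tq| := by
    rw [S.FF_neg, S.FF_neg, ← abs_neg]; congr 1; ring
  have e2 : |Th m ν (-t) - Th m ν (-tq)| = |Th m ν t - Th m ν tq| := by
    rw [S.Th_neg, S.Th_neg, ← abs_neg]; congr 1; ring
  have e3 : |FF m ν (-t) + FF m ν (-tq)| = |FF m ν t + FF m ν tq| := by
    rw [S.FF_neg, S.FF_neg, ← abs_neg]; congr 1; ring
  have e4 : |Th m ν (-t) + Th m ν (-tq)| = |Th m ν t + Th m ν tq| := by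
    rw [S.Th_neg, S.Th_neg, ← abs_neg]; congr 1; ring
  unfold Cand at h ⊢
  rw [e1, e2, e3, e4] at h
  simpa only [abs_neg] using h

namespace Geo
variable {m : ℝ → ℝ} {t0 tq ν : ℝ} {t v θ : ℝ → ℝ}

lemma osc (S : Shape m t0) (G : Geo m tq ν t v θ) {b : ℝ} (hb : b ∈ Ioo 0 t0) (hν : ν = m b)
    (hq : |tq| ≤ b) (hv0 : 0 ≤ v 0) (hqb : tq < b) :
    ∃ s1 c, 0 < s1 ∧ s1 ≤ c ∧ t s1 = b ∧ t c = -tq ∧ (∀ s ∈ Icc 0 c, Cand m t0 tq (t s) (θ s) ν s) ∧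
      (∀ s ∈ Icc s1 c, θ s = phi m ν - |Th m ν (t s) + Th m ν tq|) ∧ θ c = phi m ν ∧
      ∀ s, c < s → phi m ν ≤ θ s ∧ ν * θ s + 2 * FF m ν b < s := by
  have h0 : 0 < ν := hν ▸ S.pos b
  have hνb : ν ≤ m b := hν.le
  have hB := G.bound S hb hν hq
  have hqq := abs_le.1 hq
  obtain ⟨s1, h01, hts1, hvp, -⟩ := G.reach S h0 hb hνb (s0 := 0) (t1 := b) (by rw [G.z]; exact hqq.1)
    (by rw [G.z]; exact hqb) le_rfl hv0
  have G' := G.reflect S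
  have hv1 : v s1 = 0 := by
    by_contra hne
    have := G.lt_m S hne
    rw [hts1] at this; linarith
  obtain ⟨s2, h12, hts2, hvn, -⟩ := G'.reach S h0 hb hνb (s0 := s1) (t1 := b) (by rw [hts1])
    (by rw [hts1]; linarith [hb.1]) le_rfl (by rw [hv1, neg_zero])
  have hmono1 := (G.t_strict hvp).monotoneOn
  have hmono2 := (G'.t_strict hvn).monotoneOn
  obtain ⟨c, hc, htc⟩ := intermediate_value_Icc' h12.le G.cont.1.continuousOn
    (show -tq ∈ Icc (t s2) (t s1) by rw [hts1]; exact ⟨by linarith, by linarith⟩)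
  have hphi : phi m ν = 2 * Th m ν b := by rw [hν]; exact S.phi_eq hb
  have hthq := abs_le.1 (S.Th_le_abs hb h0.le hνb hq)
  have A1 : ∀ s ∈ Icc 0 s1, θ s = Th m ν (t s) - Th m ν tq ∧ s = ν * θ s + (FF m ν (t s) - FF m ν tq)
      ∧ 0 ≤ Th m ν (t s) - Th m ν tq ∧ 0 ≤ FF m ν (t s) - FF m ν tq := by
    intro s hs
    have hv' : ∀ r ∈ Ioo 0 s, 0 < v r := fun r hr => hvp r ⟨hr.1, hr.2.trans_le hs.2⟩
    have e1 := G.Th_upT S h0.le hb hνb hs.1 hv' fun r _ => hB r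
    have e2 := G.FF_up S hs.1 hv'
    rw [G.z, G.zθ] at e1 e2
    have hle : tq ≤ t s := by
      have := hmono1 ⟨le_rfl, h01.le⟩ hs hs.1
      rwa [G.z] at this
    exact ⟨by linarith, by linarith, by linarith [S.Th_mono hb h0.le hνb hq (hB s) hle],
      by linarith [S.FF_mono ν hle]⟩
  have A2 : ∀ s ∈ Icc s1 c, θ s = phi m ν - (Th m ν (t s) + Th m ν tq) ∧
      s = ν * θ s + (2 * FF m ν b - (FF m ν (t s) + FF m ν tq)) ∧
      0 ≤ Th m ν (t s) + Th m ν tq ∧ 0 ≤ FF m ν (t s) + FF m ν tq := by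
    intro s hs
    have hv' : ∀ r ∈ Ioo s1 s, 0 < -v r := fun r hr => hvn r ⟨hr.1, hr.2.trans_le (hs.2.trans hc.2)⟩
    have e1 := G'.Th_upT S h0.le hb hνb hs.1 hv' fun r _ => by rw [abs_neg]; exact hB r
    have e2 := G'.FF_up S hs.1 hv'
    obtain ⟨f1, f2, -⟩ := A1 s1 ⟨h01.le, le_rfl⟩
    simp only [S.Th_neg, S.FF_neg, hts1] at e1 e2 f1 f2
    have hle : -tq ≤ t s := by
      have := hmono2 ⟨hs.1, hs.2.trans hc.2⟩ hc hs.2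
      simp only [htc] at this
      linarith
    have g1 := S.Th_mono hb h0.le hνb (by rwa [abs_neg]) (hB s) hle
    have g2 := S.FF_mono ν hle
    rw [S.Th_neg] at g1
    rw [S.FF_neg] at g2
    refine ⟨by rw [hphi]; linarith, by linarith, by linarith, by linarith⟩
  have hcc : c ∈ Icc s1 c := ⟨hc.1, le_rfl⟩
  have hθc : θ c = phi m ν := by
    have := (A2 c hcc).1
    rw [htc, S.Th_neg] at this; linarith
  have hEc : c = ν * θ c + 2 * FF m ν b := by
    have := (A2 c hcc).2.1
    rw [htc, S.FF_neg] at this; linarith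
  refine ⟨s1, c, h01, hc.1, hts1, htc, ?_, ?_, hθc, ?_⟩
  · intro s hs
    rcases le_total s s1 with h | h
    · obtain ⟨a1, a2, a3, a4⟩ := A1 s ⟨hs.1, h⟩
      refine Or.inr ⟨b, hb, hB s, hq, hν, Or.inl ⟨?_, ?_⟩⟩
      · rw [abs_of_nonneg a3]; exact a1
      · rw [abs_of_nonneg a4]; exact a2
    · obtain ⟨a1, a2, a3, a4⟩ := A2 s ⟨h, hs.2⟩
      refine Or.inr ⟨b, hb, hB s, hq, hν, Or.inr ⟨?_, ?_⟩⟩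
      · rw [abs_of_nonneg a3]; exact a1
      · rw [abs_of_nonneg a4]; exact a2
  · intro s hs
    obtain ⟨a1, a2, a3, a4⟩ := A2 s hs
    rw [abs_of_nonneg a3]; exact a1
  · intro s hs
    refine ⟨hθc ▸ G.θ_mono S h0.le hs.le, ?_⟩
    have := G.E_strict S hb hν hq hs
    simp only at this
    linarith

lemma osc' (S : Shape m t0) (G : Geo m tq ν t v θ) {b : ℝ} (hb : b ∈ Ioo 0 t0) (hν : ν = m b)
    (hq : |tq| ≤ b) :
    ∃ c, 0 < c ∧ t c = -tq ∧ (∀ s ∈ Icc 0 c, Cand m t0 tq (t s) (θ s) ν s) ∧ θ c = phi m ν ∧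
      ∀ s, c < s → phi m ν ≤ θ s ∧ ν * θ s + 2 * FF m ν b < s := by
  have h0 : 0 < ν := hν ▸ S.pos b
  have key : (0 ≤ v 0 ∧ tq < b) ∨ (0 ≤ -v 0 ∧ -tq < b) := by
    have hqq := abs_le.1 hq
    rcases lt_trichotomy (v 0) 0 with h | h | h
    · right
      refine ⟨by linarith, lt_of_le_of_ne (by linarith) fun e => ?_⟩
      have := G.lt_m S h.ne
      rw [G.z, ← S.even, e] at this; linarith
    · rcases lt_or_ge tq b with hlt | hge
      · exact Or.inl ⟨h.ge, hlt⟩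
      · exact Or.inr ⟨by rw [h]; simp, by linarith [hb.1]⟩
    · left
      refine ⟨h.le, lt_of_le_of_ne (by linarith) fun e => ?_⟩
      have := G.lt_m S h.ne'
      rw [G.z, e] at this; linarith
  rcases key with ⟨h1, h2⟩ | ⟨h1, h2⟩
  · obtain ⟨s1, c, a1, a2, a3, a4, a5, a6, a7, a8⟩ := G.osc S hb hν hq h1 h2
    exact ⟨c, by linarith, a4, a5, a7, a8⟩
  · obtain ⟨s1, c, a1, a2, a3, a4, a5, a6, a7, a8⟩ := (G.reflect S).osc S hb hν (by rwa [abs_neg]) h1 h2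
    exact ⟨c, by linarith, by linarith, fun s hs => S.cand_reflect (a5 s hs), a7, a8⟩

/-- `v` keeps its sign while nonzero -/
lemma v_sign (G : Geo m tq ν t v θ) {r : ℝ} (h : 0 < v 0) (hne : ∀ s ∈ Icc 0 r, v s ≠ 0) :
    ∀ s ∈ Icc 0 r, 0 < v s := by
  intro s hs
  by_contra hs'
  push Not at hs'
  obtain ⟨x, hx, hx0⟩ := intermediate_value_Icc' hs.1 (G.cont.2.1.continuousOn) (show (0:ℝ) ∈ Icc (v s) (v 0) from ⟨hs', h.le⟩)
  exact hne x ⟨hx.1, hx.2.trans hs.2⟩ hx0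

lemma low_pos (S : Shape m t0) (G : Geo m tq ν t v θ) (h0 : 0 ≤ ν) (hl : ν ≤ m t0) (hq : |tq| < t0)
    (hv : 0 < v 0) : ∀ s, 0 ≤ s → 0 < v s := by
  rcases hl.eq_or_lt with he | hlt
  · -- the asymptotic case
    have hin : ∀ s, 0 ≤ s → |t s| < t0 := by
      by_contra hcon
      push Not at hcon
      obtain ⟨r, hr0, hr⟩ := hcon
      set A := {s : ℝ | 0 ≤ s ∧ t0 ≤ |t s|} with hA
      have hAc : IsClosed A :=
        (isClosed_le continuous_const continuous_id).inter (isClosed_le continuous_const G.cont.1.abs)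
      have hAb : BddBelow A := ⟨0, fun s hs => hs.1⟩
      have hmem : sInf A ∈ A := hAc.csInf_mem ⟨r, hr0, hr⟩ hAb
      set c := sInf A
      have hc0 : 0 < c := lt_of_le_of_ne hmem.1 fun e => by
        have := hmem.2; rw [← e, G.z] at this; linarith
      have hlt : ∀ s, 0 ≤ s → s < c → |t s| < t0 := by
        intro s hs hsc
        by_contra hcc
        exact notMem_of_lt_csInf hsc hAb ⟨hs, not_lt.1 hcc⟩
      have hvp : ∀ s, 0 ≤ s → s < c → 0 < v s := by
        intro s hs hsc
        refine G.v_sign (r := s) hv (fun x hx => G.v_ne S h0 ?_) s ⟨hs, le_rfl⟩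
        rw [he]; exact S.min_lt (hlt x hx.1 (hx.2.trans_lt hsc))
      have hmono := G.t_strict (p := 0) (q := c) fun s hs => hvp s hs.1.le hs.2
      have htc : t0 ≤ t c := by
        have h1 : tq < t c := by have := hmono ⟨le_rfl, hc0.le⟩ ⟨hc0.le, le_rfl⟩ hc0; rwa [G.z] at this
        have h2 := hmem.2
        have h3 := abs_lt.1 hq
        rcases abs_cases (t c) with h | h <;> linarith
      obtain ⟨T, hT, hTq, hN⟩ := S.Th_div (θ c + Th m ν tq + 1) |tq| hq
      obtain ⟨s, hs, hts⟩ := intermediate_value_Icc hc0.le G.cont.1.continuousOn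
        (show T ∈ Icc (t 0) (t c) from ⟨by rw [G.z]; exact (le_abs_self _).trans hTq, by linarith [hT.2]⟩)
      have hsc : s < c := lt_of_le_of_ne hs.2 fun e => by rw [e] at hts; linarith [hT.2]
      have e := G.Th_up S h0 (p := 0) (q := s) hs.1 (fun x hx => hvp x hx.1.le (hx.2.trans hsc)) ?_ ?_
      · rw [hts, G.z, G.zθ] at e
        have := G.θ_mono S h0 hs.2
        rw [← he] at hN
        linarith
      · intro x hx
        have hx' := hlt x hx.1 (hx.2.trans_lt hsc)
        exact ((S.Th_deriv_of h0 (by rw [he]; exact S.min_lt hx') (S.rho_int_low h0 (by rw [abs_zero]; exact S.t0pos) hx' hl)).continuousAt.comp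
          (f := t) G.cont.1.continuousAt).continuousWithinAt
      · intro x hx
        exact S.rho_int_low h0 (by rw [abs_zero]; exact S.t0pos) (hlt x hx.1.le (hx.2.trans hsc)) hl
    intro s hs
    refine G.v_sign (r := s) hv (fun x hx => G.v_ne S h0 ?_) s ⟨hs, le_rfl⟩
    rw [he]; exact S.min_lt (hin x hx.1)
  · intro s hs
    exact G.v_sign (r := s) hv (fun x _ => G.v_ne S h0 (hlt.trans_le (S.min _))) s ⟨hs, le_rfl⟩

lemma low_cand_up (S : Shape m t0) (G : Geo m tq ν t v θ) (h0 : 0 ≤ ν) (hl : ν ≤ m t0) (hq : |tq| < t0)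
    (hv : 0 < v 0) (s : ℝ) (hs : 0 ≤ s) : Cand m t0 tq (t s) (θ s) ν s := by
  have hvp := G.low_pos S h0 hl hq hv
  have hv' : ∀ r ∈ Ioo 0 s, 0 < v r := fun r hr => hvp r hr.1.le
  have e := G.FF_up S hs hv'
  have hle : t 0 ≤ t s := (G.t_strict hv').monotoneOn ⟨le_rfl, hs⟩ ⟨hs, le_rfl⟩ hs
  rw [G.z] at hle
  have := S.FF_mono ν hle
  rw [G.z, G.zθ] at e
  refine Or.inl ⟨h0, hl, ?_⟩
  rw [abs_of_nonneg (by linarith)]; linarith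

lemma low_cand (S : Shape m t0) (G : Geo m tq ν t v θ) (h0 : 0 ≤ ν) (hl : ν ≤ m t0) (hq : |tq| < t0)
    (s : ℝ) (hs : 0 ≤ s) : Cand m t0 tq (t s) (θ s) ν s := by
  have hne : v 0 ≠ 0 := G.v_ne S h0 (by rw [G.z]; exact hl.trans_lt (S.min_lt hq))
  rcases lt_or_gt_of_ne hne with h | h
  · exact S.cand_reflect ((G.reflect S).low_cand_up S h0 hl (by rwa [abs_neg]) (by simpa using h) s hs)
  · exact G.low_cand_up S h0 hl hq h s hs

end Geo

end

section
open Real Set MeasureTheory Filter Topology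
/-- a geodesic from `tq` hitting `(x, y)` in a candidate way -/
def Hit (m : ℝ → ℝ) (t0 tq x y : ℝ) : Prop :=
  ∃ ν > 0, ∃ t v θ : ℝ → ℝ, ∃ s, Geo m tq ν t v θ ∧ 0 < s ∧ t s = x ∧ θ s = y ∧ Cand m t0 tq x y ν s

lemma Th_n0 (m : ℝ → ℝ) (x : ℝ) : Th m 0 x = 0 := by simp [Th, rho]

namespace Shape
variable {m : ℝ → ℝ} {t0 : ℝ}

lemma hit_reflect (S : Shape m t0) {tq x y : ℝ} (h : Hit m t0 (-tq) (-x) y) : Hit m t0 tq x y := by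
  obtain ⟨ν, h0, t, v, θ, s, G, hs, h1, h2, h3⟩ := h
  have G' := G.reflect S
  rw [neg_neg] at G'
  exact ⟨ν, h0, _, _, _, s, G', hs, by simp [h1], h2, S.cand_reflect h3⟩

lemma hit_A1 (S : Shape m t0) {tq x y T : ℝ} (hT : T ∈ Ioo 0 t0) (hq : |tq| ≤ T) (hx : |x| ≤ T) (hlt : tq < x)
    (hy : 0 < y) (hy2 : y ≤ Th m (m T) x - Th m (m T) tq) : Hit m t0 tq x y := by
  have hmT := S.pos T
  obtain ⟨ν, hν, hνy⟩ := intermediate_value_Icc hmT.le ((S.Th_contN1 hT hx).sub (S.Th_contN1 hT hq))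
    (show y ∈ Icc _ _ from ⟨by simp only [Pi.sub_apply, Th_n0, sub_zero]; exact hy.le, hy2⟩)
  simp only [Pi.sub_apply] at hνy
  have h0 : 0 < ν := lt_of_le_of_ne hν.1 fun e => by rw [← e, Th_n0, Th_n0] at hνy; linarith
  obtain ⟨t, v, θ, G, hv⟩ := S.geo_exists (tq := tq) h0.le (hν.2.trans (S.le_of (by rwa [abs_of_pos hT.1])
    (by rw [abs_of_pos hT.1]; exact hT.2.le)))
  have hxx := abs_le.1 hx
  have hqq := abs_le.1 hq
  obtain ⟨s, hs, hts, hvp, hB⟩ := G.reach S h0 hT hν.2 (s0 := 0) (t1 := x) (by rw [G.z]; exact hqq.1)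
    (by rwa [G.z]) hxx.2 hv
  have e1 := G.Th_upT S h0.le hT hν.2 hs.le hvp hB
  have e2 := G.FF_up S hs.le hvp
  rw [G.z, G.zθ, hts] at e1 e2
  have hθ : θ s = y := by linarith
  have g1 : 0 ≤ Th m ν x - Th m ν tq := by linarith
  have g2 : 0 ≤ FF m ν x - FF m ν tq := by linarith [S.FF_mono ν hlt.le]
  refine ⟨ν, h0, t, v, θ, s, G, hs, hts, hθ, ?_⟩
  rcases le_or_gt ν (m t0) with hl | hl
  · refine Or.inl ⟨h0.le, hl, ?_⟩
    rw [abs_of_nonneg g2, ← hθ]; linarith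
  · obtain ⟨b, hb1, hb2, hb3⟩ := S.exists_eq hT.1.le hT.2.le hl.le hν.2
    have hb : b ∈ Ioo 0 t0 := ⟨by linarith [hT.1], lt_of_le_of_ne hb2 fun e => by rw [e] at hb3; linarith⟩
    refine Or.inr ⟨b, hb, hx.trans hb1, hq.trans hb1, hb3.symm, Or.inl ⟨?_, ?_⟩⟩
    · rw [abs_of_nonneg g1, hνy]
    · rw [abs_of_nonneg g2, ← hθ]; linarith

lemma hit_A2 (S : Shape m t0) {tq x y T : ℝ} (hT : T ∈ Ioo 0 t0) (hq : |tq| ≤ T) (hx : |x| ≤ T)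
    (hor : |tq| = T ∨ |x| = T) (hdir : 0 ≤ x + tq)
    (hy2 : |Th m (m T) x - Th m (m T) tq| < y) : Hit m t0 tq x y := by
  have hmT := S.pos T
  have habs : ∀ x, |x| = T → |Th m (m T) x| = Th m (m T) T := by
    intro x hx
    have hn : 0 ≤ Th m (m T) T := (abs_nonneg _).trans (S.Th_le_abs hT hmT.le le_rfl (abs_of_pos hT.1).le)
    rcases abs_cases x with h | h
    · rw [show x = T by linarith, abs_of_nonneg hn]
    · rw [show x = -T by linarith, S.Th_neg, abs_neg, abs_of_nonneg hn]
  have hsum : |Th m (m T) x - Th m (m T) tq| + |Th m (m T) x + Th m (m T) tq| = 2 * Th m (m T) T := by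
    refine le_antisymm (abs_max (S.Th_le_abs hT hmT.le le_rfl hx) (S.Th_le_abs hT hmT.le le_rfl hq)) ?_
    set a := Th m (m T) x
    set c := Th m (m T) tq
    rcases hor with h | h
    · rw [← habs _ h]
      have := abs_sub (a + c) (a - c)
      rw [show a + c - (a - c) = 2 * c by ring, abs_mul, abs_two] at this
      linarith
    · rw [← habs _ h]
      have := abs_add_le (a + c) (a - c)
      rw [show a + c + (a - c) = 2 * a by ring, abs_mul, abs_two] at this
      linarith
  obtain ⟨b1, hb1, hTb1, hN⟩ := S.phi_div (y + 2 * Th m (m T) T) T hT.2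
  have hmle : ∀ b ∈ Icc T b1, m b ∈ Icc 0 (m T) := fun b hb =>
    ⟨(S.pos b).le, S.le_of (by rw [abs_of_pos hT.1, abs_of_pos (hT.1.trans_le hb.1)]; exact hb.1)
      (by rw [abs_of_pos (hT.1.trans_le hb.1)]; linarith [hb.2, hb1.2])⟩
  have hTc : ∀ x, |x| ≤ T → ContinuousOn (fun b => Th m (m b) x) (Icc T b1) := fun x hx =>
    (S.Th_contN1 hT hx).comp S.cont.continuousOn hmle
  have hcont : ContinuousOn (fun b => phi m (m b) - |Th m (m b) x + Th m (m b) tq|) (Icc T b1) :=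
    (S.phi_cont.mono fun b hb => ⟨hT.1.trans_le hb.1, hb.2.trans_lt hb1.2⟩).sub ((hTc x hx).add (hTc tq hq)).abs
  have hTT : 0 ≤ T := hT.1.le
  have hval : ∀ x, |x| ≤ T → |Th m (m b1) x| ≤ Th m (m T) T := by
    intro x hx
    have h := hmle b1 ⟨hTb1, le_rfl⟩
    exact (S.Th_le_abs hT h.1 h.2 hx).trans (S.Th_monoN hT hTT le_rfl h.1 h.2 le_rfl)
  obtain ⟨b, hbI, hby⟩ := intermediate_value_Icc hTb1 hcont (show y ∈ Icc _ _ from ⟨by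
      simp only [S.phi_eq hT]; linarith, by
      have := abs_add_le (Th m (m b1) x) (Th m (m b1) tq)
      have := hval x hx
      have := hval tq hq
      linarith⟩)
  simp only at hby
  have hb : b ∈ Ioo 0 t0 := ⟨hT.1.trans_le hbI.1, hbI.2.trans_lt hb1.2⟩
  have hTb : T < b := lt_of_le_of_ne hbI.1 fun e => by
    rw [← e, S.phi_eq hT] at hby; linarith
  have hqb : |tq| ≤ b := hq.trans hbI.1
  obtain ⟨t, v, θ, G, hv⟩ := S.geo_exists (tq := tq) (S.pos b).le (S.le_of (by rwa [abs_of_pos hb.1])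
    (by rw [abs_of_pos hb.1]; exact hb.2.le))
  obtain ⟨s1, c, a1, a2, a3, a4, a5, a6, a7, a8⟩ := G.osc S hb rfl hqb hv
    (by linarith [le_abs_self tq])
  obtain ⟨s, hs, hts⟩ := intermediate_value_Icc' a2 G.cont.1.continuousOn
    (show x ∈ Icc (t c) (t s1) by rw [a3, a4]; exact ⟨by linarith, by linarith [le_abs_self x]⟩)
  have hθ := a6 s hs
  rw [hts, hby] at hθ
  have hC := a5 s ⟨a1.le.trans hs.1, hs.2⟩
  rw [hts, hθ] at hC
  exact ⟨m b, S.pos b, t, v, θ, s, G, by linarith [hs.1], hts, hθ, hC⟩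

lemma hit_B (S : Shape m t0) {tq x y : ℝ} (hq : |tq| < t0) (hx : t0 ≤ x) (hy : 0 < y) : Hit m t0 tq x y := by
  have hμ := S.pos t0
  obtain ⟨T, hT, hTq, hN⟩ := S.Th_div (y + Th m (m t0) tq + 1) |tq| hq
  have hc1 : ContinuousOn (fun ν => Th m ν T - Th m ν tq) (Icc 0 (m T)) :=
    (S.Th_contN1 hT (abs_of_pos hT.1).le).sub (S.Th_contN1 hT hTq)
  have hmT : m t0 < m T := S.min_lt (by rw [abs_of_pos hT.1]; exact hT.2)
  have hc2 : ContinuousAt (fun ν => Th m ν T - Th m ν tq) (m t0) := hc1.continuousAt (Icc_mem_nhds hμ hmT)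
  have hev : ∀ᶠ ν in 𝓝[<] (m t0), y < Th m ν T - Th m ν tq :=
    nhdsWithin_le_nhds (hc2.eventually_const_lt (by linarith))
  obtain ⟨n1, hn1c, hn1a, hn1b⟩ := (hev.and (Ioo_mem_nhdsLT hμ)).exists
  have hTx : Th m n1 T ≤ Th m n1 x := by
    have hi := fun a b => S.rho_int_vlow hn1a.le hn1b (x := a) (y := b)
    have e : Th m n1 x - Th m n1 T = ∫ u in T..x, rho m n1 u :=
      intervalIntegral.integral_interval_sub_left (hi _ _) (hi _ _)
    have : 0 ≤ ∫ u in T..x, rho m n1 u := intervalIntegral.integral_nonneg (by linarith [hT.2]) fun u _ =>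
      S.rho_nonneg hn1a.le u
    linarith
  obtain ⟨ν, hν, hνy⟩ := intermediate_value_Icc hn1a.le ((S.Th_contN2 hn1a.le hn1b (x := x)).sub (S.Th_contN2 hn1a.le hn1b (x := tq)))
    (show y ∈ Icc _ _ from ⟨by simp only [Pi.sub_apply, Th_n0, sub_zero]; exact hy.le, by
      simp only [Pi.sub_apply]; linarith⟩)
  simp only [Pi.sub_apply] at hνy
  have h0 : 0 < ν := lt_of_le_of_ne hν.1 fun e => by rw [← e, Th_n0, Th_n0] at hνy; linarith
  have hl : ν < m t0 := hν.2.trans_lt hn1b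
  obtain ⟨t, v, θ, G, hv⟩ := S.geo_exists (tq := tq) h0.le (hl.le.trans (S.min _))
  have hv0 : 0 < v 0 := lt_of_le_of_ne hv (Ne.symm (G.v_ne S h0.le (hl.trans_le (S.min _))))
  have hvp := G.low_pos S h0.le hl.le hq hv0
  set k := 1 - ν ^ 2 / m t0 ^ 2 with hk
  have hk0 : 0 < k := by
    rw [hk, sub_pos, div_lt_one (by positivity)]
    exact pow_lt_pow_left₀ hl h0.le two_ne_zero
  have hk1 : k ≤ 1 := by
    have : 0 ≤ ν ^ 2 / m t0 ^ 2 := by positivity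
    linarith
  have hvk : ∀ s, 0 ≤ s → k ≤ v s := by
    intro s hs
    have h1 := G.en s
    have h2 : ν ^ 2 / m (t s) ^ 2 ≤ ν ^ 2 / m t0 ^ 2 := by
      have := S.min (t s)
      gcongr
    have h3 := hvp s hs
    by_contra hcon
    push Not at hcon
    nlinarith
  have hgrow : ∀ s, 0 ≤ s → k * s ≤ t s - tq := by
    intro s hs
    have := (convex_Icc 0 s).mul_sub_le_image_sub_of_le_deriv (C := k) G.cont.1.continuousOn
      (fun s _ => (G.dt s).differentiableAt.differentiableWithinAt) (fun r hr => by
        rw [interior_Icc] at hr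
        rw [(G.dt r).deriv]; exact hvk r hr.1.le) 0 ⟨le_rfl, hs⟩ s ⟨hs, le_rfl⟩ hs
    rwa [G.z, sub_zero] at this
  have hqx : tq < x := by linarith [le_abs_self tq]
  have hr0 : 0 ≤ (x - tq) / k := div_nonneg (by linarith) hk0.le
  obtain ⟨s, hs, hts⟩ := intermediate_value_Icc hr0 G.cont.1.continuousOn
    (show x ∈ Icc (t 0) (t ((x - tq) / k)) from ⟨by rw [G.z]; exact hqx.le, by
      have := hgrow _ hr0
      rw [mul_div_cancel₀ _ hk0.ne'] at this; linarith⟩)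
  have hs0 : 0 < s := lt_of_le_of_ne hs.1 fun e => by rw [← e, G.z] at hts; linarith
  have hθ := G.Th_upL S h0.le hs.1 (fun r hr => hvp r hr.1.le) hl
  rw [G.z, G.zθ, hts, hνy] at hθ
  have hC := G.low_cand S h0.le hl.le hq s hs.1
  have hθ' : θ s = y := by linarith
  rw [hts, hθ'] at hC
  exact ⟨ν, h0, t, v, θ, s, G, hs0, hts, hθ', hC⟩

lemma hit (S : Shape m t0) {tq : ℝ} (hq0 : tq ≠ 0) (hq : |tq| < t0) (x : ℝ) {y : ℝ} (hy : 0 < y) :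
    Hit m t0 tq x y := by
  rcases lt_or_ge |x| t0 with hx | hx
  · set T := max |tq| |x| with hTd
    have hT : T ∈ Ioo 0 t0 := ⟨(abs_pos.2 hq0).trans_le (le_max_left _ _), max_lt hq hx⟩
    have hqT : |tq| ≤ T := le_max_left _ _
    have hxT : |x| ≤ T := le_max_right _ _
    rcases lt_or_ge |Th m (m T) x - Th m (m T) tq| y with h | h
    · have hor : |tq| = T ∨ |x| = T := by
        rcases max_choice |tq| |x| with h | h
        · left; rw [hTd, h]
        · right; rw [hTd, h]
      rcases le_total 0 (x + tq) with hd | hd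
      · exact S.hit_A2 hT hqT hxT hor hd h
      · refine S.hit_reflect (S.hit_A2 hT (by rwa [abs_neg]) (by rwa [abs_neg]) (by simpa using hor) (by linarith) ?_)
        rwa [S.Th_neg, S.Th_neg, ← abs_neg, show -(-Th m (m T) x - -Th m (m T) tq) = Th m (m T) x - Th m (m T) tq by ring]
    · have hmT := S.pos T
      rcases lt_trichotomy tq x with hlt | heq | hgt
      · rw [abs_of_nonneg (by linarith [S.Th_mono hT hmT.le le_rfl hqT hxT hlt.le])] at h
        exact S.hit_A1 hT hqT hxT hlt hy h
      · rw [heq] at h; simp at h; linarith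
      · rw [abs_of_nonpos (by linarith [S.Th_mono hT hmT.le le_rfl hxT hqT hgt.le])] at h
        refine S.hit_reflect (S.hit_A1 hT (by rwa [abs_neg]) (by rwa [abs_neg]) (by linarith) hy ?_)
        rw [S.Th_neg, S.Th_neg]; linarith
  · rcases abs_cases x with h | h
    · exact S.hit_B hq (by linarith) hy
    · exact S.hit_reflect (S.hit_B (by rwa [abs_neg]) (by linarith) hy)

/-- a turning level with prescribed `phi` -/
lemma exists_phi (S : Shape m t0) {a y : ℝ} (ha : a ∈ Ioo 0 t0) (hy : phi m (m a) ≤ y) :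
    ∃ b ∈ Ioo 0 t0, a ≤ b ∧ phi m (m b) = y := by
  obtain ⟨b1, hb1, hab, hN⟩ := S.phi_div y a ha.2
  obtain ⟨b, hb, hby⟩ := intermediate_value_Icc hab
    (S.phi_cont.mono fun b hb => ⟨ha.1.trans_le hb.1, hb.2.trans_lt hb1.2⟩) (show y ∈ Icc _ _ from ⟨hy, hN⟩)
  exact ⟨b, ⟨ha.1.trans_le hb.1, hb.2.trans_lt hb1.2⟩, hb.1, hby⟩

lemma phi_pos (S : Shape m t0) {b : ℝ} (hb : b ∈ Ioo 0 t0) : 0 < phi m (m b) := by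
  -- travel time: the geodesic through level b
  obtain ⟨t, v, θ, G, hv⟩ := S.geo_exists (tq := -b) (ν := m b) (S.pos b).le (by rw [S.even])
  obtain ⟨c, hc, -, -, h, -⟩ := G.osc' S hb rfl (by rw [abs_neg, abs_of_pos hb.1])
  rw [← h, ← G.zθ]
  exact G.θ_strict S (S.pos b) hc

end Shape
end

section
open Real Set MeasureTheory Filter Topology
namespace Geo
variable {m : ℝ → ℝ} {t0 tq ν ε : ℝ} {t v θ : ℝ → ℝ}

lemma base (G : Geo m tq ν t v θ) : proj (t 0, ε * θ 0) = (tq, ((0:ℝ) : Real.Angle)) := by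
  simp [proj, G.z, G.zθ]

lemma D_le (S : Shape m t0) (G : Geo m tq ν t v θ) (hε : |ε| = 1) {s : ℝ} (hs : 0 ≤ s) :
    cylDist m (tq, ((0:ℝ) : Real.Angle)) (t s, ((ε * θ s : ℝ) : Real.Angle)) ≤ s := by
  have := cyl_upper (G.geod S hε).1 hs
  rw [G.base] at this
  exact this

lemma D_eq (S : Shape m t0) (G : Geo m tq ν t v θ) (hε : |ε| = 1) (htq : tq ≠ 0) {s : ℝ} (hs : 0 ≤ s)
    (hC : Cand m t0 tq (t s) (θ s) ν s) (h0 : 0 ≤ θ s) (h1 : θ s ≤ π) :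
    cylDist m (tq, ((0:ℝ) : Real.Angle)) (t s, ((ε * θ s : ℝ) : Real.Angle)) = s := by
  have hx : |ε * θ s| = θ s := by rw [abs_mul, hε, one_mul, abs_of_nonneg h0]
  refine le_antisymm (G.D_le S hε hs) (S.cyl_lower (x := ε * θ s) (ν := ν) htq (by rwa [hx]) (by rwa [hx]))

lemma D_lt (S : Shape m t0) (G : Geo m tq ν t v θ) (hε : |ε| = 1) (hν : 0 < ν) {s : ℝ} (hs : 0 < s)
    (h1 : π < θ s) :
    cylDist m (tq, ((0:ℝ) : Real.Angle)) (t s, ((ε * θ s : ℝ) : Real.Angle)) < s := by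
  have hε0 : ε ≠ 0 := by intro h; simp [h] at hε
  have hpi := pi_pos
  have := cyl_strict S.cont S.pos (G.geod S hε).1 (G.geod S hε).2 (mul_ne_zero hε0 hν.ne') hs
    (by simp only [G.zθ, mul_zero, sub_zero, abs_mul, hε, one_mul]; exact h1.trans_le (le_abs_self _))
  rw [G.base] at this
  exact this

lemma D_lt_osc (S : Shape m t0) (G : Geo m tq ν t v θ) (hε : |ε| = 1) (htq : tq ≠ 0) {b : ℝ}
    (hb : b ∈ Ioo 0 t0) (hν : ν = m b) (hq : |tq| ≤ b) {s : ℝ} (hs : 0 < s)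
    (h1 : phi m ν ≤ θ s) (h2 : ν * θ s + 2 * FF m ν b < s) :
    cylDist m (tq, ((0:ℝ) : Real.Angle)) (t s, ((ε * θ s : ℝ) : Real.Angle)) < s := by
  subst hν
  rcases lt_or_ge π (θ s) with h | h
  · exact G.D_lt S hε (S.pos b) hs h
  have hpos : 0 < θ s := (S.phi_pos hb).trans_le h1
  obtain ⟨ν', hν', t', v', θ', s', G', hs', e1, e2, hC⟩ := S.hit htq (hq.trans_lt hb.2) (t s) hpos
  have hB := G.bound S hb rfl hq s
  have a1 := abs_le.1 (S.Th_le_abs hb (S.pos b).le le_rfl hB)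
  have a2 := abs_le.1 (S.Th_le_abs hb (S.pos b).le le_rfl hq)
  have hg := S.cand_g htq hC hb hB hq (by
    rw [S.phi_eq hb] at h1
    refine (abs_le.2 ⟨?_, ?_⟩ : _ ≤ 2 * Th m (m b) b).trans h1 <;> linarith)
  have hD := G'.D_le S hε hs'.le
  rw [e1, e2] at hD
  have := abs_nonneg (FF m (m b) (t s) + FF m (m b) tq)
  linarith

lemma main_sub (S : Shape m t0) (G : Geo m tq ν t v θ) (hε : |ε| = 1) (h0 : 0 ≤ ν) (htq : tq ≠ 0) (hq : |tq| < t0)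
    (hphi : phi m (m tq) < π) {a : ℝ} (ha : 0 < a)
    (hmin : cylDist m (tq, ((0:ℝ) : Real.Angle)) (t a, ((ε * θ a : ℝ) : Real.Angle)) = a)
    (hext : ∀ s, a < s → cylDist m (tq, ((0:ℝ) : Real.Angle)) (t s, ((ε * θ s : ℝ) : Real.Angle)) ≠ s) :
    ((ε * θ a : ℝ) : Real.Angle) = ((π : ℝ) : Real.Angle) ∨
    (t a = -tq ∧ ∃ x : ℝ, phi m (m tq) ≤ x ∧ x ≤ 2 * π - phi m (m tq) ∧
          ((ε * θ a : ℝ) : Real.Angle) = (x : Real.Angle)) := by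
  have hpi := pi_pos
  have hε' : ε = 1 ∨ ε = -1 := by
    rcases abs_cases ε with h | h
    · left; linarith
    · right; linarith
  have hθ0 : ∀ s, 0 ≤ s → 0 ≤ θ s := fun s hs => by rw [← G.zθ]; exact G.θ_mono S h0 hs
  rcases h0.eq_or_lt with hz | hν
  · exfalso
    have hconst : ∀ s, θ s = 0 := by
      intro s
      have := is_const_of_deriv_eq_zero (fun s => (G.dθ s).differentiableAt)
        (fun s => by rw [(G.dθ s).deriv, ← hz, zero_div]) s 0
      rw [this, G.zθ]
    refine hext (a+1) (by linarith) (G.D_eq S hε htq (by linarith)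
      (G.low_cand S h0 (by rw [← hz]; exact (S.pos _).le) hq _ (by linarith)) ?_ ?_)
    · rw [hconst]
    · rw [hconst]; exact hpi.le
  have hle : θ a ≤ π := by
    by_contra hcon
    exact (G.D_lt S hε hν ha (not_le.1 hcon)).ne hmin
  rcases hle.eq_or_lt with heq | hlt
  · left
    rw [heq]
    rcases hε' with h | h
    · rw [h, one_mul]
    · rw [h, neg_one_mul, Real.Angle.coe_neg, Real.Angle.neg_coe_pi]
  have hev : ∀ᶠ s in 𝓝[>] a, θ s < π := nhdsWithin_le_nhds (G.cont.2.2.continuousAt.eventually_lt_const hlt)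
  rcases le_or_gt ν (m t0) with hl | hl
  · exfalso
    obtain ⟨s, hs, has⟩ := (hev.and self_mem_nhdsWithin).exists
    have has : a < s := has
    exact hext s has (G.D_eq S hε htq (by linarith) (G.low_cand S h0 hl hq s (by linarith)) (hθ0 s (by linarith)) hs.le)
  have hνq : ν ≤ m |tq| := by rw [S.abs_eq]; have := G.le S 0; rwa [G.z] at this
  obtain ⟨b, hb1, hb2, hb3⟩ := S.exists_eq (abs_nonneg tq) hq.le hl.le hνq
  have hb : b ∈ Ioo 0 t0 := ⟨(abs_pos.2 htq).trans_le hb1, lt_of_le_of_ne hb2 fun e => by rw [e] at hb3; linarith⟩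
  obtain ⟨c, hc0, htc, hcand, hθc, hafter⟩ := G.osc' S hb hb3.symm hb1
  rcases lt_trichotomy a c with hac | hac | hac
  · exfalso
    obtain ⟨s, hs, has, hsc⟩ := (hev.and (Ioo_mem_nhdsGT hac)).exists
    exact hext s has (G.D_eq S hε htq (by linarith) (hcand s ⟨by linarith, hsc.le⟩) (hθ0 s (by linarith)) hs.le)
  · right
    subst hac
    refine ⟨htc, ?_⟩
    have hmono : phi m (m tq) ≤ θ a := by
      rw [hθc, ← hb3, ← S.abs_eq tq]
      exact S.phi_mono (⟨abs_pos.2 htq, hq⟩ : |tq| ∈ Ioo 0 t0) hb hb1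
    rcases hε' with h | h
    · exact ⟨θ a, hmono, by linarith, by rw [h, one_mul]⟩
    · refine ⟨2 * π - θ a, by linarith, by linarith, ?_⟩
      rw [h, neg_one_mul, Real.Angle.coe_sub, Real.Angle.coe_two_pi, zero_sub, Real.Angle.coe_neg]
  · exfalso
    obtain ⟨g1, g2⟩ := hafter a hac
    exact (G.D_lt_osc S hε htq hb hb3.symm hb1 ha g1 g2).ne hmin

lemma main_sup (S : Shape m t0) (G : Geo m tq ν t v θ) (hε : |ε| = 1) (h0 : 0 ≤ ν) (htq : tq ≠ 0) {a : ℝ} (ha : 0 < a)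
    (hC : Cand m t0 tq (t a) (θ a) ν a) (hθ : θ a ≤ π)
    (hext : ∀ s, a < s → cylDist m (tq, ((0:ℝ) : Real.Angle)) (t s, ((ε * θ s : ℝ) : Real.Angle)) < s) :
    (t a, ((ε * θ a : ℝ) : Real.Angle)) ∈ cylCutLocus m (tq, ((0:ℝ) : Real.Angle)) := by
  refine ⟨fun s => proj (t s, ε * θ s), a, ⟨_, (G.geod S hε).1, rfl⟩, G.base, ha, rfl, ?_, ?_⟩
  · unfold IsCylMinimalSeg
    simp only [G.base]
    exact G.D_eq S hε htq ha.le hC (by rw [← G.zθ]; exact G.θ_mono S h0 ha.le) hθ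
  · intro δ hδ hcon
    unfold IsCylMinimalSeg at hcon
    simp only [G.base] at hcon
    exact (hext (a + δ) (by linarith)).ne hcon

end Geo

lemma Shape.arc_mem {m : ℝ → ℝ} {t0 tq ε : ℝ} (S : Shape m t0) (hε : |ε| = 1) (htq : tq ≠ 0) (hq : |tq| < t0)
    {x : ℝ} (hx : phi m (m tq) ≤ x) (hxπ : x ≤ π) :
    (-tq, ((ε * x : ℝ) : Real.Angle)) ∈ cylCutLocus m (tq, ((0:ℝ) : Real.Angle)) := by
  obtain ⟨b, hb, hqb, hbx⟩ := S.exists_phi (y := x) (⟨abs_pos.2 htq, hq⟩ : |tq| ∈ Ioo 0 t0) (by rw [S.abs_eq]; exact hx)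
  obtain ⟨t, v, θ, G, -⟩ := S.geo_exists (tq := tq) (S.pos b).le (S.le_of (by rwa [abs_of_pos hb.1])
    (by rw [abs_of_pos hb.1]; exact hb.2.le))
  obtain ⟨c, hc0, htc, hcand, hθc, hafter⟩ := G.osc' S hb rfl hqb
  have := G.main_sup S hε (S.pos b).le htq hc0 (hcand c ⟨hc0.le, le_rfl⟩) (by rw [hθc, hbx]; exact hxπ) (fun s hs => by
    obtain ⟨g1, g2⟩ := hafter s hs
    exact G.D_lt_osc S hε htq hb rfl hqb (by linarith) g1 g2)
  rwa [htc, hθc, hbx] at this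

lemma Shape.meridian_mem {m : ℝ → ℝ} {t0 tq : ℝ} (S : Shape m t0) (htq : tq ≠ 0) (hq : |tq| < t0) (x : ℝ) :
    (x, ((π : ℝ) : Real.Angle)) ∈ cylCutLocus m (tq, ((0:ℝ) : Real.Angle)) := by
  obtain ⟨ν, hν, t, v, θ, s, G, hs, e1, e2, hC⟩ := S.hit htq hq x pi_pos
  have := G.main_sup S (ε := 1) (by simp) hν.le htq hs (by rw [e1, e2]; exact hC) e2.le (fun r hr =>
    G.D_lt S (by simp) hν (hs.trans hr) (e2 ▸ G.θ_strict S hν hr))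
  rwa [e1, e2, one_mul] at this

end

/-- Main theorem, case 1: let `q = (t(q), 0)` on the cylinder `M` with
`0 < |t(q)| < t₀` and `φ(m(t(q))) < π`.  Then the cut locus of `q` is the union of the
opposite meridian `θ⁻¹(π)` and the subarc
`t⁻¹(-t(q)) ∩ θ⁻¹([φ(m(t(q))), 2π - φ(m(t(q)))])` of the opposite parallel. -/
theorem stmt18 (m : ℝ → ℝ) (hm : ContDiff ℝ (⊤:ℕ∞) m) (hmpos : ∀ t, 0 < m t)
    (hmeven : ∀ t, m (-t) = m t)
    (hK0 : 0 < gaussK m 0) (hKdec : AntitoneOn (gaussK m) (Ici 0))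
    (tq : ℝ) (htq0 : 0 < |tq|) (htq : |tq| < tZero m)
    (hphi : phi m (m tq) < π) :
    cylCutLocus m (tq, ((0:ℝ) : Real.Angle)) =
      {P : ℝ × Real.Angle | P.2 = ((π:ℝ) : Real.Angle)} ∪
      ({P : ℝ × Real.Angle | P.1 = -tq} ∩
        {P : ℝ × Real.Angle | ∃ x : ℝ, phi m (m tq) ≤ x ∧ x ≤ 2 * π - phi m (m tq) ∧
          P.2 = (x : Real.Angle)}) := by
  have S := shape_of_hyp m hm hmpos hmeven hK0 hKdec (htq0.trans htq)
  have hne : tq ≠ 0 := abs_pos.1 htq0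
  apply Set.Subset.antisymm
  · rintro X ⟨γ, a, ⟨γ', hγ', rfl⟩, hbase, ha, rfl, hmin, hext⟩
    obtain ⟨ν, ε, h0, hε, -, G⟩ := geo_of S hγ'
    simp only [proj, Prod.mk.injEq] at hbase
    have hε2 : ε * ε = 1 := by rw [← abs_mul_abs_self, hε, one_mul]
    have hang : ∀ s, proj (γ' s) = ((γ' s).1, ((ε * (ε * ((γ' s).2 - (γ' 0).2)) : ℝ) : Real.Angle)) := by
      intro s
      rw [← mul_assoc, hε2, one_mul, Real.Angle.coe_sub, hbase.2]
      simp [proj]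
    have hb0 : proj (γ' 0) = (tq, ((0:ℝ) : Real.Angle)) := by
      simp only [proj, hbase]
    rw [hbase.1] at G
    unfold IsCylMinimalSeg at hmin hext
    simp only [hb0] at hmin hext
    rw [hang] at hmin
    have := G.main_sub S hε h0 hne htq hphi ha hmin (fun s hs => by
      have := hext (s - a) (by linarith)
      rw [add_sub_cancel, hang] at this
      exact this)
    simp only [hang]
    rcases this with h | h
    · exact Or.inl h
    · exact Or.inr ⟨h.1, h.2⟩
  · rintro ⟨p, A⟩ (h | ⟨h1, x, hx1, hx2, hx3⟩)
    · have h : A = ((π:ℝ) : Real.Angle) := h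
      rw [h]
      exact S.meridian_mem hne htq p
    · have h1 : p = -tq := h1
      have hx3 : A = (x : Real.Angle) := hx3
      rw [h1, hx3]
      rcases le_total x π with h | h
      · have := S.arc_mem (ε := 1) (by simp) hne htq hx1 h
        rwa [one_mul] at this
      · have := S.arc_mem (ε := -1) (x := 2 * π - x) (by simp) hne htq (by linarith) (by linarith)
        rwa [show -1 * (2 * π - x) = x - 2 * π by ring, Real.Angle.coe_sub, Real.Angle.coe_two_pi, sub_zero] at this
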